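/- arXiv:math/0403079 — 3 statements merged into one kernel-verified Lean document; each statement's English description precedes it below -/
import Mathlib

section
/- Let h₁, h₂ be functions of one variable holomorphic near 0 ∈ ℂ with h₁(0) = h₂(0) = μ, and assume μ is not a negative rational number. Set X_{h_i} = x²∂x + (y + x·y·h_i(y))∂y for i = 1, 2. If X_{h₁} and X_{h₂} are analytically equivalent as singular foliations at 0 ∈ ℂ², then they are conjugated by a homothety in the second variable: there exists c ∈ ℂ, c ≠ 0, such that h₂(y) = h₁(y/c) for all y near 0 (equivalently, the biholomorphism (x,y) ↦ (x, c·y) carries X_{h₁} to X_{h₂}). -/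
open Filter

/-- Two germs at `0` of holomorphic vector fields on `ℂ × ℂ` (a vector field
`a ∂x + b ∂y` being identified with the map `p ↦ (a p, b p)`) are *analytically
equivalent as singular foliations* if a germ of biholomorphism `Φ` fixing `0`
carries the first to a nonvanishing holomorphic multiple of the second. -/
def FoliationEquiv (X X' : ℂ × ℂ → ℂ × ℂ) : Prop :=
  ∃ (Φ : ℂ × ℂ → ℂ × ℂ) (u : ℂ × ℂ → ℂ),
    AnalyticAt ℂ Φ 0 ∧ Φ 0 = 0 ∧
    LinearMap.det ((fderiv ℂ Φ 0).toLinearMap) ≠ 0 ∧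
    AnalyticAt ℂ u 0 ∧ u 0 ≠ 0 ∧
    ∀ᶠ p in nhds (0 : ℂ × ℂ), fderiv ℂ Φ p (X p) = u p • X' (Φ p)

namespace SaddleNode

open PowerSeries
open scoped ENNReal Topology PowerSeries.WithPiTopology
open Finset.HasAntidiagonal (antidiagonal)

section

/-- Coefficientwise application of `d/dx` to a power series in `y` over `ℂ⟦x⟧`. -/
noncomputable def derivInner (f : ℂ⟦X⟧⟦X⟧) : ℂ⟦X⟧⟦X⟧ :=
  PowerSeries.mk fun j => d⁄dX ℂ (coeff j f)

/-- The derivation `d/dy` of `ℂ⟦x⟧⟦y⟧`. -/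
noncomputable def derivOuter (f : ℂ⟦X⟧⟦X⟧) : ℂ⟦X⟧⟦X⟧ := d⁄dX ℂ⟦X⟧ f

theorem derivInner_mul (f g : ℂ⟦X⟧⟦X⟧) :
    derivInner (f * g) = derivInner f * g + f * derivInner g := by
  ext1 j
  simp only [derivInner, coeff_mk, coeff_mul, map_sum, map_add,
    Derivation.leibniz, smul_eq_mul, Finset.sum_add_distrib]
  rw [add_comm]
  congr 1
  exact Finset.sum_congr rfl fun _ _ => mul_comm _ _

theorem derivOuter_mul (f g : ℂ⟦X⟧⟦X⟧) :
    derivOuter (f * g) = derivOuter f * g + f * derivOuter g := by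
  simp only [derivOuter, Derivation.leibniz, smul_eq_mul]
  ring

/-- The coefficient of `x ^ i * y ^ j`. -/
noncomputable def cf (f : ℂ⟦X⟧⟦X⟧) (i j : ℕ) : ℂ := coeff i (coeff j f)

theorem ext_cf {f g : ℂ⟦X⟧⟦X⟧} (h : ∀ i j, cf f i j = cf g i j) : f = g := by
  ext j i; exact h i j

@[simp] theorem cf_add (f g : ℂ⟦X⟧⟦X⟧) (i j : ℕ) : cf (f + g) i j = cf f i j + cf g i j := by
  simp [cf]
@[simp] theorem cf_sub (f g : ℂ⟦X⟧⟦X⟧) (i j : ℕ) : cf (f - g) i j = cf f i j - cf g i j := by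
  simp [cf]
@[simp] theorem cf_neg (f : ℂ⟦X⟧⟦X⟧) (i j : ℕ) : cf (-f) i j = -cf f i j := by
  simp [cf]
@[simp] theorem cf_zero (i j : ℕ) : cf 0 i j = 0 := by
  simp [cf]
@[simp] theorem cf_smul (c : ℂ) (f : ℂ⟦X⟧⟦X⟧) (i j : ℕ) : cf (c • f) i j = c * cf f i j := by
  rfl

theorem cf_mul (f g : ℂ⟦X⟧⟦X⟧) (i j : ℕ) : cf (f * g) i j =
    ∑ b ∈ antidiagonal j, ∑ a ∈ antidiagonal i,
      cf f a.1 b.1 * cf g a.2 b.2 := by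
  simp [cf, coeff_mul]

theorem cf_derivInner (f : ℂ⟦X⟧⟦X⟧) (i j : ℕ) :
    cf (derivInner f) i j = (i + 1) * cf f (i + 1) j := by
  rw [cf, derivInner, coeff_mk, coeff_derivative, cf]
  ring

theorem cf_derivOuter (f : ℂ⟦X⟧⟦X⟧) (i j : ℕ) :
    cf (derivOuter f) i j = (j + 1) * cf f i (j + 1) := by
  change coeff i (coeff j (d⁄dX ℂ⟦X⟧ f)) = _
  rw [coeff_derivative]
  have : ((j : ℂ⟦X⟧) + 1) = C ((j : ℂ) + 1) := by simp
  rw [this, coeff_mul_C, cf]; ring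

/-- The variable `x`. -/
noncomputable def vx : ℂ⟦X⟧⟦X⟧ := C X

@[simp] theorem cf_X_mul_succ (f : ℂ⟦X⟧⟦X⟧) (i j : ℕ) : cf (X * f) i (j + 1) = cf f i j := by
  simp [cf, coeff_succ_X_mul]
@[simp] theorem cf_X_mul_zero (f : ℂ⟦X⟧⟦X⟧) (i : ℕ) : cf (X * f) i 0 = 0 := by
  simp [cf]
@[simp] theorem cf_vx_mul_succ (f : ℂ⟦X⟧⟦X⟧) (i j : ℕ) : cf (vx * f) (i + 1) j = cf f i j := by
  simp [cf, vx, coeff_C_mul, coeff_succ_X_mul]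
@[simp] theorem cf_vx_mul_zero (f : ℂ⟦X⟧⟦X⟧) (j : ℕ) : cf (vx * f) 0 j = 0 := by
  simp [cf, vx, coeff_C_mul]

@[simp] theorem derivOuter_X : derivOuter X = 1 := by
  simp [derivOuter]
@[simp] theorem derivOuter_vx : derivOuter vx = 0 := by
  simp [derivOuter, vx]
@[simp] theorem derivInner_X : derivInner X = 0 := by
  refine ext_cf fun i j => ?_
  rw [cf_derivInner]
  simp only [cf, coeff_X]
  split_ifs <;> simp [coeff_one]
@[simp] theorem derivInner_vx : derivInner vx = 1 := by
  refine ext_cf fun i j => ?_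
  rw [cf_derivInner]
  simp only [cf, vx, coeff_C, coeff_one]
  split_ifs with h1
  · simp only [coeff_X, coeff_one]
    rcases i with _ | i <;> simp
  · simp

/-! ### Weighted `ℓ¹` norms -/

/-- The weighted `ℓ¹` norm at radius `exp t`. -/
noncomputable def nrm (t : ℝ) (f : ℂ⟦X⟧⟦X⟧) : ℝ≥0∞ :=
  ∑' j : ℕ, ∑' i : ℕ, ‖cf f i j‖ₑ * ENNReal.ofReal (Real.exp (t * (i + j)))

theorem tsum_sum_antidiagonal_mul (u v : ℕ → ℝ≥0∞) :
    ∑' n, ∑ p ∈ antidiagonal n, u p.1 * v p.2 = (∑' n, u n) * ∑' n, v n := by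
  have h : ∑' n, ∑ p ∈ antidiagonal n, u p.1 * v p.2 = ∑' p : ℕ × ℕ, u p.1 * v p.2 := by
    rw [← (Finset.HasAntidiagonal.sigmaAntidiagonalEquivProd (A := ℕ)).tsum_eq
      (fun p : ℕ × ℕ => u p.1 * v p.2), ENNReal.tsum_sigma']
    congr 1; ext n
    rw [tsum_fintype, ← Finset.sum_coe_sort]
    rfl
  rw [h, ENNReal.tsum_prod (f := fun a b => u a * v b), ← ENNReal.tsum_mul_right]
  simp_rw [ENNReal.tsum_mul_left]

theorem nrm_mul_le (t : ℝ) (f g : ℂ⟦X⟧⟦X⟧) : nrm t (f * g) ≤ nrm t f * nrm t g := by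
  set w : ℕ → ℕ → ℝ≥0∞ := fun i j => ENNReal.ofReal (Real.exp (t * (i + j)))
  have key : ∀ i j, ‖cf (f * g) i j‖ₑ * w i j ≤
      ∑ b ∈ antidiagonal j, ∑ a ∈ antidiagonal i,
        (‖cf f a.1 b.1‖ₑ * w a.1 b.1) * (‖cf g a.2 b.2‖ₑ * w a.2 b.2) := by
    intro i j
    rw [cf_mul]
    refine (mul_le_mul_left (enorm_sum_le _ _) _).trans ?_
    rw [Finset.sum_mul]
    refine Finset.sum_le_sum fun b hb => ?_
    refine (mul_le_mul_left (enorm_sum_le _ _) _).trans ?_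
    rw [Finset.sum_mul]
    refine Finset.sum_le_sum fun a ha => ?_
    have hw : w i j = w a.1 b.1 * w a.2 b.2 := by
      simp only [w]
      rw [← ENNReal.ofReal_mul (Real.exp_nonneg _), ← Real.exp_add]
      rw [← Finset.HasAntidiagonal.mem_antidiagonal.1 ha, ← Finset.HasAntidiagonal.mem_antidiagonal.1 hb]
      push_cast; ring_nf
    rw [hw, enorm_mul]
    exact le_of_eq (by ring)
  calc nrm t (f * g) ≤ ∑' j : ℕ, ∑' i : ℕ, ∑ b ∈ antidiagonal j,
        ∑ a ∈ antidiagonal i,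
        (‖cf f a.1 b.1‖ₑ * w a.1 b.1) * (‖cf g a.2 b.2‖ₑ * w a.2 b.2) :=
        ENNReal.tsum_le_tsum fun j => ENNReal.tsum_le_tsum fun i => key i j
    _ = ∑' j : ℕ, ∑ b ∈ antidiagonal j, ∑' i : ℕ,
        ∑ a ∈ antidiagonal i,
        (‖cf f a.1 b.1‖ₑ * w a.1 b.1) * (‖cf g a.2 b.2‖ₑ * w a.2 b.2) := by
        congr 1; ext j
        exact Summable.tsum_finsetSum fun _ _ => ENNReal.summable
    _ = ∑' j : ℕ, ∑ b ∈ antidiagonal j,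
          (∑' i, ‖cf f i b.1‖ₑ * w i b.1) * (∑' i, ‖cf g i b.2‖ₑ * w i b.2) := by
        congr 1; ext j
        refine Finset.sum_congr rfl fun b _ => ?_
        exact tsum_sum_antidiagonal_mul (fun i => ‖cf f i b.1‖ₑ * w i b.1)
          fun i => ‖cf g i b.2‖ₑ * w i b.2
    _ = nrm t f * nrm t g :=
        tsum_sum_antidiagonal_mul (fun j => ∑' i, ‖cf f i j‖ₑ * w i j)
          fun j => ∑' i, ‖cf g i j‖ₑ * w i j

theorem nrm_add_le (t : ℝ) (f g : ℂ⟦X⟧⟦X⟧) : nrm t (f + g) ≤ nrm t f + nrm t g := by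
  unfold nrm
  rw [← ENNReal.tsum_add]
  refine ENNReal.tsum_le_tsum fun j => ?_
  rw [← ENNReal.tsum_add]
  refine ENNReal.tsum_le_tsum fun i => ?_
  rw [← add_mul, cf_add]
  gcongr
  exact enorm_add_le _ _

theorem nrm_neg (t : ℝ) (f : ℂ⟦X⟧⟦X⟧) : nrm t (-f) = nrm t f := by
  simp [nrm]

theorem nrm_smul (t : ℝ) (c : ℂ) (f : ℂ⟦X⟧⟦X⟧) : nrm t (c • f) = ‖c‖ₑ * nrm t f := by
  unfold nrm
  simp_rw [cf_smul, enorm_mul, mul_assoc, ENNReal.tsum_mul_left]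

theorem nrm_mono {s t : ℝ} (h : s ≤ t) (f : ℂ⟦X⟧⟦X⟧) : nrm s f ≤ nrm t f := by
  unfold nrm
  gcongr

theorem nrm_one_le (t : ℝ) : nrm t 1 ≤ 1 := by
  unfold nrm
  rw [tsum_eq_single 0, tsum_eq_single 0]
  · simp [cf]
  · intro i hi; simp [cf, coeff_one, hi]
  · intro j hj; simp [cf, coeff_one, hj]

theorem nrm_pow_le (t : ℝ) (f : ℂ⟦X⟧⟦X⟧) (k : ℕ) : nrm t (f ^ k) ≤ nrm t f ^ k := by
  induction k with
  | zero => simpa using nrm_one_le t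
  | succ k ih => rw [pow_succ, pow_succ]; exact (nrm_mul_le _ _ _).trans (by gcongr)

theorem cf_le_nrm (t : ℝ) (f : ℂ⟦X⟧⟦X⟧) (i j : ℕ) :
    ‖cf f i j‖ₑ * ENNReal.ofReal (Real.exp (t * (i + j))) ≤ nrm t f :=
  (ENNReal.le_tsum (f := fun i : ℕ => ‖cf f i j‖ₑ * ENNReal.ofReal (Real.exp (t * (i + j)))) i).trans
    (ENNReal.le_tsum (f := fun j : ℕ => ∑' i : ℕ, ‖cf f i j‖ₑ *
      ENNReal.ofReal (Real.exp (t * (i + j)))) j)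

theorem cf_vx_mul_derivInner (f : ℂ⟦X⟧⟦X⟧) (i j : ℕ) :
    cf (vx * derivInner f) i j = i * cf f i j := by
  cases i with
  | zero => simp
  | succ i => simp [cf_derivInner]

theorem cf_X_mul_derivOuter (f : ℂ⟦X⟧⟦X⟧) (i j : ℕ) :
    cf (X * derivOuter f) i j = j * cf f i j := by
  cases j with
  | zero => simp
  | succ j => simp [cf_derivOuter]

theorem nrm_le_of_cf_le {t ε : ℝ} (hε : 0 < ε) {f g : ℂ⟦X⟧⟦X⟧}
    (h : ∀ i j, ‖cf g i j‖ ≤ (i + j : ℕ) * ‖cf f i j‖) :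
    nrm t g ≤ ENNReal.ofReal (1 / ε) * nrm (t + ε) f := by
  unfold nrm
  rw [← ENNReal.tsum_mul_left]
  refine ENNReal.tsum_le_tsum fun j => ?_
  rw [← ENNReal.tsum_mul_left]
  refine ENNReal.tsum_le_tsum fun i => ?_
  rw [← ofReal_norm, ← ofReal_norm, ← ENNReal.ofReal_mul (norm_nonneg _),
    ← ENNReal.ofReal_mul (norm_nonneg _), ← ENNReal.ofReal_mul (by positivity)]
  refine ENNReal.ofReal_le_ofReal ?_
  have h1 : ((i + j : ℕ) : ℝ) ≤ 1 / ε * Real.exp (ε * (i + j)) := by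
    have := Real.add_one_le_exp (ε * (i + j))
    rw [div_mul_eq_mul_div, le_div_iff₀ hε]
    push_cast; nlinarith
  calc ‖cf g i j‖ * Real.exp (t * (i + j))
      ≤ (1 / ε * Real.exp (ε * (i + j)) * ‖cf f i j‖) * Real.exp (t * (i + j)) := by
        gcongr
        exact (h i j).trans (by gcongr)
    _ = _ := by rw [add_mul, Real.exp_add]; ring

theorem nrm_euler_le {t ε : ℝ} (hε : 0 < ε) (α β f : ℂ⟦X⟧⟦X⟧) :
    nrm t (α * (vx * derivInner f) + β * (X * derivOuter f)) ≤
      (nrm t α + nrm t β) * ENNReal.ofReal (1 / ε) * nrm (t + ε) f := by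
  refine (nrm_add_le _ _ _).trans ?_
  rw [add_mul, add_mul, mul_assoc, mul_assoc]
  gcongr
  · refine (nrm_mul_le _ _ _).trans (mul_le_mul_right (nrm_le_of_cf_le hε fun i j => ?_) _)
    rw [cf_vx_mul_derivInner, norm_mul, Complex.norm_natCast]
    gcongr; simp
  · refine (nrm_mul_le _ _ _).trans (mul_le_mul_right (nrm_le_of_cf_le hε fun i j => ?_) _)
    rw [cf_X_mul_derivOuter, norm_mul, Complex.norm_natCast]
    gcongr; simp

end

section

/-! ### Summable families of double power series -/

theorem hasSum_iff_cf {ι : Type*} {f : ι → ℂ⟦X⟧⟦X⟧} {S : ℂ⟦X⟧⟦X⟧} :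
    HasSum f S ↔ ∀ i j, HasSum (fun k => cf (f k) i j) (cf S i j) := by
  simp_rw [WithPiTopology.hasSum_iff_hasSum_coeff]
  exact ⟨fun h i j => h j i, fun h j i => h i j⟩

theorem summable_of_cf {ι : Type*} {f : ι → ℂ⟦X⟧⟦X⟧}
    (h : ∀ i j, Summable (fun k => cf (f k) i j)) : Summable f := by
  refine ⟨PowerSeries.mk fun j => PowerSeries.mk fun i => ∑' k, cf (f k) i j,
    hasSum_iff_cf.2 fun i j => ?_⟩
  simpa [cf] using (h i j).hasSum

theorem cf_tsum {ι : Type*} {f : ι → ℂ⟦X⟧⟦X⟧} (h : Summable f) (i j : ℕ) :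
    cf (∑' k, f k) i j = ∑' k, cf (f k) i j :=
  ((hasSum_iff_cf.1 h.hasSum i j).tsum_eq).symm

theorem summable_of_nrm {ι : Type*} {f : ι → ℂ⟦X⟧⟦X⟧} {t : ℝ} (h : ∑' k, nrm t (f k) ≠ ⊤) :
    Summable f := by
  refine summable_of_cf fun i j => Summable.of_enorm fun htop => h ?_
  have hw : ENNReal.ofReal (Real.exp (t * (i + j))) ≠ 0 := by
    simpa using Real.exp_pos _
  have : ∑' k, ‖cf (f k) i j‖ₑ * ENNReal.ofReal (Real.exp (t * (i + j))) ≤ ∑' k, nrm t (f k) :=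
    ENNReal.tsum_le_tsum fun k => cf_le_nrm t (f k) i j
  rw [ENNReal.tsum_mul_right, htop, ENNReal.top_mul hw] at this
  exact top_le_iff.1 this

theorem nrm_tsum_le {ι : Type*} {f : ι → ℂ⟦X⟧⟦X⟧} {t : ℝ} (h : ∑' k, nrm t (f k) ≠ ⊤) :
    nrm t (∑' k, f k) ≤ ∑' k, nrm t (f k) := by
  have hs := summable_of_nrm h
  calc nrm t (∑' k, f k) ≤ ∑' j : ℕ, ∑' i : ℕ, ∑' k, ‖cf (f k) i j‖ₑ *
        ENNReal.ofReal (Real.exp (t * (i + j))) := by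
        unfold nrm
        refine ENNReal.tsum_le_tsum fun j => ENNReal.tsum_le_tsum fun i => ?_
        rw [cf_tsum hs, ENNReal.tsum_mul_right]
        gcongr
        exact enorm_tsum_le_tsum_enorm
    _ = ∑' j : ℕ, ∑' k, ∑' i : ℕ, ‖cf (f k) i j‖ₑ *
        ENNReal.ofReal (Real.exp (t * (i + j))) := by
        congr 1; ext j; exact ENNReal.tsum_comm
    _ = _ := ENNReal.tsum_comm

theorem tsum_mul_tsum_of_nrm {f g : ℕ → ℂ⟦X⟧⟦X⟧} {t : ℝ} (hf : ∑' k, nrm t (f k) ≠ ⊤)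
    (hg : ∑' k, nrm t (g k) ≠ ⊤) :
    (∑' n, f n) * ∑' n, g n = ∑' n, ∑ p ∈ antidiagonal n, f p.1 * g p.2 := by
  refine (summable_of_nrm hf).tsum_mul_tsum_eq_tsum_sum_antidiagonal (summable_of_nrm hg)
    (summable_of_nrm (t := t) ?_)
  refine ne_top_of_le_ne_top (ENNReal.mul_ne_top hf hg) ?_
  calc ∑' p : ℕ × ℕ, nrm t (f p.1 * g p.2) ≤ ∑' p : ℕ × ℕ, nrm t (f p.1) * nrm t (g p.2) :=
        ENNReal.tsum_le_tsum fun p => nrm_mul_le _ _ _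
    _ = _ := by
        rw [ENNReal.tsum_prod (f := fun a b => nrm t (f a) * nrm t (g b)),
          ← ENNReal.tsum_mul_right]
        simp_rw [ENNReal.tsum_mul_left]

/-! ### Convergent double power series -/

/-- A double power series is convergent if some weighted `ℓ¹` norm is finite. -/
def Conv (f : ℂ⟦X⟧⟦X⟧) : Prop := ∃ t, nrm t f ≠ ⊤

theorem nrm_ne_top_of_le {s t : ℝ} (h : s ≤ t) {f : ℂ⟦X⟧⟦X⟧} (hf : nrm t f ≠ ⊤) :
    nrm s f ≠ ⊤ := ne_top_of_le_ne_top hf (nrm_mono h f)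

theorem Conv.add {f g : ℂ⟦X⟧⟦X⟧} (hf : Conv f) (hg : Conv g) : Conv (f + g) := by
  obtain ⟨s, hs⟩ := hf
  obtain ⟨t, ht⟩ := hg
  exact ⟨min s t, ne_top_of_le_ne_top (ENNReal.add_ne_top.2
    ⟨nrm_ne_top_of_le (min_le_left _ _) hs, nrm_ne_top_of_le (min_le_right _ _) ht⟩)
    (nrm_add_le _ _ _)⟩

theorem Conv.mul {f g : ℂ⟦X⟧⟦X⟧} (hf : Conv f) (hg : Conv g) : Conv (f * g) := by
  obtain ⟨s, hs⟩ := hf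
  obtain ⟨t, ht⟩ := hg
  exact ⟨min s t, ne_top_of_le_ne_top (ENNReal.mul_ne_top
    (nrm_ne_top_of_le (min_le_left _ _) hs) (nrm_ne_top_of_le (min_le_right _ _) ht))
    (nrm_mul_le _ _ _)⟩

theorem Conv.neg {f : ℂ⟦X⟧⟦X⟧} (hf : Conv f) : Conv (-f) := by
  obtain ⟨s, hs⟩ := hf
  exact ⟨s, by rwa [nrm_neg]⟩

theorem Conv.sub {f g : ℂ⟦X⟧⟦X⟧} (hf : Conv f) (hg : Conv g) : Conv (f - g) := by
  rw [sub_eq_add_neg]; exact hf.add hg.neg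

theorem Conv.smul {f : ℂ⟦X⟧⟦X⟧} (c : ℂ) (hf : Conv f) : Conv (c • f) := by
  obtain ⟨s, hs⟩ := hf
  exact ⟨s, by rw [nrm_smul]; exact ENNReal.mul_ne_top enorm_ne_top hs⟩

theorem conv_one : Conv 1 := ⟨0, ne_top_of_le_ne_top ENNReal.one_ne_top (nrm_one_le 0)⟩

/-! ### Euler vector fields and their Lie series -/

/-- The derivation `α · x∂x + β · y∂y`. -/
noncomputable def euler (α β f : ℂ⟦X⟧⟦X⟧) : ℂ⟦X⟧⟦X⟧ :=
  α * (vx * derivInner f) + β * (X * derivOuter f)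

theorem derivInner_add (f g : ℂ⟦X⟧⟦X⟧) : derivInner (f + g) = derivInner f + derivInner g :=
  ext_cf fun i j => by simp only [cf_derivInner, cf_add]; ring

theorem derivOuter_add (f g : ℂ⟦X⟧⟦X⟧) : derivOuter (f + g) = derivOuter f + derivOuter g :=
  ext_cf fun i j => by simp only [cf_derivOuter, cf_add]; ring

theorem derivInner_smul (c : ℂ) (f : ℂ⟦X⟧⟦X⟧) : derivInner (c • f) = c • derivInner f :=
  ext_cf fun i j => by simp only [cf_derivInner, cf_smul]; ring

theorem derivOuter_smul (c : ℂ) (f : ℂ⟦X⟧⟦X⟧) : derivOuter (c • f) = c • derivOuter f :=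
  ext_cf fun i j => by simp only [cf_derivOuter, cf_smul]; ring

theorem smul_eq_C_mul (c : ℂ) (f : ℂ⟦X⟧⟦X⟧) : c • f = C (C c) * f :=
  ext_cf fun i j => by simp [cf, coeff_C_mul]

theorem mul_smul' (c : ℂ) (f g : ℂ⟦X⟧⟦X⟧) : f * (c • g) = c • (f * g) := by
  rw [smul_eq_C_mul, smul_eq_C_mul]; ring

theorem smul_mul' (c : ℂ) (f g : ℂ⟦X⟧⟦X⟧) : (c • f) * g = c • (f * g) := by
  rw [smul_eq_C_mul, smul_eq_C_mul]; ring

variable (α β : ℂ⟦X⟧⟦X⟧)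

theorem euler_add (f g : ℂ⟦X⟧⟦X⟧) : euler α β (f + g) = euler α β f + euler α β g := by
  simp only [euler, derivInner_add, derivOuter_add]; ring

theorem euler_smul (c : ℂ) (f : ℂ⟦X⟧⟦X⟧) : euler α β (c • f) = c • euler α β f := by
  simp only [euler, derivInner_smul, derivOuter_smul]
  simp only [smul_eq_C_mul]
  ring

theorem euler_mul (f g : ℂ⟦X⟧⟦X⟧) :
    euler α β (f * g) = euler α β f * g + f * euler α β g := by
  simp only [euler, derivInner_mul, derivOuter_mul]; ring

theorem hasSum_euler {ι : Type*} {f : ι → ℂ⟦X⟧⟦X⟧} {S : ℂ⟦X⟧⟦X⟧} (h : HasSum f S) :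
    HasSum (fun k => euler α β (f k)) (euler α β S) := by
  refine ((HasSum.mul_left _ (HasSum.mul_left _ (hasSum_iff_cf.2 fun i j => ?_))).add
    (HasSum.mul_left _ (HasSum.mul_left _ (hasSum_iff_cf.2 fun i j => ?_))))
  · simp only [cf_derivInner]
    exact (hasSum_iff_cf.1 h _ _).mul_left _
  · simp only [cf_derivOuter]
    exact (hasSum_iff_cf.1 h _ _).mul_left _

/-- The `k`-th Taylor coefficient of the flow of `euler α β`. -/
noncomputable def lam (k : ℕ) (f : ℂ⟦X⟧⟦X⟧) : ℂ⟦X⟧⟦X⟧ :=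
  ((k.factorial : ℂ)⁻¹) • (euler α β)^[k] f

theorem lam_zero (f : ℂ⟦X⟧⟦X⟧) : lam α β 0 f = f := by simp [lam]

theorem succ_smul_lam (k : ℕ) (f : ℂ⟦X⟧⟦X⟧) :
    ((k : ℂ) + 1) • lam α β (k + 1) f = lam α β k (euler α β f) := by
  have h1 : ((k : ℂ) + 1) ≠ 0 := by exact_mod_cast k.succ_ne_zero
  refine ext_cf fun i j => ?_
  simp only [lam, cf_smul, Function.iterate_succ_apply, Nat.factorial_succ]
  push_cast
  field_simp

theorem euler_lam (k : ℕ) (f : ℂ⟦X⟧⟦X⟧) :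
    euler α β (lam α β k f) = lam α β k (euler α β f) := by
  rw [lam, euler_smul, ← Function.iterate_succ_apply' (euler α β), Function.iterate_succ_apply, lam]

theorem lam_add (k : ℕ) (f g : ℂ⟦X⟧⟦X⟧) :
    lam α β k (f + g) = lam α β k f + lam α β k g := by
  have : (euler α β)^[k] (f + g) = (euler α β)^[k] f + (euler α β)^[k] g := by
    induction k with
    | zero => rfl
    | succ k ih => simp only [Function.iterate_succ_apply', ih, euler_add]
  rw [lam, this, lam, lam]
  exact ext_cf fun i j => by simp only [cf_smul, cf_add]; ring

theorem lam_mul (k : ℕ) (f g : ℂ⟦X⟧⟦X⟧) :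
    lam α β k (f * g) = ∑ p ∈ antidiagonal k, lam α β p.1 f * lam α β p.2 g := by
  induction k generalizing f g with
  | zero => simp [lam_zero]
  | succ k ih =>
    have h1 : ((k : ℂ) + 1) ≠ 0 := by exact_mod_cast k.succ_ne_zero
    have hinj : Function.Injective fun f : ℂ⟦X⟧⟦X⟧ => ((k : ℂ) + 1) • f := by
      intro f g h
      refine ext_cf fun i j => ?_
      have := congrArg (fun f => cf f i j) h
      simpa [h1] using this
    apply hinj
    have hA : ∑ p ∈ antidiagonal (k + 1), (p.1 : ℂ) • (lam α β p.1 f * lam α β p.2 g) =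
        ∑ p ∈ antidiagonal k, lam α β p.1 (euler α β f) * lam α β p.2 g := by
      rw [Finset.Nat.sum_antidiagonal_succ]
      simp only [← succ_smul_lam, smul_mul']
      simp [smul_eq_C_mul]
    have hB : ∑ p ∈ antidiagonal (k + 1), (p.2 : ℂ) • (lam α β p.1 f * lam α β p.2 g) =
        ∑ p ∈ antidiagonal k, lam α β p.1 f * lam α β p.2 (euler α β g) := by
      rw [Finset.Nat.sum_antidiagonal_succ']
      simp only [← succ_smul_lam, mul_smul']
      simp [smul_eq_C_mul]
    simp only [succ_smul_lam, euler_mul, lam_add, ih]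
    rw [← hA, ← hB, ← Finset.sum_add_distrib, smul_eq_C_mul, Finset.mul_sum]
    refine Finset.sum_congr rfl fun p hp => ?_
    rw [smul_eq_C_mul, smul_eq_C_mul, ← add_mul, ← map_add, ← map_add]
    congr 3
    rw [← Nat.cast_add, Finset.HasAntidiagonal.mem_antidiagonal.1 hp]
    push_cast; rfl

variable (τ : ℂ⟦X⟧⟦X⟧)

/-- The Lie series transporting `f` along `euler α β` for the time `-τ`. -/
noncomputable def lie (f : ℂ⟦X⟧⟦X⟧) : ℂ⟦X⟧⟦X⟧ := ∑' k, (-τ) ^ k * lam α β k f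

variable {α β τ}

theorem nrm_iterate_euler_le {t₀ ε : ℝ} (hε : 0 < ε) (k : ℕ) {t : ℝ} (ht : t + k * ε ≤ t₀)
    (f : ℂ⟦X⟧⟦X⟧) : nrm t ((euler α β)^[k] f) ≤
      ((nrm t₀ α + nrm t₀ β) * ENNReal.ofReal (1 / ε)) ^ k * nrm (t + k * ε) f := by
  induction k generalizing f with
  | zero => simp
  | succ k ih =>
    rw [Function.iterate_succ_apply]
    push_cast at ht
    have h1 : t + k * ε ≤ t₀ := by nlinarith
    refine (ih h1 _).trans ?_
    rw [pow_succ, mul_assoc]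
    gcongr
    refine (nrm_euler_le hε α β f).trans ?_
    rw [show t + k * ε + ε = t + (k + 1 : ℕ) * ε by push_cast; ring]
    gcongr
    · exact nrm_mono h1 α
    · exact nrm_mono h1 β

theorem exists_nrm_lie_ne_top {t₀ : ℝ} (hα : nrm t₀ α ≠ ⊤) (hβ : nrm t₀ β ≠ ⊤)
    (hτ : nrm t₀ τ ≠ ⊤) :
    ∃ t, ∀ f, nrm t₀ f ≠ ⊤ → ∑' k, nrm t ((-τ) ^ k * lam α β k f) ≠ ⊤ := by
  set B : ℝ := (nrm t₀ α + nrm t₀ β).toReal with hB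
  set K : ℝ := (nrm t₀ τ).toReal with hK
  have hB0 : 0 ≤ B := ENNReal.toReal_nonneg
  have hK0 : 0 ≤ K := ENNReal.toReal_nonneg
  have hBe : nrm t₀ α + nrm t₀ β = ENNReal.ofReal B :=
    (ENNReal.ofReal_toReal (ENNReal.add_ne_top.2 ⟨hα, hβ⟩)).symm
  have hKe : nrm t₀ τ = ENNReal.ofReal K := (ENNReal.ofReal_toReal hτ).symm
  set L : ℝ := 2 * Real.exp 1 * K * B + 1 with hL
  have hL0 : 0 < L := by positivity
  refine ⟨t₀ - L, fun f hf => ?_⟩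
  have key : ∀ k : ℕ, nrm (t₀ - L) ((-τ) ^ k * lam α β k f) ≤
      ENNReal.ofReal ((1 / 2) ^ k) * nrm t₀ f := by
    intro k
    rcases Nat.eq_zero_or_pos k with rfl | hk
    · simpa [lam_zero] using nrm_mono (by linarith) f
    have hk' : (0 : ℝ) < k := by exact_mod_cast hk
    have hkL : (k : ℝ) * (L / k) = L := by field_simp
    have h1 := nrm_iterate_euler_le (α := α) (β := β) (t₀ := t₀) (div_pos hL0 hk') k
      (t := t₀ - L) (by rw [hkL]; linarith) f
    rw [hkL, hBe, sub_add_cancel] at h1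
    have h2 : nrm (t₀ - L) ((-τ) ^ k) ≤ ENNReal.ofReal K ^ k := by
      refine (nrm_pow_le _ _ _).trans ?_
      rw [nrm_neg, ← hKe]
      gcongr
      exact nrm_mono (by linarith) τ
    have h3 : ‖((k.factorial : ℂ)⁻¹)‖ₑ = ENNReal.ofReal ((k.factorial : ℝ)⁻¹) := by
      rw [← ofReal_norm]; simp
    calc nrm (t₀ - L) ((-τ) ^ k * lam α β k f)
        ≤ ENNReal.ofReal K ^ k * (ENNReal.ofReal ((k.factorial : ℝ)⁻¹) *
          ((ENNReal.ofReal B * ENNReal.ofReal (1 / (L / k))) ^ k * nrm t₀ f)) := by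
          refine (nrm_mul_le _ _ _).trans ?_
          rw [lam, nrm_smul, h3]
          gcongr
      _ = ENNReal.ofReal (K ^ k * (k.factorial : ℝ)⁻¹ * (B * (1 / (L / k))) ^ k) *
          nrm t₀ f := by
          rw [ENNReal.ofReal_mul (by positivity), ENNReal.ofReal_mul (by positivity),
            ENNReal.ofReal_pow (by positivity), ENNReal.ofReal_pow (by positivity),
            ENNReal.ofReal_mul (by positivity)]
          ring
      _ ≤ _ := by
          gcongr
          have h4 : (k : ℝ) ^ k / k.factorial ≤ Real.exp 1 ^ k := by
            rw [← Real.exp_nat_mul, mul_one]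
            exact Real.pow_div_factorial_le_exp _ hk'.le _
          calc K ^ k * (k.factorial : ℝ)⁻¹ * (B * (1 / (L / k))) ^ k
              = (K * B / L) ^ k * ((k : ℝ) ^ k / k.factorial) := by
                rw [one_div_div]
                simp only [div_pow, mul_pow]
                ring
            _ ≤ (K * B / L) ^ k * Real.exp 1 ^ k := by gcongr
            _ = (K * B / L * Real.exp 1) ^ k := by rw [mul_pow]
            _ ≤ (1 / 2) ^ k := by
                gcongr
                rw [div_mul_eq_mul_div, div_le_div_iff₀ hL0 two_pos]
                nlinarith
  refine ne_top_of_le_ne_top ?_ (ENNReal.tsum_le_tsum key)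
  rw [ENNReal.tsum_mul_right]
  refine ENNReal.mul_ne_top ?_ hf
  rw [← ENNReal.ofReal_tsum_of_nonneg (fun _ => by positivity) summable_geometric_two]
  exact ENNReal.ofReal_ne_top

theorem summable_lie (hα : Conv α) (hβ : Conv β) (hτ : Conv τ) {f : ℂ⟦X⟧⟦X⟧} (hf : Conv f) :
    Summable fun k => (-τ) ^ k * lam α β k f := by
  obtain ⟨a, ha⟩ := hα
  obtain ⟨b, hb⟩ := hβ
  obtain ⟨c, hc⟩ := hτ
  obtain ⟨d, hd⟩ := hf
  obtain ⟨t, ht⟩ := exists_nrm_lie_ne_top (t₀ := min (min a b) (min c d))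
    (nrm_ne_top_of_le (by simp) ha) (nrm_ne_top_of_le (by simp) hb)
    (nrm_ne_top_of_le (by simp) hc)
  exact summable_of_nrm (ht f (nrm_ne_top_of_le (by simp) hd))

theorem conv_lie (hα : Conv α) (hβ : Conv β) (hτ : Conv τ) {f : ℂ⟦X⟧⟦X⟧} (hf : Conv f) :
    Conv (lie α β τ f) := by
  obtain ⟨a, ha⟩ := hα
  obtain ⟨b, hb⟩ := hβ
  obtain ⟨c, hc⟩ := hτ
  obtain ⟨d, hd⟩ := hf
  obtain ⟨t, ht⟩ := exists_nrm_lie_ne_top (t₀ := min (min a b) (min c d))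
    (nrm_ne_top_of_le (by simp) ha) (nrm_ne_top_of_le (by simp) hb)
    (nrm_ne_top_of_le (by simp) hc)
  have := ht f (nrm_ne_top_of_le (by simp) hd)
  exact ⟨t, ne_top_of_le_ne_top this (nrm_tsum_le this)⟩

theorem lie_mul (hα : Conv α) (hβ : Conv β) (hτ : Conv τ) {f g : ℂ⟦X⟧⟦X⟧} (hf : Conv f)
    (hg : Conv g) : lie α β τ (f * g) = lie α β τ f * lie α β τ g := by
  obtain ⟨a, ha⟩ := hα
  obtain ⟨b, hb⟩ := hβ
  obtain ⟨c, hc⟩ := hτ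
  obtain ⟨d, hd⟩ := hf
  obtain ⟨e, he⟩ := hg
  obtain ⟨t, ht⟩ := exists_nrm_lie_ne_top (t₀ := min (min a b) (min c (min d e)))
    (nrm_ne_top_of_le (by simp) ha) (nrm_ne_top_of_le (by simp) hb)
    (nrm_ne_top_of_le (by simp) hc)
  rw [lie, lie, lie, tsum_mul_tsum_of_nrm (ht f (nrm_ne_top_of_le (by simp) hd))
    (ht g (nrm_ne_top_of_le (by simp) he))]
  congr 1; ext1 k
  rw [lam_mul, Finset.mul_sum]
  refine Finset.sum_congr rfl fun p hp => ?_
  rw [← Finset.HasAntidiagonal.mem_antidiagonal.1 hp, pow_add]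
  ring

theorem lie_add (hα : Conv α) (hβ : Conv β) (hτ : Conv τ) {f g : ℂ⟦X⟧⟦X⟧} (hf : Conv f)
    (hg : Conv g) : lie α β τ (f + g) = lie α β τ f + lie α β τ g := by
  rw [lie, lie, lie, ← (summable_lie hα hβ hτ hf).tsum_add (summable_lie hα hβ hτ hg)]
  simp only [lam_add, mul_add]

theorem conv_vx_mul_derivInner {f : ℂ⟦X⟧⟦X⟧} (hf : Conv f) : Conv (vx * derivInner f) := by
  obtain ⟨d, hd⟩ := hf
  refine ⟨d - 1, ne_top_of_le_ne_top ?_ (nrm_le_of_cf_le (f := f) one_pos fun i j => ?_)⟩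
  · rw [sub_add_cancel]
    exact ENNReal.mul_ne_top ENNReal.ofReal_ne_top hd
  · rw [cf_vx_mul_derivInner, norm_mul, Complex.norm_natCast]
    gcongr; simp

theorem conv_X_mul_derivOuter {f : ℂ⟦X⟧⟦X⟧} (hf : Conv f) : Conv (X * derivOuter f) := by
  obtain ⟨d, hd⟩ := hf
  refine ⟨d - 1, ne_top_of_le_ne_top ?_ (nrm_le_of_cf_le (f := f) one_pos fun i j => ?_)⟩
  · rw [sub_add_cancel]
    exact ENNReal.mul_ne_top ENNReal.ofReal_ne_top hd
  · rw [cf_X_mul_derivOuter, norm_mul, Complex.norm_natCast]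
    gcongr; simp

theorem conv_euler (hα : Conv α) (hβ : Conv β) {f : ℂ⟦X⟧⟦X⟧} (hf : Conv f) :
    Conv (euler α β f) :=
  (hα.mul (conv_vx_mul_derivInner hf)).add (hβ.mul (conv_X_mul_derivOuter hf))

theorem euler_pow_mul (σ f : ℂ⟦X⟧⟦X⟧) (k : ℕ) :
    euler α β (σ ^ (k + 1) * f) =
      euler α β σ * (σ ^ k * (((k : ℂ) + 1) • f)) + σ ^ (k + 1) * euler α β f := by
  have h : ∀ k : ℕ, euler α β (σ ^ (k + 1)) = euler α β σ * (((k : ℂ) + 1) • σ ^ k) := by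
    intro k
    induction k with
    | zero => simp
    | succ k ih =>
      rw [pow_succ, euler_mul, ih]
      simp only [smul_eq_C_mul, map_add, map_one]
      push_cast
      simp only [map_add, map_one]
      ring
  rw [euler_mul, h, smul_eq_C_mul, smul_eq_C_mul]
  ring

theorem euler_lie (hα : Conv α) (hβ : Conv β) (hτ : Conv τ) {f : ℂ⟦X⟧⟦X⟧} (hf : Conv f) :
    euler α β (lie α β τ f) = (1 - euler α β τ) * lie α β τ (euler α β f) := by
  have h1 := hasSum_euler α β (summable_lie hα hβ hτ hf).hasSum
  have h2 := (summable_lie hα hβ hτ (conv_euler hα hβ hf)).hasSum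
  have hneg : euler α β (-τ) = -euler α β τ := by
    rw [← neg_one_smul ℂ τ, euler_smul, neg_one_smul]
  have h5 := h2.mul_left (-euler α β τ)
  have h6 := (hasSum_nat_add_iff' 1).2 h2
  have h7 : HasSum (fun k => euler α β ((-τ) ^ (k + 1) * lam α β (k + 1) f))
      (((-euler α β τ) * ∑' k, (-τ) ^ k * lam α β k (euler α β f)) +
      (∑' k, (-τ) ^ k * lam α β k (euler α β f) -
        ∑ k ∈ Finset.range 1, (-τ) ^ k * lam α β k (euler α β f))) := by
    refine (h5.add h6).congr_fun fun k => ?_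
    rw [euler_pow_mul, succ_smul_lam, euler_lam, hneg]
  have h8 := (hasSum_nat_add_iff (f := fun k => euler α β ((-τ) ^ k * lam α β k f)) 1).1 h7
  rw [lie, h1.unique h8]
  simp only [lie, Finset.range_one, Finset.sum_singleton, pow_zero, one_mul, lam_zero]
  ring

end

section

/-! ### Growth of coefficients, quotients and inverses of convergent series -/

theorem Conv.exists_cf_le {f : ℂ⟦X⟧⟦X⟧} (hf : Conv f) :
    ∃ M R : ℝ, 0 < R ∧ ∀ i j, ‖cf f i j‖ ≤ M * R ^ (i + j) := by
  obtain ⟨t, ht⟩ := hf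
  refine ⟨(nrm t f).toReal, Real.exp (-t), Real.exp_pos _, fun i j => ?_⟩
  have h := (ENNReal.toReal_le_toReal (ne_top_of_le_ne_top ht (cf_le_nrm t f i j)) ht).2
    (cf_le_nrm t f i j)
  rw [ENNReal.toReal_mul, toReal_enorm, ENNReal.toReal_ofReal (Real.exp_pos _).le] at h
  rw [← Real.exp_nat_mul]
  push_cast
  rw [show ((i : ℝ) + j) * -t = -(t * (i + j)) by ring, Real.exp_neg, ← div_eq_mul_inv,
    le_div_iff₀ (Real.exp_pos _)]
  exact h

theorem conv_of_cf_le {f : ℂ⟦X⟧⟦X⟧} {M R : ℝ} (hR : 0 < R)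
    (h : ∀ i j, ‖cf f i j‖ ≤ M * R ^ (i + j)) : Conv f := by
  have hM : 0 ≤ M := by simpa using (norm_nonneg _).trans (h 0 0)
  refine ⟨-Real.log (2 * R), ?_⟩
  have hb : ∀ i j : ℕ, ‖cf f i j‖ₑ *
      ENNReal.ofReal (Real.exp (-Real.log (2 * R) * (i + j))) ≤
      ENNReal.ofReal M * (ENNReal.ofReal ((1 / 2) ^ i) * ENNReal.ofReal ((1 / 2) ^ j)) := by
    intro i j
    rw [← ofReal_norm, ← ENNReal.ofReal_mul (norm_nonneg _),
      ← ENNReal.ofReal_mul (by positivity), ← ENNReal.ofReal_mul hM]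
    refine ENNReal.ofReal_le_ofReal ?_
    have h1 : Real.exp (-Real.log (2 * R) * (i + j)) = ((2 * R) ^ (i + j))⁻¹ := by
      rw [show -Real.log (2 * R) * (i + j) = -((i + j : ℕ) * Real.log (2 * R)) by
        push_cast; ring, Real.exp_neg, Real.exp_nat_mul, Real.exp_log (by positivity)]
    rw [h1]
    calc ‖cf f i j‖ * ((2 * R) ^ (i + j))⁻¹
        ≤ (M * R ^ (i + j)) * ((2 * R) ^ (i + j))⁻¹ := by gcongr; exact h i j
      _ = M * ((1 / 2) ^ i * (1 / 2) ^ j) := by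
        rw [← pow_add, mul_pow, one_div, inv_pow]
        field_simp
  have hg : ∑' i : ℕ, ENNReal.ofReal (((1 : ℝ) / 2) ^ i) ≠ ⊤ := by
    rw [← ENNReal.ofReal_tsum_of_nonneg (fun _ => by positivity) summable_geometric_two]
    exact ENNReal.ofReal_ne_top
  refine ne_top_of_le_ne_top ?_
    (ENNReal.tsum_le_tsum fun j => ENNReal.tsum_le_tsum fun i => hb i j)
  simp_rw [ENNReal.tsum_mul_left, ENNReal.tsum_mul_right, ENNReal.tsum_mul_left]
  exact ENNReal.mul_ne_top ENNReal.ofReal_ne_top (ENNReal.mul_ne_top hg hg)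

theorem conv_of_forall_cf_eq {f g : ℂ⟦X⟧⟦X⟧} (hf : Conv f) (a b : ℕ)
    (h : ∀ i j, cf g i j = cf f (i + a) (j + b)) : Conv g := by
  obtain ⟨M, R, hR, hM⟩ := hf.exists_cf_le
  refine conv_of_cf_le (M := M * R ^ (a + b)) hR fun i j => ?_
  rw [h]
  refine (hM _ _).trans (le_of_eq ?_)
  ring

theorem Conv.of_vx_mul {f : ℂ⟦X⟧⟦X⟧} (hf : Conv (vx * f)) : Conv f :=
  conv_of_forall_cf_eq hf 1 0 fun i j => by simp

theorem Conv.of_X_mul {f : ℂ⟦X⟧⟦X⟧} (hf : Conv (X * f)) : Conv f :=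
  conv_of_forall_cf_eq hf 0 1 fun i j => by simp

theorem Conv.of_X_pow_mul {f : ℂ⟦X⟧⟦X⟧} {n : ℕ} (hf : Conv (X ^ n * f)) : Conv f := by
  induction n with
  | zero => simpa using hf
  | succ n ih => exact ih (Conv.of_X_mul (by rwa [← mul_assoc, ← pow_succ']))

theorem conv_C_C (c : ℂ) : Conv (C (C c)) := by
  simpa [smul_eq_C_mul] using conv_one.smul c

theorem conv_vx : Conv vx := by
  refine conv_of_cf_le (M := 1) (R := 1) one_pos fun i j => ?_
  simp only [cf, vx, coeff_C, one_pow, mul_one]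
  split_ifs <;> simp [coeff_X]
  split_ifs <;> simp

theorem conv_X : Conv X := by
  refine conv_of_cf_le (M := 1) (R := 1) one_pos fun i j => ?_
  simp only [cf, coeff_X, one_pow, mul_one]
  split_ifs <;> simp [coeff_one]
  split_ifs <;> simp

theorem Conv.pow {f : ℂ⟦X⟧⟦X⟧} (hf : Conv f) (n : ℕ) : Conv (f ^ n) := by
  induction n with
  | zero => simpa using conv_one
  | succ n ih => rw [pow_succ]; exact ih.mul hf

theorem cf_C_C (c : ℂ) (i j : ℕ) : cf (C (C c)) i j = if i = 0 ∧ j = 0 then c else 0 := by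
  simp only [cf, coeff_C]
  by_cases hj : j = 0 <;> by_cases hi : i = 0 <;> simp [hi, hj, coeff_C]

theorem cf_mul_zero_zero (f g : ℂ⟦X⟧⟦X⟧) : cf (f * g) 0 0 = cf f 0 0 * cf g 0 0 := by
  simp [cf_mul]

theorem nrm_sub_le_of_cf_eq_zero {h : ℂ⟦X⟧⟦X⟧} (h0 : cf h 0 0 = 0) (t : ℝ) {s : ℝ} (hs : 0 ≤ s) :
    nrm (t - s) h ≤ ENNReal.ofReal (Real.exp (-s)) * nrm t h := by
  unfold nrm
  rw [← ENNReal.tsum_mul_left]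
  refine ENNReal.tsum_le_tsum fun j => ?_
  rw [← ENNReal.tsum_mul_left]
  refine ENNReal.tsum_le_tsum fun i => ?_
  by_cases hij : i = 0 ∧ j = 0
  · simp [hij.1, hij.2, h0]
  · rw [mul_left_comm, ← ENNReal.ofReal_mul (Real.exp_pos _).le, ← Real.exp_add]
    gcongr
    have : (1 : ℝ) ≤ i + j := by
      have : 1 ≤ i + j := by omega
      exact_mod_cast this
    nlinarith

theorem Conv.exists_inv {f : ℂ⟦X⟧⟦X⟧} (hf : Conv f) (h0 : cf f 0 0 ≠ 0) :
    ∃ g, Conv g ∧ f * g = 1 := by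
  set h : ℂ⟦X⟧⟦X⟧ := 1 - (cf f 0 0)⁻¹ • f with hh
  have hh0 : cf h 0 0 = 0 := by
    rw [hh, cf_sub, cf_smul, inv_mul_cancel₀ h0]
    simp [cf]
  obtain ⟨t, ht⟩ := conv_one.sub (hf.smul (cf f 0 0)⁻¹)
  rw [← hh] at ht
  obtain ⟨s, hs0, hs⟩ : ∃ s : ℝ, 0 ≤ s ∧ nrm (t - s) h ≤ ENNReal.ofReal (1 / 2) := by
    refine ⟨(2 * (nrm t h).toReal), by positivity, ?_⟩
    refine (nrm_sub_le_of_cf_eq_zero hh0 t (by positivity)).trans ?_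
    nth_rw 2 [← ENNReal.ofReal_toReal ht]
    rw [← ENNReal.ofReal_mul (Real.exp_pos _).le]
    refine ENNReal.ofReal_le_ofReal ?_
    rw [Real.exp_neg, inv_mul_le_iff₀ (Real.exp_pos _)]
    nlinarith [Real.add_one_le_exp (2 * (nrm t h).toReal)]
  have hsum : ∑' k, nrm (t - s) (h ^ k) ≠ ⊤ := by
    refine ne_top_of_le_ne_top ?_ (ENNReal.tsum_le_tsum fun k =>
      (nrm_pow_le (t - s) h k).trans (pow_le_pow_left' hs k))
    simp_rw [← ENNReal.ofReal_pow (by norm_num : (0 : ℝ) ≤ 1 / 2)]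
    rw [← ENNReal.ofReal_tsum_of_nonneg (fun _ => by positivity) summable_geometric_two]
    exact ENNReal.ofReal_ne_top
  have hS : Summable fun k => h ^ k := summable_of_nrm hsum
  have hgeo : (1 - h) * ∑' k, h ^ k = 1 := by
    have h1 := hS.tsum_eq_zero_add
    simp_rw [pow_zero, pow_succ', hS.tsum_mul_left] at h1
    linear_combination h1
  refine ⟨(cf f 0 0)⁻¹ • ∑' k, h ^ k,
    Conv.smul _ ⟨t - s, ne_top_of_le_ne_top hsum (nrm_tsum_le hsum)⟩, ?_⟩
  rw [mul_smul', ← smul_mul', ← hgeo, hh]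
  ring

end

section

/-! ### Further properties of Lie series -/

theorem X_pow_dvd_iff_cf {m : ℕ} {f : ℂ⟦X⟧⟦X⟧} :
    X ^ m ∣ f ↔ ∀ i, ∀ j < m, cf f i j = 0 := by
  rw [X_pow_dvd_iff]
  exact ⟨fun h i j hj => by rw [cf, h j hj, map_zero], fun h j hj => by ext i; exact h i j hj⟩

variable {α β τ : ℂ⟦X⟧⟦X⟧}

theorem X_pow_dvd_euler {m : ℕ} {f : ℂ⟦X⟧⟦X⟧} (h : X ^ m ∣ f) : X ^ m ∣ euler α β f := by
  rw [X_pow_dvd_iff_cf] at h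
  refine dvd_add (Dvd.dvd.mul_left (X_pow_dvd_iff_cf.2 fun i j hj => ?_) _)
    (Dvd.dvd.mul_left (X_pow_dvd_iff_cf.2 fun i j hj => ?_) _)
  · rw [cf_vx_mul_derivInner, h i j hj, mul_zero]
  · rw [cf_X_mul_derivOuter, h i j hj, mul_zero]

theorem X_pow_dvd_lam {m : ℕ} {f : ℂ⟦X⟧⟦X⟧} (h : X ^ m ∣ f) (k : ℕ) : X ^ m ∣ lam α β k f := by
  rw [lam, smul_eq_C_mul]
  refine Dvd.dvd.mul_left ?_ _
  induction k with
  | zero => exact h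
  | succ k ih => rw [Function.iterate_succ_apply']; exact X_pow_dvd_euler ih

theorem X_pow_dvd_lie (hα : Conv α) (hβ : Conv β) (hτ : Conv τ) {m : ℕ} {f : ℂ⟦X⟧⟦X⟧}
    (hf : Conv f) (h : X ^ m ∣ f) : X ^ m ∣ lie α β τ f := by
  refine X_pow_dvd_iff_cf.2 fun i j hj => ?_
  rw [lie, cf_tsum (summable_lie hα hβ hτ hf)]
  convert tsum_zero with k
  exact X_pow_dvd_iff_cf.1 ((X_pow_dvd_lam h k).mul_left _) i j hj

theorem derivInner_C_C (c : ℂ) : derivInner (C (C c)) = 0 :=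
  ext_cf fun i j => by simp [cf_derivInner, cf_C_C]

theorem derivOuter_C_C (c : ℂ) : derivOuter (C (C c)) = 0 :=
  ext_cf fun i j => by simp [cf_derivOuter, cf_C_C]

theorem euler_C_C (c : ℂ) : euler α β (C (C c)) = 0 := by
  simp [euler, derivInner_C_C, derivOuter_C_C]

theorem euler_zero : euler α β 0 = 0 := by
  simpa using euler_smul α β 0 0

theorem lie_C_C (c : ℂ) : lie α β τ (C (C c)) = C (C c) := by
  rw [lie, tsum_eq_single 0, pow_zero, one_mul, lam_zero]
  intro k hk
  obtain ⟨k, rfl⟩ := Nat.exists_eq_succ_of_ne_zero hk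
  have h : (euler α β)^[k] 0 = 0 := by
    induction k with
    | zero => rfl
    | succ k ih => rw [Function.iterate_succ_apply', ih (by simp), euler_zero]
  rw [lam, Function.iterate_succ_apply, euler_C_C, h, smul_zero, mul_zero]

theorem lie_eval₂ (hα : Conv α) (hβ : Conv β) (hτ : Conv τ) {f : ℂ⟦X⟧⟦X⟧} (hf : Conv f)
    (p : Polynomial ℂ) : Conv (p.eval₂ ((C).comp C) f) ∧
      lie α β τ (p.eval₂ ((C).comp C) f) = p.eval₂ ((C).comp C) (lie α β τ f) := by
  induction p using Polynomial.induction_on' with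
  | add p q hp hq =>
    simp only [Polynomial.eval₂_add]
    exact ⟨hp.1.add hq.1, by rw [lie_add hα hβ hτ hp.1 hq.1, hp.2, hq.2]⟩
  | monomial n c =>
    simp only [Polynomial.eval₂_monomial, RingHom.comp_apply]
    refine ⟨(conv_C_C c).mul (hf.pow n), ?_⟩
    rw [lie_mul hα hβ hτ (conv_C_C c) (hf.pow n), lie_C_C]
    congr 1
    induction n with
    | zero => simpa using lie_C_C (α := α) (β := β) (τ := τ) 1
    | succ n ih => rw [pow_succ, pow_succ, lie_mul hα hβ hτ (hf.pow n) hf, ih]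

theorem lam_of_euler_eq_neg_sq {F : ℂ⟦X⟧⟦X⟧} (h : euler α β F = -F ^ 2) (k : ℕ) :
    lam α β k F = (-1) ^ k * F ^ (k + 1) := by
  have hpow : ∀ n : ℕ, euler α β (F ^ (n + 1)) = -(((n : ℂ) + 1) • F ^ (n + 2)) := by
    intro n
    have := euler_pow_mul (α := α) (β := β) F 1 n
    rw [h, mul_one, mul_smul', mul_smul', mul_one] at this
    have h1 : euler α β 1 = 0 := by
      simpa only [map_one] using euler_C_C (α := α) (β := β) 1
    rw [this, h1, mul_zero, add_zero, ← smul_neg]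
    congr 1
    ring
  induction k with
  | zero => simp [lam_zero]
  | succ k ih =>
    have h1 := succ_smul_lam α β k F
    rw [← euler_lam, ih] at h1
    have h2 : euler α β ((-1) ^ k * F ^ (k + 1)) = ((-1 : ℂ) ^ k) • euler α β (F ^ (k + 1)) := by
      rw [← euler_smul, smul_eq_C_mul]
      simp
    rw [h2, hpow] at h1
    have h3 : ((k : ℂ) + 1) ≠ 0 := by exact_mod_cast k.succ_ne_zero
    refine smul_right_injective _ h3 ?_
    simp only
    rw [h1]
    simp only [smul_eq_C_mul, map_pow, map_neg, map_one]
    ring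

theorem one_sub_mul_lie_of_euler_eq_neg_sq (hα : Conv α) (hβ : Conv β) (hτ : Conv τ)
    {F : ℂ⟦X⟧⟦X⟧} (hF : Conv F) (h : euler α β F = -F ^ 2) :
    (1 - τ * F) * lie α β τ F = F := by
  have hS := summable_lie hα hβ hτ hF
  have hk : ∀ k, (-τ) ^ (k + 1) * lam α β (k + 1) F = τ * F * ((-τ) ^ k * lam α β k F) := by
    intro k
    rw [lam_of_euler_eq_neg_sq h, lam_of_euler_eq_neg_sq h]
    ring
  have h1 := hS.tsum_eq_zero_add
  simp_rw [hk, hS.tsum_mul_left, pow_zero, one_mul, lam_zero] at h1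
  rw [lie]
  linear_combination h1

theorem cf_zero_one_lie (hα : Conv α) (hβ : Conv β) (hτ : Conv τ) {f : ℂ⟦X⟧⟦X⟧} (hf : Conv f)
    (h : X ∣ f) :
    cf (lie α β τ f) 0 1 = Complex.exp (-cf τ 0 0 * cf β 0 0) * cf f 0 1 := by
  have hmul : ∀ a g : ℂ⟦X⟧⟦X⟧, X ∣ g → cf (a * g) 0 1 = cf a 0 0 * cf g 0 1 := by
    rintro a _ ⟨g, rfl⟩
    rw [mul_left_comm]
    rw [cf_X_mul_succ g 0 0, cf_X_mul_succ (a * g) 0 0]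
    exact cf_mul_zero_zero a g
  have heul : ∀ g : ℂ⟦X⟧⟦X⟧, cf (euler α β g) 0 1 = cf β 0 0 * cf g 0 1 := by
    intro g
    rw [euler, cf_add, mul_left_comm, cf_vx_mul_zero, zero_add, hmul _ _ (dvd_mul_right _ _),
      cf_X_mul_derivOuter]
    simp
  have hlam : ∀ k, cf (lam α β k f) 0 1 = (k.factorial : ℂ)⁻¹ * (cf β 0 0 ^ k * cf f 0 1) := by
    intro k
    rw [lam, cf_smul]
    congr 1
    induction k with
    | zero => simp
    | succ k ih => rw [Function.iterate_succ_apply', heul, ih]; ring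
  have hterm : ∀ k, cf ((-τ) ^ k * lam α β k f) 0 1 =
      (-cf τ 0 0 * cf β 0 0) ^ k / k.factorial * cf f 0 1 := by
    intro k
    have hp : cf ((-τ) ^ k) 0 0 = (-cf τ 0 0) ^ k := by
      induction k with
      | zero => simp [cf]
      | succ k ih => rw [pow_succ, cf_mul_zero_zero, ih, cf_neg, pow_succ]
    rw [hmul _ _ (by simpa using X_pow_dvd_lam (m := 1) (by simpa using h) k), hlam, hp]
    ring
  rw [lie, cf_tsum (summable_lie hα hβ hτ hf)]
  simp_rw [hterm]
  rw [tsum_mul_right, Complex.exp_eq_exp_ℂ, NormedSpace.exp_eq_tsum_div]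

end

section

/-! ### Reduction of an equivalence to one preserving `x` -/

theorem cf_mul_zero_right_of_lt {f : ℂ⟦X⟧⟦X⟧} {i : ℕ} (h : ∀ i' < i, cf f i' 0 = 0)
    (g : ℂ⟦X⟧⟦X⟧) : cf (g * f) i 0 = cf g 0 0 * cf f i 0 := by
  rw [cf_mul, Finset.HasAntidiagonal.antidiagonal_zero, Finset.sum_singleton,
    Finset.sum_eq_single (0, i)]
  · rintro ⟨a, b⟩ hab hne
    rw [Finset.HasAntidiagonal.mem_antidiagonal] at hab
    have : b < i := by
      rcases Nat.eq_zero_or_pos a with rfl | ha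
      · simp only [zero_add] at hab
        exact absurd (by rw [hab]) hne
      · simp only at hab; omega
    simp [h b this]
  · simp [Finset.HasAntidiagonal.mem_antidiagonal]

theorem cf_mul_zero_left_of_lt {f : ℂ⟦X⟧⟦X⟧} {j : ℕ} (h : ∀ j' < j, cf f 0 j' = 0)
    (g : ℂ⟦X⟧⟦X⟧) : cf (g * f) 0 j = cf g 0 0 * cf f 0 j := by
  rw [cf_mul, Finset.sum_eq_single (0, j)]
  · simp
  · rintro ⟨a, b⟩ hab hne
    rw [Finset.HasAntidiagonal.mem_antidiagonal] at hab
    have : b < j := by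
      rcases Nat.eq_zero_or_pos a with rfl | ha
      · simp only [zero_add] at hab
        exact absurd (by rw [hab]) hne
      · simp only at hab; omega
    simp [h b this]
  · simp [Finset.HasAntidiagonal.mem_antidiagonal]

theorem exists_eq_vx_mul {f : ℂ⟦X⟧⟦X⟧} (h : ∀ j, cf f 0 j = 0) : ∃ g, f = vx * g := by
  refine ⟨PowerSeries.mk fun j => PowerSeries.mk fun i => cf f (i + 1) j, ext_cf fun i j => ?_⟩
  cases i with
  | zero => rw [h, cf_vx_mul_zero]
  | succ i => rw [cf_vx_mul_succ]; simp [cf]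

theorem vx_ne_zero : vx ≠ 0 := fun h => by
  have := congrArg (fun f => cf f 1 0) h
  simp [vx, cf] at this

theorem cf_euler_normalForm_zero_left (H f : ℂ⟦X⟧⟦X⟧) (j : ℕ) :
    cf (euler vx (1 + vx * H) f) 0 j = j * cf f 0 j := by
  rw [euler, show vx * (vx * derivInner f) + (1 + vx * H) * (X * derivOuter f) =
    X * derivOuter f + vx * (vx * derivInner f + H * (X * derivOuter f)) by ring, cf_add,
    cf_X_mul_derivOuter, cf_vx_mul_zero, add_zero]

theorem cf_euler_normalForm_zero_right (H f : ℂ⟦X⟧⟦X⟧) (i : ℕ) :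
    cf (euler vx (1 + vx * H) f) i 0 = (i - 1 : ℕ) * cf f (i - 1) 0 := by
  rw [euler, mul_left_comm (1 + vx * H), cf_add, cf_X_mul_zero, add_zero]
  cases i with
  | zero => simp
  | succ i => rw [cf_vx_mul_succ, cf_vx_mul_derivInner]; simp

variable {H u F G Q : ℂ⟦X⟧⟦X⟧}

theorem X_dvd_of_euler_eq_mul {K : ℂ⟦X⟧⟦X⟧} (hG : euler vx (1 + vx * H) G = K * G)
    (hK : cf K 0 0 ≠ 0) : X ∣ G := by
  have h : ∀ i, cf G i 0 = 0 := by
    intro i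
    induction i using Nat.strong_induction_on with
    | _ i ih =>
      have h1 := cf_euler_normalForm_zero_right H G i
      rw [hG, cf_mul_zero_right_of_lt ih] at h1
      rcases Nat.eq_zero_or_pos i with rfl | hi
      · simpa [hK] using h1
      · rw [ih (i - 1) (by omega), mul_zero] at h1
        exact (mul_eq_zero.1 h1).resolve_left hK
  have := X_pow_dvd_iff_cf (m := 1) (f := G)
  rw [pow_one] at this
  exact this.2 fun i j hj => by rw [Nat.lt_one_iff.1 hj, h]

theorem cf_zero_left_of_euler_eq_mul {K : ℂ⟦X⟧⟦X⟧} (hF : euler vx (1 + vx * H) F = K * F)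
    (hK : cf K 0 0 = 0) (h0 : cf F 0 0 = 0) (j : ℕ) : cf F 0 j = 0 := by
  induction j using Nat.strong_induction_on with
  | _ j ih =>
    have h1 := cf_euler_normalForm_zero_left H F j
    rw [hF, cf_mul_zero_left_of_lt ih, hK, zero_mul] at h1
    rcases Nat.eq_zero_or_pos j with rfl | hj
    · exact h0
    · exact (mul_eq_zero.1 h1.symm).resolve_left (by exact_mod_cast hj.ne')

theorem exists_eq_vx_mul_one_sub (hu : cf u 0 0 = 1)
    (hF : euler vx (1 + vx * H) F = u * F ^ 2) (hFc : Conv F) (h0 : cf F 0 0 = 0)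
    (h1 : cf F 1 0 ≠ 0) : ∃ τ, Conv τ ∧ F = vx * (1 - τ * F) := by
  obtain ⟨A, rfl⟩ := exists_eq_vx_mul (cf_zero_left_of_euler_eq_mul (K := u * F)
    (by rw [hF]; ring) (by rw [cf_mul_zero_zero, h0, mul_zero]) h0)
  rw [cf_vx_mul_succ] at h1
  have hA : vx * A + euler vx (1 + vx * H) A = vx * (u * A ^ 2) := by
    refine mul_left_cancel₀ vx_ne_zero ?_
    have hv : euler vx (1 + vx * H) vx = vx ^ 2 := by
      simp only [euler, derivInner_vx, derivOuter_vx]; ring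
    rw [euler_mul, hv] at hF
    linear_combination hF
  have hA0 : ∀ j ≠ 0, cf A 0 j = 0 := by
    intro j hj
    have := congrArg (fun f => cf f 0 j) hA
    simp only [cf_add, cf_vx_mul_zero, cf_euler_normalForm_zero_left, zero_add] at this
    exact (mul_eq_zero.1 this).resolve_left (by exact_mod_cast hj)
  have hA1 : cf A 0 0 = 1 := by
    have := congrArg (fun f => cf f 1 0) hA
    simp only [cf_add, cf_vx_mul_succ _ 0, cf_euler_normalForm_zero_right, pow_two,
      cf_mul_zero_zero, hu] at this
    refine mul_left_cancel₀ h1 ?_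
    simpa using this.symm
  obtain ⟨T, hT⟩ := exists_eq_vx_mul (f := 1 - A) fun j => by
    rcases eq_or_ne j 0 with rfl | hj
    · rw [cf_sub, hA1]; simp [cf]
    · rw [cf_sub, hA0 j hj]; simp [cf, coeff_one, hj]
  have hAc := hFc.of_vx_mul
  obtain ⟨B, hB, hAB⟩ := hAc.exists_inv h1
  have hTc : Conv T := Conv.of_vx_mul (by rw [← hT]; exact conv_one.sub hAc)
  refine ⟨T * B, hTc.mul hB, ?_⟩
  linear_combination (vx * vx * T) * hAB - vx * hT

/-- An equivalence between normal forms can be corrected, by moving along the leaves, so that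
it preserves the first coordinate. -/
theorem exists_fibered_conjugacy (hH : Conv H) (hu : Conv u) (hFc : Conv F) (hGc : Conv G)
    (hu0 : cf u 0 0 ≠ 0)
    (hF : euler vx (1 + vx * H) F = u * F ^ 2)
    (hG : euler vx (1 + vx * H) G = u * (G + F * G * Q))
    (hF0 : cf F 0 0 = 0) (hdet : cf F 1 0 * cf G 0 1 - cf F 0 1 * cf G 1 0 ≠ 0) :
    ∃ ψ, Conv ψ ∧ X ∣ ψ ∧ cf ψ 0 1 ≠ 0 ∧
      ∀ (N : ℕ) (p : Polynomial ℂ) (W : ℂ⟦X⟧⟦X⟧), Conv W →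
        Q = p.eval₂ ((C).comp C) G + G ^ N * W →
        X ^ (N + 1) ∣ euler vx (1 + vx * H) ψ - ψ * (1 + vx * p.eval₂ ((C).comp C) ψ) := by
  have hG' : euler vx (1 + vx * H) G = u * (1 + F * Q) * G := by rw [hG]; ring
  have hK : cf (u * (1 + F * Q)) 0 0 = cf u 0 0 := by
    rw [cf_mul_zero_zero, cf_add, cf_mul_zero_zero, hF0]; simp [cf]
  have hXG : X ∣ G := X_dvd_of_euler_eq_mul hG' (by rwa [hK])
  have hG0 : ∀ i, cf G i 0 = 0 := by
    obtain ⟨B, rfl⟩ := hXG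
    simp
  rw [hG0 1, mul_zero, sub_zero] at hdet
  have hG01 := right_ne_zero_of_mul hdet
  have hu1 : cf u 0 0 = 1 := by
    have h := cf_euler_normalForm_zero_left H G 1
    rw [hG', cf_mul_zero_left_of_lt (by simp [hG0]), hK] at h
    refine mul_right_cancel₀ hG01 ?_
    simpa using h
  obtain ⟨τ, hτ, hFτ⟩ := exists_eq_vx_mul_one_sub hu1 hF hFc hF0 (left_ne_zero_of_mul hdet)
  obtain ⟨v, hv, huv⟩ := hu.exists_inv hu0
  have hY : ∀ f, euler (-v * vx) (-v * (1 + vx * H)) f = -v * euler vx (1 + vx * H) f := by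
    intro f; simp only [euler]; ring
  have hα : Conv (-v * vx) := hv.neg.mul conv_vx
  have hβ : Conv (-v * (1 + vx * H)) := hv.neg.mul (conv_one.add (conv_vx.mul hH))
  set α := -v * vx with hα_def
  set β := -v * (1 + vx * H) with hβ_def
  have hYF : euler α β F = -F ^ 2 := by
    rw [hY, hF]; linear_combination (-F ^ 2) * huv
  have hSF : lie α β τ F = vx := by
    have h1 := one_sub_mul_lie_of_euler_eq_neg_sq hα hβ hτ hFc hYF
    have h2 : 1 - τ * F ≠ 0 := by
      intro h
      rw [h, mul_zero] at hFτ
      rw [hFτ] at hdet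
      simp at hdet
    refine mul_left_cancel₀ h2 (h1.trans ?_)
    rw [mul_comm]; exact hFτ
  have hτv : 1 - euler α β τ = v := by
    have h1 := euler_lie hα hβ hτ hFc
    have h2 : lie α β τ (-F ^ 2) = -vx ^ 2 := by
      have : (-F ^ 2 : ℂ⟦X⟧⟦X⟧) = C (C (-1)) * (F * F) := by simp; ring
      rw [this, lie_mul hα hβ hτ (conv_C_C _) (hFc.mul hFc), lie_C_C, lie_mul hα hβ hτ hFc hFc,
        hSF]
      simp; ring
    have hv : euler vx (1 + vx * H) vx = vx ^ 2 := by
      simp only [euler, derivInner_vx, derivOuter_vx]; ring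
    rw [hYF, h2, hSF, hY, hv] at h1
    refine mul_right_cancel₀ (pow_ne_zero 2 vx_ne_zero) ?_
    linear_combination h1
  refine ⟨lie α β τ G, conv_lie hα hβ hτ hGc, ?_, ?_, ?_⟩
  · simpa using X_pow_dvd_lie hα hβ hτ (m := 1) hGc (by simpa using hXG)
  · rw [cf_zero_one_lie hα hβ hτ hGc hXG]
    exact mul_ne_zero (Complex.exp_ne_zero _) hG01
  · intro N p W hW hQ
    set ψ := lie α β τ G with hψ
    have hp := lie_eval₂ hα hβ hτ hGc p
    rw [← hψ] at hp
    set P := p.eval₂ ((C).comp C) G with hP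
    have hYG : euler α β G = C (C (-1)) * (G + F * (G * P) + F * (G ^ (N + 1) * W)) := by
      rw [hY, hG, hQ]
      simp only [map_neg, map_one]
      linear_combination (-(G + F * G * (P + G ^ N * W))) * huv
    have c1 : Conv (G * P) := hGc.mul hp.1
    have c2 : Conv (F * (G * P)) := hFc.mul c1
    have c3 : Conv (F * (G ^ (N + 1) * W)) := hFc.mul ((hGc.pow _).mul hW)
    have h1 := euler_lie hα hβ hτ hGc
    rw [hYG, lie_mul hα hβ hτ (conv_C_C _) ((hGc.add c2).add c3), lie_C_C,
      lie_add hα hβ hτ (hGc.add c2) c3, lie_add hα hβ hτ hGc c2, lie_mul hα hβ hτ hFc c1,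
      lie_mul hα hβ hτ hGc hp.1, hp.2, hSF, hτv, ← hψ, hY] at h1
    have h2 : X ^ (N + 1) ∣ lie α β τ (F * (G ^ (N + 1) * W)) :=
      X_pow_dvd_lie hα hβ hτ c3 (((pow_dvd_pow_of_dvd hXG _).mul_right _).mul_left _)
    convert h2 using 1
    simp only [map_neg, map_one] at h1
    set E := lie α β τ (F * (G ^ (N + 1) * W))
    linear_combination (-u) * h1 + (ψ + vx * (ψ * p.eval₂ ((C).comp C) ψ) + E -
      euler vx (1 + vx * H) ψ) * huv

end

section

/-! ### Fibered conjugacies are homotheties -/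

theorem eq_zero_of_recurrence {μ : ℂ} (hμ : ∀ q : ℚ, (q : ℂ) = μ → 0 ≤ q) {m : ℕ} (hm : 0 < m)
    {a : ℕ → ℂ} {M R : ℝ} (hR : 0 < R) (ha : ∀ k, ‖a k‖ ≤ M * R ^ k) (h0 : a 0 = 0)
    (hrec : ∀ k, 0 < k → m * (a (k + 1) + μ * a k) + k * a k = 0) (k : ℕ) : a k = 0 := by
  have hm' : (m : ℂ) ≠ 0 := by exact_mod_cast hm.ne'
  have hstep : ∀ k, 0 < k → a (k + 1) = -((k / m + μ) * a k) := by
    intro k hk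
    have := hrec k hk
    field_simp
    linear_combination this
  suffices h1 : a 1 = 0 by
    rcases Nat.eq_zero_or_pos k with rfl | hk
    · exact h0
    · induction k, hk using Nat.le_induction with
      | base => exact h1
      | succ k hk ih => rw [hstep k hk, ih, mul_zero, neg_zero]
  by_contra h1
  have hne : ∀ k, 0 < k → a k ≠ 0 := by
    intro k hk
    induction k, hk using Nat.le_induction with
    | base => exact h1
    | succ k hk ih =>
      rw [hstep k hk]
      refine neg_ne_zero.2 (mul_ne_zero (fun h => ?_) ih)
      have h2 := hμ (-(k / m)) (by push_cast; linear_combination -h)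
      have h3 : (0 : ℚ) < k / m := div_pos (by exact_mod_cast hk) (by exact_mod_cast hm)
      linarith
  obtain ⟨n, hn⟩ := exists_nat_gt (m * (2 * R + ‖μ‖))
  set k₀ := n + 1 with hk₀
  have hm0 : (0 : ℝ) < m := by exact_mod_cast hm
  have hgrow : ∀ k, k₀ ≤ k → 2 * R * ‖a k‖ ≤ ‖a (k + 1)‖ := by
    intro k hk
    rw [hstep k (by omega), norm_neg, norm_mul]
    gcongr
    have h2 : 2 * R + ‖μ‖ ≤ k / m := by
      rw [le_div_iff₀ hm0]
      have : (n : ℝ) ≤ k := by exact_mod_cast (by omega : n ≤ k)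
      nlinarith
    have h3 := norm_sub_le ((k : ℂ) / m + μ) μ
    rw [add_sub_cancel_right, norm_div, Complex.norm_natCast, Complex.norm_natCast] at h3
    linarith
  have hlow : ∀ n : ℕ, (2 * R) ^ n * ‖a k₀‖ ≤ ‖a (k₀ + n)‖ := by
    intro n
    induction n with
    | zero => simp
    | succ n ih =>
      refine le_trans ?_ (hgrow (k₀ + n) (by omega))
      rw [pow_succ', mul_assoc]
      gcongr
  have hbound : ∀ n : ℕ, 2 ^ n * ‖a k₀‖ ≤ M * R ^ k₀ := by
    intro n
    have h2 := (hlow n).trans (ha _)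
    rw [mul_pow, pow_add] at h2
    have h3 : 0 < R ^ n := by positivity
    refine le_of_mul_le_mul_right ?_ h3
    calc _ = 2 ^ n * R ^ n * ‖a k₀‖ := by ring
      _ ≤ _ := h2
      _ = _ := by ring
  have hpos : 0 < ‖a k₀‖ := norm_pos_iff.2 (hne k₀ (by omega))
  obtain ⟨n, hn⟩ := pow_unbounded_of_one_lt (M * R ^ k₀ / ‖a k₀‖) (one_lt_two)
  rw [div_lt_iff₀ hpos] at hn
  exact absurd (hbound n) (not_le.2 hn)

theorem cf_eval₂_C_mul_X (c : ℂ) (p : Polynomial ℂ) (i j : ℕ) :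
    cf (p.eval₂ ((C).comp C) (C (C c) * X)) i j = if i = 0 then c ^ j * p.coeff j else 0 := by
  induction p using Polynomial.induction_on' with
  | add p q hp hq =>
    rw [Polynomial.eval₂_add, cf_add, hp, hq, Polynomial.coeff_add]
    split_ifs <;> ring
  | monomial n b =>
    rw [Polynomial.eval₂_monomial, mul_pow, RingHom.comp_apply, ← mul_assoc, ← map_pow, ← map_pow,
      ← map_mul, ← map_mul, Polynomial.coeff_monomial, cf, coeff_C_mul, coeff_X_pow]
    by_cases hj : j = n
    · subst hj
      simp only [if_true, mul_one, coeff_C]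
      split_ifs
      · ring
      · rfl
    · simp [hj, Ne.symm hj]

theorem eval₂_sub_dvd (p : Polynomial ℂ) (f g : ℂ⟦X⟧⟦X⟧) :
    f - g ∣ p.eval₂ ((C).comp C) f - p.eval₂ ((C).comp C) g := by
  rw [← Polynomial.eval_map, ← Polynomial.eval_map]
  exact Polynomial.sub_dvd_eval_sub _ _ _

variable {H ψ W : ℂ⟦X⟧⟦X⟧}

theorem X_pow_dvd_linearization {N : ℕ} {p₁ p₂ : Polynomial ℂ} {μ c : ℂ}
    (hp₁ : p₁.coeff 0 = μ) (hp₂ : p₂.coeff 0 = μ)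
    (hH : H = p₁.eval₂ ((C).comp C) X + X ^ N * W) (hψ : X ∣ ψ)
    (hD : X ^ (N + 1) ∣ euler vx (1 + vx * H) ψ - ψ * (1 + vx * p₂.eval₂ ((C).comp C) ψ))
    {m : ℕ} (hm : m < N) {g : ℂ⟦X⟧⟦X⟧} (hg : ψ = C (C c) * X + X ^ (m + 1) * g) :
    X ^ (m + 1) * X ∣ X * (vx * (C (C c) * (p₁.eval₂ ((C).comp C) X -
      p₂.eval₂ ((C).comp C) (C (C c) * X)))) +
      X ^ (m + 1) * ((m : ℂ) • g + vx * (((m : ℂ) * μ) • g) + euler vx (1 + vx * H) g) := by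
  have hzero : ∀ p : Polynomial ℂ, p.eval₂ ((C).comp C) (0 : ℂ⟦X⟧⟦X⟧) = C (C (p.coeff 0)) := by
    intro p; rw [Polynomial.eval₂_at_zero]; rfl
  set a : ℂ⟦X⟧⟦X⟧ := C (C c) * X with ha
  obtain ⟨B, hB⟩ : X ∣ p₂.eval₂ ((C).comp C) ψ - C (C μ) := by
    have := eval₂_sub_dvd p₂ ψ 0
    rw [hzero, hp₂, sub_zero] at this
    exact hψ.trans this
  obtain ⟨B', hB'⟩ : X ∣ p₁.eval₂ ((C).comp C) X - C (C μ) := by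
    have := eval₂_sub_dvd p₁ X 0
    rwa [hzero, hp₁, sub_zero] at this
  obtain ⟨E, hE⟩ : X ^ (m + 1) ∣ p₂.eval₂ ((C).comp C) ψ - p₂.eval₂ ((C).comp C) a :=
    (Dvd.intro g (by rw [hg]; ring)).trans (eval₂_sub_dvd p₂ ψ a)
  obtain ⟨n, rfl⟩ : ∃ n, N = m + 1 + n := ⟨N - (m + 1), by omega⟩
  obtain ⟨V, hV⟩ := hD
  set P₂ := p₂.eval₂ ((C).comp C) ψ
  set P₂a := p₂.eval₂ ((C).comp C) a
  set P₁ := p₁.eval₂ ((C).comp C) X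
  have hDψ : euler vx (1 + vx * H) ψ = (1 + vx * H) * a +
      (((m : ℂ) + 1) • (X ^ (m + 1) * g)) * (1 + vx * H) +
        X ^ (m + 1) * euler vx (1 + vx * H) g := by
    have hX : euler vx (1 + vx * H) X = (1 + vx * H) * X := by
      simp [euler]
    rw [hg, euler_add, euler_mul, euler_C_C, euler_pow_mul, hX, ha]
    simp only [smul_eq_C_mul]
    ring
  rw [hDψ] at hV
  refine ⟨X ^ n * V - vx * C (C c) * X ^ n * W - (((m : ℂ) + 1) • g) * vx * (B' + X ^ (m + n) * W) +
    vx * (g * B + C (C c) * E), ?_⟩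
  simp only [smul_eq_C_mul, map_add, map_mul, map_one, ha] at hV hB hE hB' hg hH ⊢
  linear_combination hV + (1 + vx * P₂) * hg + vx * (C (C c) * X) * hE +
    vx * X ^ (m + 1) * g * hB - (vx * (C (C c) * X) + (C (C (m : ℂ)) + 1) * X ^ (m + 1) * g * vx) * hH -
    (C (C (m : ℂ)) + 1) * X ^ (m + 1) * g * vx * hB'

theorem cf_X_pow_mul (f : ℂ⟦X⟧⟦X⟧) (n i j : ℕ) : cf (X ^ n * f) i (j + n) = cf f i j := by
  rw [cf, coeff_X_pow_mul, cf]

theorem cf_C_C_mul (c : ℂ) (f : ℂ⟦X⟧⟦X⟧) (i j : ℕ) : cf (C (C c) * f) i j = c * cf f i j := by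
  rw [← smul_eq_C_mul, cf_smul]

theorem coeff_eq_of_fibered_conjugacy {N : ℕ} {p₁ p₂ : Polynomial ℂ} {μ : ℂ}
    (hμ : ∀ q : ℚ, (q : ℂ) = μ → 0 ≤ q)
    (hp₁ : p₁.coeff 0 = μ) (hp₂ : p₂.coeff 0 = μ)
    (hH : H = p₁.eval₂ ((C).comp C) X + X ^ N * W) (hψc : Conv ψ) (hψ : X ∣ ψ)
    (hc : cf ψ 0 1 ≠ 0)
    (hD : X ^ (N + 1) ∣ euler vx (1 + vx * H) ψ - ψ * (1 + vx * p₂.eval₂ ((C).comp C) ψ)) :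
    ∀ j < N, p₁.coeff j = cf ψ 0 1 ^ j * p₂.coeff j := by
  set c := cf ψ 0 1 with hc_def
  suffices h : ∀ m ≤ N, X ^ (m + 1) ∣ ψ - C (C c) * X ∧
      ∀ j < m, p₁.coeff j = c ^ j * p₂.coeff j from (h N le_rfl).2
  intro m
  induction m with
  | zero =>
    intro _
    refine ⟨?_, by simp⟩
    rw [zero_add, pow_one]
    exact dvd_sub hψ (dvd_mul_left _ _)
  | succ m ih =>
    intro hm
    obtain ⟨⟨g, hg⟩, hcoeff⟩ := ih (by omega)
    have hg' : ψ = C (C c) * X + X ^ (m + 1) * g := by rw [← hg]; ring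
    obtain ⟨V, hV⟩ := X_pow_dvd_linearization hp₁ hp₂ hH hψ hD (by omega) hg'
    set L := vx * (C (C c) * (p₁.eval₂ ((C).comp C) X -
      p₂.eval₂ ((C).comp C) (C (C c) * X))) with hL
    have hrel : ∀ i, cf L i m + (m * cf g i 0 + cf (vx * (((m : ℂ) * μ) • g)) i 0 +
        (i - 1 : ℕ) * cf g (i - 1) 0) = 0 := by
      intro i
      have h1 := congrArg (fun f => cf f i (m + 1)) hV
      simp only [cf_add] at h1
      rw [mul_assoc, cf_X_mul_succ] at h1
      have h2 : ∀ f : ℂ⟦X⟧⟦X⟧, cf (X ^ (m + 1) * f) i (m + 1) = cf f i 0 := fun f => by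
        simpa using cf_X_pow_mul f (m + 1) i 0
      rw [h2, h2, cf_X_mul_zero, cf_add, cf_add, cf_smul, cf_euler_normalForm_zero_right] at h1
      exact h1
    have hLk : ∀ k, cf L (k + 1) m = c * if k = 0 then p₁.coeff m - c ^ m * p₂.coeff m else 0 := by
      intro k
      have hX : p₁.eval₂ ((C).comp C) (X : ℂ⟦X⟧⟦X⟧) =
          p₁.eval₂ ((C).comp C) (C (C 1) * X) := by simp
      rw [hL, cf_vx_mul_succ, cf_C_C_mul, cf_sub, hX, cf_eval₂_C_mul_X, cf_eval₂_C_mul_X]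
      split_ifs <;> simp
    have hrec : ∀ k, (c * if k = 0 then p₁.coeff m - c ^ m * p₂.coeff m else 0) +
        (m * (cf g (k + 1) 0 + μ * cf g k 0) + k * cf g k 0) = 0 := by
      intro k
      have h1 := hrel (k + 1)
      rw [hLk, cf_vx_mul_succ, cf_smul] at h1
      simp only [add_tsub_cancel_right] at h1
      linear_combination h1
    have hm0 : m * cf g 0 0 = 0 := by
      have h1 := hrel 0
      rw [hL, cf_vx_mul_zero, cf_vx_mul_zero] at h1
      simpa using h1
    have hgc : Conv g := by
      refine Conv.of_X_pow_mul (n := m + 1) ?_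
      rw [← hg]
      exact hψc.sub ((conv_C_C c).mul conv_X)
    have hzero : ∀ i, cf g i 0 = 0 := by
      rcases Nat.eq_zero_or_pos m with rfl | hmpos
      · intro i
        rcases Nat.eq_zero_or_pos i with rfl | hi
        · have h1 := congrArg (fun f => cf f 0 1) hg'
          simp only [cf_add, cf_C_C_mul, zero_add, pow_one, cf_X_mul_succ g 0 0] at h1
          have h2 : cf (X : ℂ⟦X⟧⟦X⟧) 0 1 = 1 := by simp [cf, coeff_X]
          rw [h2, ← hc_def] at h1
          linear_combination -h1
        · have h1 := hrec i
          rw [if_neg hi.ne'] at h1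
          simpa [hi.ne'] using h1
      · obtain ⟨M, R, hR, hM⟩ := hgc.exists_cf_le
        refine eq_zero_of_recurrence hμ hmpos (M := M) hR (fun k => by simpa using hM k 0) ?_ ?_
        · exact (mul_eq_zero.1 hm0).resolve_left (by exact_mod_cast hmpos.ne')
        · intro k hk
          have h1 := hrec k
          rw [if_neg hk.ne'] at h1
          simpa using h1
    have hcm : p₁.coeff m = c ^ m * p₂.coeff m := by
      have h1 := hrec 0
      rw [hzero, hzero] at h1
      simp only [if_true, mul_zero, add_zero, mul_eq_zero, hc, false_or] at h1
      exact sub_eq_zero.1 h1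
    refine ⟨?_, fun j hj => ?_⟩
    · rw [hg, pow_succ _ (m + 1)]
      refine mul_dvd_mul_left _ ?_
      have := X_pow_dvd_iff_cf (m := 1) (f := g)
      rw [pow_one] at this
      exact this.2 fun i j hj => by rw [Nat.lt_one_iff.1 hj, hzero]
    · rcases Nat.lt_succ_iff_lt_or_eq.1 hj with h | rfl
      · exact hcoeff j h
      · exact hcm

end

section

/-! ### Iterated directional derivatives -/

section DirectionalDerivative

variable {E : Type*} [NormedAddCommGroup E] [NormedSpace ℂ E]

/-- The derivative of `f` in the constant direction `v`, as a function of the point. -/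
noncomputable def pd (v : E) (f : E → ℂ) : E → ℂ := fun p => fderiv ℂ f p v

theorem analyticAt_pd (v : E) {f : E → ℂ} {p : E} (hf : AnalyticAt ℂ f p) :
    AnalyticAt ℂ (pd v f) p :=
  ((ContinuousLinearMap.apply ℂ ℂ v).analyticAt _).comp hf.fderiv

theorem analyticAt_iterate_pd (v : E) {f : E → ℂ} {p : E} (hf : AnalyticAt ℂ f p) (n : ℕ) :
    AnalyticAt ℂ ((pd v)^[n] f) p := by
  induction n with
  | zero => exact hf
  | succ n ih => rw [Function.iterate_succ_apply']; exact analyticAt_pd v ih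

theorem pd_congr (v : E) {f g : E → ℂ} {p : E} (h : f =ᶠ[𝓝 p] g) : pd v f =ᶠ[𝓝 p] pd v g := by
  filter_upwards [h.fderiv (𝕜 := ℂ)] with q hq
  rw [pd, pd, hq]

theorem iterate_pd_congr (v : E) {f g : E → ℂ} {p : E} (h : f =ᶠ[𝓝 p] g) (n : ℕ) :
    (pd v)^[n] f =ᶠ[𝓝 p] (pd v)^[n] g := by
  induction n with
  | zero => exact h
  | succ n ih => simp only [Function.iterate_succ_apply']; exact pd_congr v ih

theorem pd_add (v : E) {f g : E → ℂ} {p : E} (hf : AnalyticAt ℂ f p) (hg : AnalyticAt ℂ g p) :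
    pd v (f + g) =ᶠ[𝓝 p] pd v f + pd v g := by
  filter_upwards [hf.eventually_analyticAt, hg.eventually_analyticAt] with q hfq hgq
  simp [pd, fderiv_add hfq.differentiableAt hgq.differentiableAt]

theorem pd_mul (v : E) {f g : E → ℂ} {p : E} (hf : AnalyticAt ℂ f p) (hg : AnalyticAt ℂ g p) :
    pd v (f * g) =ᶠ[𝓝 p] pd v f * g + f * pd v g := by
  filter_upwards [hf.eventually_analyticAt, hg.eventually_analyticAt] with q hfq hgq
  simp [pd, fderiv_mul hfq.differentiableAt hgq.differentiableAt]
  ring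

theorem pd_comm (v w : E) {f : E → ℂ} {p : E} (hf : AnalyticAt ℂ f p) :
    pd v (pd w f) =ᶠ[𝓝 p] pd w (pd v f) := by
  have key : ∀ (a b : E) (q : E), AnalyticAt ℂ f q →
      pd a (pd b f) q = fderiv ℂ (fderiv ℂ f) q a b := by
    intro a b q hq
    change fderiv ℂ (fun p => fderiv ℂ f p b) q a = _
    rw [fderiv_clm_apply hq.fderiv.differentiableAt (differentiableAt_const b)]
    simp
  filter_upwards [hf.eventually_analyticAt] with q hq
  rw [key v w q hq, key w v q hq]
  exact (ContDiffAt.isSymmSndFDerivAt_of_omega hq.contDiffAt).eq v w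

theorem pd_iterate_comm (v w : E) {f : E → ℂ} {p : E} (hf : AnalyticAt ℂ f p) (n : ℕ) :
    (pd w)^[n] (pd v f) =ᶠ[𝓝 p] pd v ((pd w)^[n] f) := by
  induction n with
  | zero => rfl
  | succ n ih =>
    simp only [Function.iterate_succ_apply']
    exact (pd_congr w ih).trans (pd_comm w v (analyticAt_iterate_pd w hf n))

theorem iterate_pd_eq_iteratedDeriv {U : Set E} (hU : IsOpen U) {f : E → ℂ}
    (hf : AnalyticOnNhd ℂ f U) (p v : E) (n : ℕ) {t : ℂ} (ht : p + t • v ∈ U) :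
    (pd v)^[n] f (p + t • v) = iteratedDeriv n (fun s : ℂ => f (p + s • v)) t := by
  induction n generalizing t with
  | zero => simp
  | succ n ih =>
    have hline : HasDerivAt (fun s : ℂ => p + s • v) v t := by
      simpa using ((hasDerivAt_id t).smul_const v).const_add p
    have hpre : ∀ᶠ s in 𝓝 t, p + s • v ∈ U := hline.continuousAt.eventually (hU.mem_nhds ht)
    rw [iteratedDeriv_succ, Function.iterate_succ_apply']
    have h1 : iteratedDeriv n (fun s : ℂ => f (p + s • v)) =ᶠ[𝓝 t]
        fun s => (pd v)^[n] f (p + s • v) := hpre.mono fun s hs => (ih hs).symm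
    rw [h1.deriv_eq]
    have h2 := (analyticAt_iterate_pd v (hf _ ht) n).differentiableAt.hasFDerivAt
    exact (h2.comp_hasDerivAt t hline).deriv.symm

theorem norm_iterate_pd_le {U : Set E} (hU : IsOpen U) {f : E → ℂ}
    (hf : AnalyticOnNhd ℂ f U) {p v : E} {r M : ℝ} (hr : 0 < r)
    (hline : ∀ t : ℂ, ‖t‖ ≤ r → p + t • v ∈ U ∧ ‖f (p + t • v)‖ ≤ M) (n : ℕ) :
    ‖(pd v)^[n] f p‖ ≤ n.factorial * M / r ^ n := by
  have h0 := iterate_pd_eq_iteratedDeriv hU hf p v n (t := 0) (hline 0 (by simpa using hr.le)).1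
  rw [zero_smul, add_zero] at h0
  rw [h0]
  refine Complex.norm_iteratedDeriv_le_of_forall_mem_sphere_norm_le n hr ?_ fun z hz => ?_
  · refine DifferentiableOn.diffContOnCl ?_
    rw [closure_ball _ hr.ne']
    intro z hz
    have h1 : ‖z‖ ≤ r := by simpa using hz
    have h2 : DifferentiableAt ℂ (fun s : ℂ => p + s • v) z := by fun_prop
    exact ((hf _ (hline z h1).1).differentiableAt.comp z h2).differentiableWithinAt
  · exact (hline z (by simpa using (mem_sphere_iff_norm.1 hz).le)).2

end DirectionalDerivative

/-! ### Taylor expansion at the origin of `ℂ × ℂ` -/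

/-- The Taylor series at `0` of a function of two variables. -/
noncomputable def taylor (f : ℂ × ℂ → ℂ) : ℂ⟦X⟧⟦X⟧ :=
  PowerSeries.mk fun j => PowerSeries.mk fun i =>
    (pd (1, 0))^[i] ((pd (0, 1))^[j] f) 0 / (i.factorial * j.factorial)

theorem cf_taylor (f : ℂ × ℂ → ℂ) (i j : ℕ) :
    cf (taylor f) i j =
      (pd (1, 0))^[i] ((pd (0, 1))^[j] f) 0 / (i.factorial * j.factorial) := by
  simp [cf, taylor]

theorem cf_taylor_zero_zero (f : ℂ × ℂ → ℂ) : cf (taylor f) 0 0 = f 0 := by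
  simp [cf_taylor]

variable {f g : ℂ × ℂ → ℂ}

theorem taylor_congr (h : f =ᶠ[𝓝 0] g) : taylor f = taylor g :=
  ext_cf fun i j => by
    rw [cf_taylor, cf_taylor, (iterate_pd_congr _ (iterate_pd_congr _ h j) i).eq_of_nhds]

theorem iterate_pd_add {E : Type*} [NormedAddCommGroup E] [NormedSpace ℂ E] (v : E)
    {f g : E → ℂ} {p : E} (hf : AnalyticAt ℂ f p) (hg : AnalyticAt ℂ g p) (n : ℕ) :
    (pd v)^[n] (f + g) =ᶠ[𝓝 p] (pd v)^[n] f + (pd v)^[n] g := by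
  induction n with
  | zero => rfl
  | succ n ih =>
    simp only [Function.iterate_succ_apply']
    exact (pd_congr v ih).trans (pd_add v (analyticAt_iterate_pd v hf n)
      (analyticAt_iterate_pd v hg n))

theorem taylor_add (hf : AnalyticAt ℂ f 0) (hg : AnalyticAt ℂ g 0) :
    taylor (f + g) = taylor f + taylor g :=
  ext_cf fun i j => by
    have h1 := (iterate_pd_congr (1, 0) (iterate_pd_add (0, 1) hf hg j) i).trans
      (iterate_pd_add (1, 0) (analyticAt_iterate_pd _ hf j) (analyticAt_iterate_pd _ hg j) i)
    rw [cf_add, cf_taylor, cf_taylor, cf_taylor, h1.eq_of_nhds, Pi.add_apply, add_div]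

theorem derivOuter_taylor : derivOuter (taylor f) = taylor (pd (0, 1) f) :=
  ext_cf fun i j => by
    rw [cf_derivOuter, cf_taylor, cf_taylor, Function.iterate_succ_apply, Nat.factorial_succ]
    have : (j : ℂ) + 1 ≠ 0 := by exact_mod_cast j.succ_ne_zero
    push_cast
    field_simp

theorem derivInner_taylor (hf : AnalyticAt ℂ f 0) :
    derivInner (taylor f) = taylor (pd (1, 0) f) :=
  ext_cf fun i j => by
    rw [cf_derivInner, cf_taylor, cf_taylor,
      (iterate_pd_congr _ (pd_iterate_comm (1, 0) (0, 1) hf j) i).eq_of_nhds,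
      Function.iterate_succ_apply, Nat.factorial_succ]
    have : (i : ℂ) + 1 ≠ 0 := by exact_mod_cast i.succ_ne_zero
    push_cast
    field_simp

theorem ext_of_derivs {a b : ℂ⟦X⟧⟦X⟧} (h0 : cf a 0 0 = cf b 0 0)
    (h1 : derivInner a = derivInner b) (h2 : derivOuter a = derivOuter b) : a = b := by
  refine ext_cf fun i j => ?_
  cases j with
  | succ j =>
    have := congrArg (fun f => cf f i j) h2
    simp only [cf_derivOuter] at this
    exact mul_left_cancel₀ (by exact_mod_cast j.succ_ne_zero) this
  | zero =>
    cases i with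
    | zero => exact h0
    | succ i =>
      have := congrArg (fun f => cf f i 0) h1
      simp only [cf_derivInner] at this
      exact mul_left_cancel₀ (by exact_mod_cast i.succ_ne_zero) this

theorem taylor_mul (hf : AnalyticAt ℂ f 0) (hg : AnalyticAt ℂ g 0) :
    taylor (f * g) = taylor f * taylor g := by
  have outer : ∀ f g : ℂ × ℂ → ℂ, AnalyticAt ℂ f 0 → AnalyticAt ℂ g 0 →
      derivOuter (taylor (f * g) - taylor f * taylor g) =
        (taylor (pd (0, 1) f * g) - taylor (pd (0, 1) f) * taylor g) +
        (taylor (f * pd (0, 1) g) - taylor f * taylor (pd (0, 1) g)) := by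
    intro f g hf hg
    have h1 : derivOuter (taylor (f * g) - taylor f * taylor g) =
        derivOuter (taylor (f * g)) - derivOuter (taylor f * taylor g) := by
      refine ext_cf fun i j => ?_
      simp only [cf_derivOuter, cf_sub]; ring
    rw [h1, derivOuter_mul, derivOuter_taylor, derivOuter_taylor, derivOuter_taylor,
      taylor_congr (pd_mul _ hf hg), taylor_add ((analyticAt_pd _ hf).mul hg)
        (hf.mul (analyticAt_pd _ hg))]
    ring
  have inner : ∀ f g : ℂ × ℂ → ℂ, AnalyticAt ℂ f 0 → AnalyticAt ℂ g 0 →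
      derivInner (taylor (f * g) - taylor f * taylor g) =
        (taylor (pd (1, 0) f * g) - taylor (pd (1, 0) f) * taylor g) +
        (taylor (f * pd (1, 0) g) - taylor f * taylor (pd (1, 0) g)) := by
    intro f g hf hg
    have h1 : derivInner (taylor (f * g) - taylor f * taylor g) =
        derivInner (taylor (f * g)) - derivInner (taylor f * taylor g) := by
      refine ext_cf fun i j => ?_
      simp only [cf_derivInner, cf_sub]; ring
    rw [h1, derivInner_mul, derivInner_taylor (hf.mul hg), derivInner_taylor hf,
      derivInner_taylor hg, taylor_congr (pd_mul _ hf hg),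
      taylor_add ((analyticAt_pd _ hf).mul hg) (hf.mul (analyticAt_pd _ hg))]
    ring
  suffices h : ∀ j i (f g : ℂ × ℂ → ℂ), AnalyticAt ℂ f 0 → AnalyticAt ℂ g 0 →
      cf (taylor (f * g) - taylor f * taylor g) i j = 0 from
    sub_eq_zero.1 (ext_cf fun i j => by rw [h j i f g hf hg, cf_zero])
  intro j
  induction j with
  | succ j ih =>
    intro i f g hf hg
    have h1 := congrArg (fun f => cf f i j) (outer f g hf hg)
    simp only [cf_derivOuter, cf_add] at h1
    rw [ih i _ _ (analyticAt_pd _ hf) hg, ih i _ _ hf (analyticAt_pd _ hg), add_zero] at h1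
    exact (mul_eq_zero.1 h1).resolve_left (by exact_mod_cast j.succ_ne_zero)
  | zero =>
    intro i
    induction i with
    | succ i ih =>
      intro f g hf hg
      have h1 := congrArg (fun f => cf f i 0) (inner f g hf hg)
      simp only [cf_derivInner, cf_add] at h1
      rw [ih _ _ (analyticAt_pd _ hf) hg, ih _ _ hf (analyticAt_pd _ hg), add_zero] at h1
      exact (mul_eq_zero.1 h1).resolve_left (by exact_mod_cast i.succ_ne_zero)
    | zero =>
      intro f g _ _
      rw [cf_sub, cf_mul_zero_zero, cf_taylor_zero_zero, cf_taylor_zero_zero, cf_taylor_zero_zero,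
        Pi.mul_apply, sub_self]

theorem pd_const (v : ℂ × ℂ) (c : ℂ) : pd v (fun _ => c) = fun _ => 0 := by
  funext p; simp [pd]

theorem taylor_const (c : ℂ) : taylor (fun _ => c) = C (C c) := by
  have h0 : taylor (fun _ => (0 : ℂ)) = 0 := by
    have := taylor_add (f := fun _ => (0 : ℂ)) (g := fun _ => 0) analyticAt_const analyticAt_const
    have h1 : ((fun _ => (0 : ℂ)) + fun _ => 0 : ℂ × ℂ → ℂ) = fun _ => 0 := by funext; simp
    rwa [h1, left_eq_add] at this
  refine ext_of_derivs ?_ ?_ ?_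
  · simp [cf_taylor_zero_zero, cf_C_C]
  · rw [derivInner_taylor analyticAt_const, pd_const, h0, derivInner_C_C]
  · rw [derivOuter_taylor, pd_const, h0, derivOuter_C_C]

theorem taylor_fst : taylor Prod.fst = vx := by
  refine ext_of_derivs ?_ ?_ ?_
  · rw [cf_taylor_zero_zero]; simp [cf, vx]
  · have : pd (1, 0) (Prod.fst : ℂ × ℂ → ℂ) = fun _ => 1 := by
      funext p; simp [pd, fderiv_fst]
    rw [derivInner_taylor analyticAt_fst, this, taylor_const, derivInner_vx]
    simp
  · have : pd (0, 1) (Prod.fst : ℂ × ℂ → ℂ) = fun _ => 0 := by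
      funext p; simp [pd, fderiv_fst]
    rw [derivOuter_taylor, this, taylor_const, derivOuter_vx]
    simp

theorem taylor_snd : taylor Prod.snd = X := by
  refine ext_of_derivs ?_ ?_ ?_
  · rw [cf_taylor_zero_zero]; simp [cf]
  · have : pd (1, 0) (Prod.snd : ℂ × ℂ → ℂ) = fun _ => 0 := by
      funext p; simp [pd, fderiv_snd]
    rw [derivInner_taylor analyticAt_snd, this, taylor_const, derivInner_X]
    simp
  · have : pd (0, 1) (Prod.snd : ℂ × ℂ → ℂ) = fun _ => 1 := by
      funext p; simp [pd, fderiv_snd]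
    rw [derivOuter_taylor, this, taylor_const, derivOuter_X]
    simp

theorem taylor_pow (hf : AnalyticAt ℂ f 0) (n : ℕ) : taylor (f ^ n) = taylor f ^ n := by
  induction n with
  | zero => rw [pow_zero, pow_zero]; exact (taylor_const 1).trans (by simp)
  | succ n ih => rw [pow_succ, pow_succ, taylor_mul (hf.pow n) hf, ih]

theorem taylor_polynomial (hf : AnalyticAt ℂ f 0) (p : Polynomial ℂ) :
    AnalyticAt ℂ (fun q => p.eval (f q)) 0 ∧
      taylor (fun q => p.eval (f q)) = p.eval₂ ((C).comp C) (taylor f) := by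
  induction p using Polynomial.induction_on' with
  | add p q hp hq =>
    simp only [Polynomial.eval_add, Polynomial.eval₂_add]
    exact ⟨hp.1.add hq.1, by rw [← hp.2, ← hq.2]; exact taylor_add hp.1 hq.1⟩
  | monomial n c =>
    simp only [Polynomial.eval_monomial, Polynomial.eval₂_monomial]
    refine ⟨analyticAt_const.mul (hf.pow n), ?_⟩
    rw [← taylor_pow hf, RingHom.comp_apply, ← taylor_const]
    exact taylor_mul analyticAt_const (hf.pow n)

theorem conv_taylor (hf : AnalyticAt ℂ f 0) : Conv (taylor f) := by
  obtain ⟨ρ, hρ, hball⟩ : ∃ ρ > 0, ∀ p ∈ Metric.ball (0 : ℂ × ℂ) ρ,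
      AnalyticAt ℂ f p ∧ ‖f p‖ ≤ ‖f 0‖ + 1 := by
    have h1 : ∀ᶠ p in 𝓝 (0 : ℂ × ℂ), ‖f p‖ ≤ ‖f 0‖ + 1 :=
      (hf.continuousAt.norm.eventually_lt continuousAt_const (lt_add_one _)).mono fun _ => le_of_lt
    exact Metric.eventually_nhds_iff_ball.1 (hf.eventually_analyticAt.and h1)
  set U := Metric.ball (0 : ℂ × ℂ) ρ
  have hfU : AnalyticOnNhd ℂ f U := fun p hp => (hball p hp).1
  set r := ρ / 2 with hr
  have hr0 : 0 < r := by positivity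
  have hmem : ∀ x y : ℂ, ‖x‖ ≤ r → ‖y‖ ≤ r → (x, y) ∈ U := by
    intro x y hx hy
    simp only [U, Metric.mem_ball, dist_zero_right, Prod.norm_def, max_lt_iff]
    constructor <;> linarith
  have hy : ∀ (j : ℕ) (x : ℂ), ‖x‖ ≤ r →
      ‖(pd (0, 1))^[j] f (x, 0)‖ ≤ j.factorial * (‖f 0‖ + 1) / r ^ j := by
    intro j x hx
    refine norm_iterate_pd_le Metric.isOpen_ball hfU hr0 (fun t ht => ?_) j
    have h1 : (x, (0 : ℂ)) + t • ((0 : ℂ), (1 : ℂ)) = (x, t) := by simp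
    rw [h1]
    exact ⟨hmem x t hx ht, (hball _ (hmem x t hx ht)).2⟩
  refine conv_of_cf_le (M := ‖f 0‖ + 1) (R := r⁻¹) (inv_pos.2 hr0) fun i j => ?_
  have hx : ‖(pd (1, 0))^[i] ((pd (0, 1))^[j] f) 0‖ ≤
      i.factorial * (j.factorial * (‖f 0‖ + 1) / r ^ j) / r ^ i := by
    refine norm_iterate_pd_le Metric.isOpen_ball
      (fun p hp => analyticAt_iterate_pd _ (hfU p hp) j) hr0 (fun t ht => ?_) i
    have h1 : (0 : ℂ × ℂ) + t • ((1 : ℂ), (0 : ℂ)) = (t, 0) := by simp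
    rw [h1]
    exact ⟨hmem t 0 ht (by simpa using hr0.le), hy j t ht⟩
  rw [cf_taylor, norm_div, norm_mul, Complex.norm_natCast, Complex.norm_natCast]
  have hi : (0 : ℝ) < i.factorial := by exact_mod_cast i.factorial_pos
  have hj : (0 : ℝ) < j.factorial := by exact_mod_cast j.factorial_pos
  rw [div_le_iff₀ (by positivity)]
  refine hx.trans (le_of_eq ?_)
  rw [inv_pow, pow_add]
  field_simp

end

section

/-! ### From germs to formal series -/

theorem exists_polynomial_add_pow_mul {h : ℂ → ℂ} (hh : AnalyticAt ℂ h 0) (N : ℕ) :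
    ∃ (p : Polynomial ℂ) (r : ℂ → ℂ), AnalyticAt ℂ r 0 ∧
      ∀ z, h z = p.eval z + z ^ N * r z := by
  induction N with
  | zero => exact ⟨0, h, hh, fun z => by simp⟩
  | succ N ih =>
    obtain ⟨p, r, hr, hp⟩ := ih
    obtain ⟨q, hq⟩ := hr
    refine ⟨p + Polynomial.C (r 0) * Polynomial.X ^ N, dslope r 0,
      hq.has_fpower_series_dslope_fslope.analyticAt, fun z => ?_⟩
    have h1 := sub_smul_dslope r 0 z
    rw [smul_eq_mul, sub_zero] at h1
    rw [hp z]
    simp only [Polynomial.eval_add, Polynomial.eval_mul, Polynomial.eval_C, Polynomial.eval_pow,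
      Polynomial.eval_X]
    linear_combination (-z ^ N) * h1

theorem det_eq_pd (L : ℂ × ℂ →L[ℂ] ℂ × ℂ) :
    LinearMap.det L.toLinearMap =
      (L (1, 0)).1 * (L (0, 1)).2 - (L (0, 1)).1 * (L (1, 0)).2 := by
  rw [← LinearMap.det_toMatrix (Module.Basis.finTwoProd ℂ), Matrix.det_fin_two]
  simp [LinearMap.toMatrix_apply]

theorem fderiv_apply_eq_pd {Φ : ℂ × ℂ → ℂ × ℂ} {p : ℂ × ℂ} (hΦ : DifferentiableAt ℂ Φ p)
    (a b : ℂ) : fderiv ℂ Φ p (a, b) =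
      (a * pd (1, 0) (fun q => (Φ q).1) p + b * pd (0, 1) (fun q => (Φ q).1) p,
        a * pd (1, 0) (fun q => (Φ q).2) p + b * pd (0, 1) (fun q => (Φ q).2) p) := by
  have h1 : ∀ v, pd v (fun q => (Φ q).1) p = (fderiv ℂ Φ p v).1 := fun v => by
    rw [pd, fderiv.fst hΦ]; rfl
  have h2 : ∀ v, pd v (fun q => (Φ q).2) p = (fderiv ℂ Φ p v).2 := fun v => by
    rw [pd, fderiv.snd hΦ]; rfl
  rw [h1, h1, h2, h2, show ((a, b) : ℂ × ℂ) = a • (1, 0) + b • (0, 1) by simp, map_add, map_smul,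
    map_smul]
  ext <;> simp

theorem taylor_comp_eq {h : ℂ → ℂ} {p : Polynomial ℂ} {r : ℂ → ℂ} {N : ℕ}
    (hr : AnalyticAt ℂ r 0) (hp : ∀ z, h z = p.eval z + z ^ N * r z)
    {f : ℂ × ℂ → ℂ} (hf : AnalyticAt ℂ f 0) (hf0 : f 0 = 0) :
    Conv (taylor fun q => r (f q)) ∧
      taylor (fun q => h (f q)) =
        p.eval₂ ((C).comp C) (taylor f) + taylor f ^ N * taylor (fun q => r (f q)) := by
  have hrf : AnalyticAt ℂ (fun q => r (f q)) 0 := AnalyticAt.comp (by rwa [hf0]) hf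
  have hpf := taylor_polynomial hf p
  refine ⟨conv_taylor hrf, ?_⟩
  rw [← hpf.2, ← taylor_pow hf, ← taylor_mul (hf.pow N) hrf,
    ← taylor_add hpf.1 ((hf.pow N).mul hrf)]
  exact congrArg taylor (funext fun q => hp (f q))

theorem taylor_normalForm_apply {h : ℂ → ℂ} (hh : AnalyticAt ℂ h 0) {f : ℂ × ℂ → ℂ}
    (hf : AnalyticAt ℂ f 0) :
    taylor (fun p => p.1 ^ 2 * pd (1, 0) f p + (p.2 + p.1 * p.2 * h p.2) * pd (0, 1) f p) =
      euler vx (1 + vx * taylor fun p => h p.2) (taylor f) := by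
  have hh' : AnalyticAt ℂ (fun p : ℂ × ℂ => h p.2) 0 := AnalyticAt.comp hh analyticAt_snd
  have hx : AnalyticAt ℂ (Prod.fst : ℂ × ℂ → ℂ) 0 := analyticAt_fst
  have hy : AnalyticAt ℂ (Prod.snd : ℂ × ℂ → ℂ) 0 := analyticAt_snd
  have h1 := analyticAt_pd (1, 0) hf
  have h2 := analyticAt_pd (0, 1) hf
  have h3 := hy.add ((hx.mul hy).mul hh')
  have key := taylor_add ((hx.pow 2).mul h1) (h3.mul h2)
  rw [taylor_mul (hx.pow 2) h1, taylor_mul h3 h2, taylor_add hy ((hx.mul hy).mul hh'),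
    taylor_mul (hx.mul hy) hh', taylor_mul hx hy, taylor_pow hx, taylor_fst, taylor_snd,
    ← derivInner_taylor hf, ← derivOuter_taylor] at key
  refine Eq.trans ?_ (key.trans ?_)
  · rfl
  · rw [euler]; ring

/-- The Taylor coefficients of `h₁` and `h₂` of equivalent normal forms correspond to each other
under a homothety. -/
theorem exists_coeff_eq_of_foliationEquiv {μ : ℂ} {h₁ h₂ : ℂ → ℂ} (hh₁ : AnalyticAt ℂ h₁ 0)
    (hh₂ : AnalyticAt ℂ h₂ 0) (h₁0 : h₁ 0 = μ) (h₂0 : h₂ 0 = μ)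
    (hμ : ∀ q : ℚ, (q : ℂ) = μ → 0 ≤ q)
    (hequiv : FoliationEquiv (fun p => (p.1 ^ 2, p.2 + p.1 * p.2 * h₁ p.2))
      (fun p => (p.1 ^ 2, p.2 + p.1 * p.2 * h₂ p.2))) :
    ∃ c : ℂ, c ≠ 0 ∧ ∀ (N : ℕ) (p₁ p₂ : Polynomial ℂ) (r₁ r₂ : ℂ → ℂ),
      AnalyticAt ℂ r₁ 0 → AnalyticAt ℂ r₂ 0 → (∀ z, h₁ z = p₁.eval z + z ^ N * r₁ z) →
      (∀ z, h₂ z = p₂.eval z + z ^ N * r₂ z) → ∀ j < N, p₁.coeff j = c ^ j * p₂.coeff j := by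
  obtain ⟨Φ, u, hΦ, hΦ0, hdet, hu, hu0, heq⟩ := hequiv
  set f : ℂ × ℂ → ℂ := fun q => (Φ q).1 with hf_def
  set g : ℂ × ℂ → ℂ := fun q => (Φ q).2 with hg_def
  have hf : AnalyticAt ℂ f 0 := analyticAt_fst.comp hΦ
  have hg : AnalyticAt ℂ g 0 := analyticAt_snd.comp hΦ
  have hf0 : f 0 = 0 := by simp [f, hΦ0]
  have hg0 : g 0 = 0 := by simp [g, hΦ0]
  have hh₁' : AnalyticAt ℂ (fun p : ℂ × ℂ => h₁ p.2) 0 := AnalyticAt.comp hh₁ analyticAt_snd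
  have hh₂' : AnalyticAt ℂ (fun p => h₂ (g p)) 0 := AnalyticAt.comp (by rwa [hg0]) hg
  have heq' : ∀ᶠ p in 𝓝 (0 : ℂ × ℂ),
      p.1 ^ 2 * pd (1, 0) f p + (p.2 + p.1 * p.2 * h₁ p.2) * pd (0, 1) f p = u p * f p ^ 2 ∧
      p.1 ^ 2 * pd (1, 0) g p + (p.2 + p.1 * p.2 * h₁ p.2) * pd (0, 1) g p =
        u p * (g p + f p * g p * h₂ (g p)) := by
    filter_upwards [heq, hΦ.eventually_analyticAt] with p hp hΦp
    rw [fderiv_apply_eq_pd hΦp.differentiableAt] at hp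
    exact Prod.mk.inj hp
  have hF : euler vx (1 + vx * taylor fun p => h₁ p.2) (taylor f) = taylor u * taylor f ^ 2 := by
    rw [← taylor_normalForm_apply hh₁ hf, ← taylor_pow hf, ← taylor_mul hu (hf.pow 2)]
    exact taylor_congr (heq'.mono fun p hp => hp.1)
  have hG : euler vx (1 + vx * taylor fun p => h₁ p.2) (taylor g) =
      taylor u * (taylor g + taylor f * taylor g * taylor fun p => h₂ (g p)) := by
    rw [← taylor_normalForm_apply hh₁ hg, ← taylor_mul hf hg, ← taylor_mul (hf.mul hg) hh₂',
      ← taylor_add hg ((hf.mul hg).mul hh₂'), ← taylor_mul hu (hg.add ((hf.mul hg).mul hh₂'))]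
    exact taylor_congr (heq'.mono fun p hp => hp.2)
  have hdet' : cf (taylor f) 1 0 * cf (taylor g) 0 1 -
      cf (taylor f) 0 1 * cf (taylor g) 1 0 ≠ 0 := by
    have h1 := fderiv_apply_eq_pd hΦ.differentiableAt
    rw [det_eq_pd, h1, h1] at hdet
    simpa [cf_taylor] using hdet
  obtain ⟨ψ, hψc, hXψ, hc, hψ⟩ := exists_fibered_conjugacy (conv_taylor hh₁') (conv_taylor hu)
    (conv_taylor hf) (conv_taylor hg) (by rwa [cf_taylor_zero_zero]) hF hG
    (by rw [cf_taylor_zero_zero, hf0]) hdet'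
  refine ⟨cf ψ 0 1, hc, fun N p₁ p₂ r₁ r₂ hr₁ hr₂ hp₁ hp₂ => ?_⟩
  rcases Nat.eq_zero_or_pos N with rfl | hN
  · simp
  have h1 : p₁.coeff 0 = μ := by
    rw [← h₁0, hp₁, zero_pow hN.ne', zero_mul, add_zero, Polynomial.coeff_zero_eq_eval_zero]
  have h2 : p₂.coeff 0 = μ := by
    rw [← h₂0, hp₂, zero_pow hN.ne', zero_mul, add_zero, Polynomial.coeff_zero_eq_eval_zero]
  have hH := (taylor_comp_eq hr₁ hp₁ (f := Prod.snd) analyticAt_snd rfl).2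
  rw [taylor_snd] at hH
  obtain ⟨hW, hQ⟩ := taylor_comp_eq hr₂ hp₂ hg hg0
  exact coeff_eq_of_fibered_conjugacy hμ h1 h2 hH hψc hXψ hc (hψ N p₂ _ hW hQ)

end

end SaddleNode

/-- **Theorem (uniqueness of the central-manifold normal form when `μ ∉ ℚ<0`).**
If two normal forms `X_{h₁}`, `X_{h₂}` (with `h₁ 0 = h₂ 0 = μ` and `μ` not a
negative rational) are analytically equivalent as singular foliations, then they
are conjugated by a homothety `y ↦ c·y`: `h₂ y = h₁ (y / c)` near `0`. -/
theorem saddleNode_centralManifold_normal_form_unique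
    (μ : ℂ) (h₁ h₂ : ℂ → ℂ) (hh₁ : AnalyticAt ℂ h₁ 0) (hh₂ : AnalyticAt ℂ h₂ 0)
    (h₁0 : h₁ 0 = μ) (h₂0 : h₂ 0 = μ)
    (hμ : ∀ q : ℚ, (q : ℂ) = μ → 0 ≤ q)
    (hequiv : FoliationEquiv (fun p => (p.1 ^ 2, p.2 + p.1 * p.2 * h₁ p.2))
      (fun p => (p.1 ^ 2, p.2 + p.1 * p.2 * h₂ p.2))) :
    ∃ c : ℂ, c ≠ 0 ∧ ∀ᶠ y in nhds (0 : ℂ), h₂ y = h₁ (y / c) := by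
  obtain ⟨c, hc, hcoeff⟩ :=
    SaddleNode.exists_coeff_eq_of_foliationEquiv hh₁ hh₂ h₁0 h₂0 hμ hequiv
  have hlin : AnalyticAt ℂ (fun y : ℂ => c * y) 0 := analyticAt_const.mul analyticAt_id
  have hφ : AnalyticAt ℂ (fun y => h₁ y - h₂ (c * y)) 0 :=
    hh₁.sub (AnalyticAt.comp (g := h₂) (f := fun y => c * y) (by simpa using hh₂) hlin)
  have hord : analyticOrderAt (fun y => h₁ y - h₂ (c * y)) 0 = ⊤ := by
    refine ENat.eq_top_iff_forall_ge.2 fun N => (natCast_le_analyticOrderAt hφ).2 ?_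
    obtain ⟨p₁, r₁, hr₁, hp₁⟩ := SaddleNode.exists_polynomial_add_pow_mul hh₁ N
    obtain ⟨p₂, r₂, hr₂, hp₂⟩ := SaddleNode.exists_polynomial_add_pow_mul hh₂ N
    obtain ⟨q, hq⟩ : Polynomial.X ^ N ∣ p₁ - p₂.comp (Polynomial.C c * Polynomial.X) := by
      refine Polynomial.X_pow_dvd_iff.2 fun j hj => ?_
      rw [Polynomial.coeff_sub, Polynomial.comp_C_mul_X_coeff,
        hcoeff N p₁ p₂ r₁ r₂ hr₁ hr₂ hp₁ hp₂ j hj]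
      ring
    refine ⟨fun y => q.eval y + r₁ y - c ^ N * r₂ (c * y), ?_, .of_forall fun y => ?_⟩
    · refine ((AnalyticOnNhd.eval_polynomial q 0 (Set.mem_univ _)).add hr₁).sub
        (analyticAt_const.mul ?_)
      exact AnalyticAt.comp (g := r₂) (f := fun y => c * y) (by simpa using hr₂) hlin
    · have h1 := congrArg (Polynomial.eval y) hq
      simp only [Polynomial.eval_sub, Polynomial.eval_comp, Polynomial.eval_mul,
        Polynomial.eval_pow, Polynomial.eval_C, Polynomial.eval_X] at h1
      rw [hp₁, hp₂, sub_zero, smul_eq_mul]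
      linear_combination h1
  refine ⟨c, hc, ?_⟩
  have hdiv : Tendsto (fun y : ℂ => y / c) (nhds 0) (nhds 0) := by
    have : ContinuousAt (fun y : ℂ => y / c) 0 := by fun_prop
    simpa [ContinuousAt] using this
  filter_upwards [hdiv.eventually (analyticOrderAt_eq_top.1 hord)] with y hy
  rw [mul_div_cancel₀ _ hc] at hy
  exact (sub_eq_zero.1 hy).symm
end

section
/- Let n ∈ ℕ and let f₁, f₂ be functions of one variable holomorphic near 0 ∈ ℂ with f₁(0) = f₂(0) = μ, where either μ ∉ ℝ or μ + n > 0. Set X_{f_i,n} = x²∂x + (y + x·y·f_i(xⁿ·y))∂y for i = 1, 2. If X_{f₁,n} and X_{f₂,n} are analytically equivalent as singular foliations at 0 ∈ ℂ², then they are conjugated by a homothety in the second variable: there exists c ∈ ℂ, c ≠ 0, such that f₂(t) = f₁(t/c) for all t near 0. -/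
open Filter

open scoped Topology ContDiff

section Superposition

variable {I E F : Type*} [TopologicalSpace I] [CompactSpace I]
  [NormedAddCommGroup E] [NormedSpace ℂ E] [NormedAddCommGroup F] [NormedSpace ℂ F]

/-- The pointwise action of a continuous multilinear map on continuous functions. -/
noncomputable def ContinuousMultilinearMap.superpose (I : Type*) [TopologicalSpace I]
    [CompactSpace I] {k : ℕ} (f : E [×k]→L[ℂ] F) : C(I, E) [×k]→L[ℂ] C(I, F) :=
  MultilinearMap.mkContinuous
    { toFun := fun b => ⟨fun t => f fun i => b i t, by fun_prop⟩
      map_update_add' := by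
        intro _ m i x y
        ext t
        have h : ∀ z : C(I, E), (fun j => Function.update m i z j t)
            = Function.update (fun j => m j t) i (z t) := by
          intro z; ext j; by_cases hj : j = i
          · subst hj; simp
          · simp [hj]
        simp [h]
      map_update_smul' := by
        intro _ m i c x
        ext t
        have h : ∀ z : C(I, E), (fun j => Function.update m i z j t)
            = Function.update (fun j => m j t) i (z t) := by
          intro z; ext j; by_cases hj : j = i
          · subst hj; simp
          · simp [hj]
        simp [h] }
    ‖f‖ (by
      intro m
      rw [ContinuousMap.norm_le _ (by positivity)]
      intro t
      refine (f.le_opNorm _).trans ?_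
      gcongr with i
      exact (m i).norm_coe_le_norm t)

@[simp] lemma ContinuousMultilinearMap.superpose_apply {k : ℕ} (f : E [×k]→L[ℂ] F)
    (b : Fin k → C(I, E)) (t : I) : f.superpose I b t = f fun i => b i t := rfl

lemma ContinuousMultilinearMap.norm_superpose_le {k : ℕ} (f : E [×k]→L[ℂ] F) :
    ‖f.superpose I‖ ≤ ‖f‖ :=
  MultilinearMap.mkContinuous_norm_le _ (norm_nonneg _) _

/-- An analytic germ acts by composition on small continuous functions, and this action is
analytic. -/
lemma AnalyticAt.exists_superposition [CompleteSpace F] (I : Type*) [TopologicalSpace I]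
    [CompactSpace I] {K : E → F} (hK : AnalyticAt ℂ K 0) :
    ∃ S : C(I, E) → C(I, F), AnalyticAt ℂ S 0 ∧
      ∀ᶠ b in 𝓝 (0 : C(I, E)), ∀ t, S b t = K (b t) := by
  obtain ⟨p, r, hp⟩ := hK
  let q : FormalMultilinearSeries ℂ C(I, E) C(I, F) := fun k => (p k).superpose I
  have hq : p.radius ≤ q.radius := by
    refine ENNReal.le_of_forall_nnreal_lt fun s hs => ?_
    obtain ⟨C, -, hC⟩ := p.norm_mul_pow_le_of_lt_radius hs
    refine q.le_radius_of_bound C fun k => le_trans ?_ (hC k)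
    gcongr
    exact (p k).norm_superpose_le
  have hpos : 0 < q.radius := lt_of_lt_of_le (lt_of_lt_of_le hp.r_pos hp.r_le) hq
  have hqs := q.hasFPowerSeriesOnBall hpos
  refine ⟨q.sum, hqs.analyticAt, ?_⟩
  filter_upwards [Metric.eball_mem_nhds (0 : C(I, E)) hp.r_pos] with b hb t
  have hb' : ‖b‖ₑ < r := by simpa using hb
  have h1 := hqs.hasSum (y := b) (by
    simpa using lt_of_lt_of_le hb' (hp.r_le.trans hq))
  have h2 := h1.mapL (ContinuousMap.evalCLM ℂ t : C(I, F) →L[ℂ] F)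
  have hbt : ‖b t‖ₑ ≤ ‖b‖ₑ := ENNReal.coe_le_coe.2 (b.norm_coe_le_norm t)
  have h3 := hp.hasSum (y := b t) (by simpa using lt_of_le_of_lt hbt hb')
  simp only [zero_add] at h2 h3
  exact h2.unique h3

end Superposition

/-- Integration from the left end point, on continuous functions on the unit interval. -/
noncomputable def unitPrimitive : C(unitInterval, ℂ) →L[ℂ] C(unitInterval, ℂ) :=
  LinearMap.mkContinuous
    { toFun := fun b => ⟨fun t => ∫ s in (0 : ℝ)..t, Set.IccExtend zero_le_one b s, by
        have : Continuous fun t : ℝ => ∫ s in (0 : ℝ)..t, Set.IccExtend zero_le_one b s :=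
          intervalIntegral.continuous_primitive
            (fun a c => (b.continuous.Icc_extend').intervalIntegrable a c) 0
        exact this.comp continuous_subtype_val⟩
      map_add' := by
        intro b c
        ext t
        simp only [ContinuousMap.coe_mk, ContinuousMap.add_apply]
        rw [← intervalIntegral.integral_add
          (b.continuous.Icc_extend'.intervalIntegrable _ _)
          (c.continuous.Icc_extend'.intervalIntegrable _ _)]
        rfl
      map_smul' := by
        intro a b
        ext t
        simp only [ContinuousMap.coe_mk, ContinuousMap.smul_apply, RingHom.id_apply]
        rw [← intervalIntegral.integral_smul]
        rfl } 1 (by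
      intro b
      rw [ContinuousMap.norm_le _ (by positivity)]
      intro t
      have := intervalIntegral.norm_integral_le_of_norm_le_const
        (a := (0 : ℝ)) (b := t) (C := ‖b‖) (f := Set.IccExtend zero_le_one b)
        (fun s _ => b.norm_coe_le_norm _)
      refine this.trans ?_
      have h0 := t.2.1
      have h1 := t.2.2
      rw [sub_zero, abs_of_nonneg h0, one_mul]
      exact mul_le_of_le_one_right (norm_nonneg _) h1)

lemma unitPrimitive_apply (b : C(unitInterval, ℂ)) (t : unitInterval) :
    unitPrimitive b t = ∫ s in (0 : ℝ)..t, Set.IccExtend zero_le_one b s := rfl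

/-- Division of an analytic germ by the coordinate `ℓ`, along the projection `π` onto its kernel. -/
lemma AnalyticAt.exists_sub_eq_mul {E : Type*} [NormedAddCommGroup E] [NormedSpace ℂ E]
    {F : E → ℂ} (hF : AnalyticAt ℂ F 0) (π : E →L[ℂ] E) (ℓ : E →L[ℂ] ℂ) (e : E)
    (h : ∀ z, z = π z + ℓ z • e) :
    ∃ G : E → ℂ, AnalyticAt ℂ G 0 ∧ ∀ᶠ z in 𝓝 (0 : E), F z = F (π z) + ℓ z * G z := by
  obtain ⟨S, hS, hSe⟩ := AnalyticAt.exists_superposition unitInterval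
    (K := fun z => fderiv ℂ F z e)
    ((ContinuousLinearMap.apply ℂ ℂ e).analyticAt _ |>.comp hF.fderiv)
  let c : E →L[ℂ] C(unitInterval, E) :=
    LinearMap.mkContinuous
      { toFun := fun z => ⟨fun t => π z + ((t : ℝ) : ℂ) • (ℓ z • e), by fun_prop⟩
        map_add' := by intro z w; ext t; simp [add_smul, smul_add]; abel
        map_smul' := by
          intro a z; ext t; simp [smul_smul]; congr 1; ring }
      (‖π‖ + ‖ℓ‖ * ‖e‖) (by
        intro z
        rw [ContinuousMap.norm_le _ (by positivity)]
        intro t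
        have ht : ‖((t : ℝ) : ℂ)‖ ≤ 1 := by
          rw [Complex.norm_real, Real.norm_eq_abs, abs_of_nonneg t.2.1]; exact t.2.2
        calc ‖π z + ((t : ℝ) : ℂ) • (ℓ z • e)‖ ≤ ‖π z‖ + ‖((t : ℝ) : ℂ)‖ * (‖ℓ z‖ * ‖e‖) := by
              refine (norm_add_le _ _).trans ?_
              rw [norm_smul, norm_smul]
          _ ≤ ‖π‖ * ‖z‖ + 1 * ((‖ℓ‖ * ‖z‖) * ‖e‖) := by
              gcongr
              · exact π.le_opNorm z
              · exact ℓ.le_opNorm z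
          _ = _ := by ring)
  have hc : ∀ z t, c z t = π z + ((t : ℝ) : ℂ) • (ℓ z • e) := fun _ _ => rfl
  let ev : C(unitInterval, ℂ) →L[ℂ] ℂ := ContinuousMap.evalCLM ℂ 1
  have hc0 : Tendsto c (𝓝 0) (𝓝 0) := by simpa using c.continuous.tendsto 0
  refine ⟨fun z => ev (unitPrimitive (S (c z))), ?_, ?_⟩
  · have h1 : AnalyticAt ℂ (fun z => S (c z)) 0 :=
      AnalyticAt.comp (by simpa using hS) (c.analyticAt 0)
    exact (ev.comp unitPrimitive).analyticAt _ |>.comp h1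
  · have hFd : ∀ᶠ b in 𝓝 (0 : C(unitInterval, E)), ∀ t, DifferentiableAt ℂ F (b t) := by
      obtain ⟨ε, hε, hb⟩ := Metric.eventually_nhds_iff.1 hF.eventually_analyticAt
      filter_upwards [Metric.ball_mem_nhds (0 : C(unitInterval, E)) hε] with b hb' t
      refine (hb ?_).differentiableAt
      rw [dist_zero_right]
      exact lt_of_le_of_lt (b.norm_coe_le_norm t) (by simpa using hb')
    filter_upwards [hc0.eventually hSe, hc0.eventually hFd] with z hz hd
    have key : ∀ s ∈ Set.uIcc (0 : ℝ) 1, HasDerivAt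
        (fun s : ℝ => F (π z + (s : ℂ) • (ℓ z • e)))
        (ℓ z * Set.IccExtend zero_le_one (S (c z)) s) s := by
      intro s hs
      rw [Set.uIcc_of_le zero_le_one] at hs
      rw [Set.IccExtend_of_mem _ _ hs, hz ⟨s, hs⟩]
      have h1 : HasDerivAt (fun s : ℝ => π z + (s : ℂ) • (ℓ z • e)) (ℓ z • e) s := by
        have := (Complex.ofRealCLM.hasDerivAt (x := s)).smul_const (ℓ z • e)
        simpa using this.const_add (π z)
      have h2 := (hd ⟨s, hs⟩).hasFDerivAt.restrictScalars ℝ |>.comp_hasDerivAt s h1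
      simpa [hc, Function.comp_def] using h2
    have hprim := intervalIntegral.integral_eq_sub_of_hasDerivAt key
      ((continuous_const.mul (S (c z)).continuous.Icc_extend').intervalIntegrable _ _)
    rw [intervalIntegral.integral_const_mul] at hprim
    have hev : ev (unitPrimitive (S (c z)))
        = ∫ s in (0 : ℝ)..1, Set.IccExtend zero_le_one (S (c z)) s := rfl
    rw [hev, hprim]
    simp only [Complex.ofReal_one, one_smul, Complex.ofReal_zero, zero_smul, add_zero]
    rw [← h z]; ring

lemma AnalyticAt.eventually_hasSum_iteratedDeriv {r : ℂ → ℂ} (hr : AnalyticAt ℂ r 0) :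
    ∀ᶠ x in 𝓝 (0 : ℂ), HasSum (fun j : ℕ => x ^ j * (iteratedDeriv j r 0 / j.factorial)) (r x) := by
  have := hasFPowerSeriesAt_iff.1 hr.hasFPowerSeriesAt
  simpa [FormalMultilinearSeries.coeff_ofScalars] using this

lemma eq_zero_of_eventually_hasSum_zero {e : ℕ → ℂ}
    (h : ∀ᶠ x in 𝓝 (0 : ℂ), HasSum (fun j : ℕ => x ^ j * e j) 0) (j : ℕ) : e j = 0 := by
  have h1 : HasFPowerSeriesAt (fun _ : ℂ => (0 : ℂ)) (FormalMultilinearSeries.ofScalars ℂ e) 0 := by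
    rw [hasFPowerSeriesAt_iff]
    simpa [FormalMultilinearSeries.coeff_ofScalars] using h
  have h2 := HasFPowerSeriesAt.eq_zero (p := FormalMultilinearSeries.ofScalars ℂ e) h1
  have h3 : (FormalMultilinearSeries.ofScalars ℂ e).coeff j = 0 := by
    rw [h2]; rfl
  simpa [FormalMultilinearSeries.coeff_ofScalars] using h3

/-- Away from the resonances, Euler's equation with a monomial right-hand side has no convergent
solution except the trivial one. -/
lemma euler_equation_convergent_solution {r : ℂ → ℂ} (hr : AnalyticAt ℂ r 0) {μ d : ℂ} {m n : ℕ}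
    (hm : 0 < m) (hμ : ∀ s : ℝ, (s : ℂ) = μ → 0 < s + n)
    (h : ∀ᶠ x in 𝓝 (0 : ℂ),
      x ^ 2 * deriv r x + m * (1 + μ * x) * r x = d * x ^ (n * m + 1)) :
    d = 0 ∧ ∀ᶠ x in 𝓝 (0 : ℂ), r x = 0 := by
  set a : ℕ → ℂ := fun j => iteratedDeriv j r 0 / j.factorial with ha
  have hmC : (m : ℂ) ≠ 0 := by exact_mod_cast hm.ne'
  have hs := hr.eventually_hasSum_iteratedDeriv
  have hs' : ∀ᶠ x in 𝓝 (0 : ℂ), HasSum (fun j : ℕ => x ^ j * ((j + 1) * a (j + 1))) (deriv r x) := by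
    filter_upwards [hr.deriv.eventually_hasSum_iteratedDeriv] with x hx
    convert hx using 2 with j
    rw [ha]
    simp only [← iteratedDeriv_succ', Nat.factorial_succ]
    have : ((j.factorial : ℕ) : ℂ) ≠ 0 := by exact_mod_cast j.factorial_ne_zero
    have h2 : (j : ℂ) + 1 ≠ 0 := by exact_mod_cast j.succ_ne_zero
    push_cast
    field_simp
  let e : ℕ → ℂ := fun j => Nat.casesOn j (m * a 0)
    (fun j => (j + m * μ) * a j + m * a (j + 1) - if j = n * m then d else 0)
  have he : ∀ j, e j = 0 := by
    apply eq_zero_of_eventually_hasSum_zero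
    filter_upwards [hs, hs', h] with x h0 h1 h2
    rw [← hasSum_nat_add_iff' 1]
    have k1 : HasSum (fun j : ℕ => x ^ (j + 1) * (j * a j)) (x ^ 2 * deriv r x) := by
      rw [← hasSum_nat_add_iff' 1]
      convert! h1.mul_left (x ^ 2) using 1
      · ext j; push_cast; ring
      · simp
    have k2 := h0.mul_left (m * μ * x)
    have k3 := ((hasSum_nat_add_iff' 1).2 h0).mul_left (m : ℂ)
    have k4 : HasSum (fun j : ℕ => x ^ (j + 1) * if j = n * m then d else 0)
        (d * x ^ (n * m + 1)) := by
      convert! hasSum_ite_eq (n * m) (d * x ^ (n * m + 1)) using 2 with j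
      split_ifs with hj
      · rw [hj, mul_comm]
      · simp
    convert! ((k1.add k2).add k3).sub k4 using 1
    · ext j
      simp only [e, ha]
      ring
    · rw [← h2]
      simp [e, ha]
      ring
  have h0 : a 0 = 0 := by
    have := he 0
    simpa [e, hmC] using this
  have hrec : ∀ j, (j + m * μ) * a j + m * a (j + 1) = if j = n * m then d else 0 := fun j => by
    have := he (j + 1)
    simpa [e, sub_eq_zero] using this
  have hlow : ∀ j ≤ n * m, a j = 0 := by
    intro j
    induction j with
    | zero => intro _; exact h0
    | succ j ih =>
      intro hj
      have := hrec j
      rw [ih (by omega), if_neg (by omega)] at this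
      simpa [hmC] using this
  have hzero : d = 0 → ∀ᶠ x in 𝓝 (0 : ℂ), r x = 0 := by
    intro hd
    have hall : ∀ j, a j = 0 := by
      intro j
      induction j with
      | zero => exact h0
      | succ j ih =>
        have := hrec j
        rw [ih, hd] at this
        simpa [hmC] using this
    filter_upwards [hs] with x hx
    have : HasSum (fun j : ℕ => x ^ j * a j) 0 := by simp [hall, hasSum_zero]
    exact hx.unique this
  suffices hd : d = 0 from ⟨hd, hzero hd⟩
  by_contra hd
  have hne : ∀ i, a (n * m + 1 + i) ≠ 0 := by
    intro i
    induction i with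
    | zero =>
      intro h1
      have := hrec (n * m)
      rw [hlow _ le_rfl, if_pos rfl] at this
      rw [add_zero] at h1
      rw [h1] at this
      simp at this
      exact hd this.symm
    | succ i ih =>
      intro h1
      have h2 := hrec (n * m + 1 + i)
      rw [if_neg (by omega), show n * m + 1 + i + 1 = n * m + 1 + (i + 1) by ring, h1] at h2
      simp only [mul_zero, add_zero, mul_eq_zero, ih, or_false] at h2
      have hmR : (0 : ℝ) < m := by exact_mod_cast hm
      have := hμ (-((n * m + 1 + i : ℕ) : ℝ) / m) (by
        push_cast at h2 ⊢
        field_simp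
        linear_combination -h2)
      have h3 : -((n * m + 1 + i : ℕ) : ℝ) / m + n = -(1 + i) / m := by
        push_cast
        field_simp
        ring
      rw [h3] at this
      have h4 : -(1 + (i : ℝ)) / m < 0 := div_neg_of_neg_of_pos (by linarith [i.cast_nonneg (α := ℝ)]) hmR
      linarith
  obtain ⟨z, hz, hz0⟩ : ∃ z : ℂ, HasSum (fun j : ℕ => z ^ j * a j) (r z) ∧ z ≠ 0 :=
    ((hs.filter_mono nhdsWithin_le_nhds).and self_mem_nhdsWithin).exists (f := 𝓝[≠] (0 : ℂ))
  refine not_summable_of_ratio_norm_eventually_ge (r := 2) one_lt_two ?_ ?_ hz.summable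
  · rw [frequently_atTop]
    intro N
    refine ⟨n * m + 1 + N, by omega, ?_⟩
    simp [hz0, hne N]
  · have hgrow : ∀ᶠ j : ℕ in atTop, 2 * m / ‖z‖ + ‖(m : ℂ) * μ‖ ≤ (j : ℝ) :=
      tendsto_natCast_atTop_atTop.eventually_ge_atTop _
    filter_upwards [hgrow, eventually_gt_atTop (n * m)] with j hj hj'
    have h1 := hrec j
    rw [if_neg (by omega)] at h1
    have hmR : (0 : ℝ) < m := by exact_mod_cast hm
    have hzp : 0 < ‖z‖ := norm_pos_iff.2 hz0
    have h2 : ‖(j : ℂ) + m * μ‖ * ‖a j‖ = m * ‖a (j + 1)‖ := by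
      rw [← norm_mul, eq_neg_of_add_eq_zero_left h1, norm_neg, norm_mul, Complex.norm_natCast]
    have h3 : 2 * m / ‖z‖ ≤ ‖(j : ℂ) + m * μ‖ := by
      have := norm_sub_le_norm_add (j : ℂ) (m * μ)
      rw [Complex.norm_natCast] at this
      linarith
    have h4 : 2 * ‖a j‖ ≤ ‖z‖ * ‖a (j + 1)‖ := by
      rw [div_le_iff₀ hzp] at h3
      have h5 : 2 * m * ‖a j‖ ≤ ‖(j : ℂ) + m * μ‖ * ‖z‖ * ‖a j‖ := by gcongr
      have h6 : m * (2 * ‖a j‖) ≤ m * (‖z‖ * ‖a (j + 1)‖) := by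
        calc m * (2 * ‖a j‖) = 2 * m * ‖a j‖ := by ring
          _ ≤ _ := h5
          _ = ‖z‖ * (‖(j : ℂ) + m * μ‖ * ‖a j‖) := by ring
          _ = _ := by rw [h2]; ring
      exact le_of_mul_le_mul_left h6 hmR
    rw [norm_mul, norm_mul, norm_pow, norm_pow, pow_succ]
    calc 2 * (‖z‖ ^ j * ‖a j‖) = ‖z‖ ^ j * (2 * ‖a j‖) := by ring
      _ ≤ ‖z‖ ^ j * (‖z‖ * ‖a (j + 1)‖) := by gcongr
      _ = _ := by ring

/-- Analytic dependence on parameters of the solution of a fixed point equation which is constant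
at the base parameter. -/
lemma exists_analyticAt_fixedPoint {E V : Type*} [NormedAddCommGroup E] [NormedSpace ℂ E]
    [CompleteSpace E] [NormedAddCommGroup V] [NormedSpace ℂ V] [CompleteSpace V]
    {N : E × V → V} {w₀ : V} (hN : AnalyticAt ℂ N (0, w₀)) (h : ∀ w, N (0, w) = w₀) :
    ∃ W : E → V, AnalyticAt ℂ W 0 ∧ W 0 = w₀ ∧ ∀ᶠ p in 𝓝 (0 : E), W p = N (p, W p) := by
  let f : E × V → V := fun q => q.2 - N q
  have hf : AnalyticAt ℂ f (0, w₀) := analyticAt_snd.sub hN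
  have hcd : ContDiffAt ℂ ω f (0, w₀) := hf.contDiffAt
  have hinv : (fderiv ℂ f (0, w₀) ∘L .inr ℂ E V) = ContinuousLinearMap.id ℂ V := by
    have h1 : HasFDerivAt (fun w : V => ((0 : E), w)) (.inr ℂ E V) w₀ := hasFDerivAt_prodMk_right 0 w₀
    have h2 := hf.differentiableAt.hasFDerivAt.comp w₀ h1
    have h3 : (f ∘ fun w : V => ((0 : E), w)) = fun w => w - w₀ := by
      ext w; simp [f, h]
    rw [h3] at h2
    exact h2.unique ((hasFDerivAt_id w₀).sub_const w₀)
  have hI : (fderiv ℂ f (0, w₀) ∘L .inr ℂ E V).IsInvertible := by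
    rw [hinv]; exact ⟨ContinuousLinearEquiv.refl ℂ V, rfl⟩
  refine ⟨hcd.implicitFunction (by simp) hI,
    (hcd.contDiffAt_implicitFunction (by simp) hI).analyticAt,
    hcd.implicitFunction_apply_self (by simp) hI, ?_⟩
  filter_upwards [hcd.eventually_apply_implicitFunction (by simp) hI] with p hp
  have : f (0, w₀) = 0 := by simp [f, h]
  rw [this] at hp
  exact sub_eq_zero.1 hp

lemma AnalyticAt.exists_eq_snd_mul {F : ℂ × ℂ → ℂ} (hF : AnalyticAt ℂ F 0)
    (h0 : ∀ᶠ x in 𝓝 (0 : ℂ), F (x, 0) = 0) :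
    ∃ G : ℂ × ℂ → ℂ, AnalyticAt ℂ G 0 ∧ ∀ᶠ p in 𝓝 (0 : ℂ × ℂ), F p = p.2 * G p := by
  obtain ⟨G, hG, hFG⟩ := hF.exists_sub_eq_mul
    ((ContinuousLinearMap.inl ℂ ℂ ℂ).comp (ContinuousLinearMap.fst ℂ ℂ ℂ))
    (ContinuousLinearMap.snd ℂ ℂ ℂ) (0, 1) (fun z => by simp)
  refine ⟨G, hG, ?_⟩
  have hfst : Tendsto (Prod.fst : ℂ × ℂ → ℂ) (𝓝 0) (𝓝 0) := continuous_fst.tendsto' _ _ rfl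
  filter_upwards [hFG, hfst.eventually h0] with p hp h
  rw [hp]
  simp [h]

lemma AnalyticAt.exists_eq_fst_mul {F : ℂ × ℂ → ℂ} (hF : AnalyticAt ℂ F 0)
    (h0 : ∀ᶠ y in 𝓝 (0 : ℂ), F (0, y) = 0) :
    ∃ G : ℂ × ℂ → ℂ, AnalyticAt ℂ G 0 ∧ ∀ᶠ p in 𝓝 (0 : ℂ × ℂ), F p = p.1 * G p := by
  obtain ⟨G, hG, hFG⟩ := hF.exists_sub_eq_mul
    ((ContinuousLinearMap.inr ℂ ℂ ℂ).comp (ContinuousLinearMap.snd ℂ ℂ ℂ))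
    (ContinuousLinearMap.fst ℂ ℂ ℂ) (1, 0) (fun z => by simp)
  refine ⟨G, hG, ?_⟩
  have hsnd : Tendsto (Prod.snd : ℂ × ℂ → ℂ) (𝓝 0) (𝓝 0) := continuous_snd.tendsto' _ _ rfl
  filter_upwards [hFG, hsnd.eventually h0] with p hp h
  rw [hp]
  simp [h]

lemma DifferentiableAt.hasDerivAt_line {E F : Type*} [NormedAddCommGroup E] [NormedSpace ℂ E]
    [NormedAddCommGroup F] [NormedSpace ℂ F] {G : E → F} {p : E} (hG : DifferentiableAt ℂ G p)
    (v : E) : HasDerivAt (fun l : ℂ => G (p + l • v)) (fderiv ℂ G p v) 0 := by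
  have h1 : HasDerivAt (fun l : ℂ => p + l • v) v 0 := by
    simpa using ((hasDerivAt_id (0 : ℂ)).smul_const v).const_add p
  have h2 : HasFDerivAt G (fderiv ℂ G p) (p + (0 : ℂ) • v) := by simpa using hG.hasFDerivAt
  exact h2.comp_hasDerivAt 0 h1

lemma hasDerivAt_one_add_mul_comp {𝕜 : Type*} [NontriviallyNormedField 𝕜] [NormedAlgebra 𝕜 ℂ]
    {f : ℂ → ℂ} {z q : 𝕜 → ℂ} {t : 𝕜} {c q' : ℂ} (n : ℕ)
    (hf : DifferentiableAt ℂ f (z t ^ n * q t)) (hz : HasDerivAt z (c * z t ^ 2) t)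
    (hq : HasDerivAt q q' t) :
    HasDerivAt (fun s => 1 + z s * f (z s ^ n * q s))
      (c * z t ^ 2 * f (z t ^ n * q t) + z t * (deriv f (z t ^ n * q t) *
        (n * z t ^ n * z t * c * q t + z t ^ n * q'))) t := by
  have h1 := (hz.pow n).mul hq
  have h2 := HasDerivAt.comp t hf.hasDerivAt h1
  have h3 := (hz.mul h2).const_add 1
  refine HasDerivAt.congr_deriv h3 ?_
  rcases n with _ | n
  · simp
  · simp only [Pi.mul_apply, Pi.pow_apply, Nat.add_sub_cancel, Function.comp]
    ring

lemma ContinuousMap.exp_apply {I : Type*} [TopologicalSpace I] [CompactSpace I] (w : C(I, ℂ))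
    (t : I) : NormedSpace.exp w t = Complex.exp (w t) := by
  have := NormedSpace.map_exp (f := (ContinuousMap.evalAlgHom ℂ ℂ t : C(I, ℂ) →ₐ[ℂ] ℂ))
    (continuous_eval_const t) w
  rw [Complex.exp_eq_exp_ℂ]
  exact this

lemma eq_one_add_mul_comp_of_flow {f : ℂ → ℂ} {z q D : ℝ → ℂ} {σ u : ℂ} (n : ℕ)
    (hf : ∀ s ∈ Set.Icc (0 : ℝ) 1, AnalyticAt ℂ f (z s ^ n * q s))
    (hz : ∀ s ∈ Set.Icc (0 : ℝ) 1, HasDerivAt z (-σ * z s ^ 2) s)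
    (hq : ∀ s ∈ Set.Icc (0 : ℝ) 1,
      HasDerivAt q (-(σ * (1 + z s * f (z s ^ n * q s))) * q s) s)
    (hD : ∀ s ∈ Set.Icc (0 : ℝ) 1, HasDerivAt D
      (-((u - 1) * (1 + z s * f (z s ^ n * q s)) + σ * ((u - s * (u - 1)) * z s ^ 2 *
        f (z s ^ n * q s) + z s * (deriv f (z s ^ n * q s) *
          (n * z s ^ n * z s * (u - s * (u - 1)) * q s + z s ^ n * (q s * D s)))))) s)
    (hD0 : D 0 = u * (1 + z 0 * f (z 0 ^ n * q 0))) :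
    D 1 = 1 + z 1 * f (z 1 ^ n * q 1) := by
  let e : ℝ → ℂ := fun s => D s - (u - s * (u - 1)) * (1 + z s * f (z s ^ n * q s))
  let k : ℝ → ℂ := fun s => -(σ * z s ^ (n + 1) * q s * deriv f (z s ^ n * q s))
  have he : ∀ s ∈ Set.Icc (0 : ℝ) 1, HasDerivAt e (k s * e s) s := by
    intro s hs
    have h1 := hasDerivAt_one_add_mul_comp n (hf s hs).differentiableAt (hz s hs) (hq s hs)
    have h2 : HasDerivAt (fun s : ℝ => u - (s : ℂ) * (u - 1)) (-(u - 1)) s := by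
      simpa using (((hasDerivAt_id s).ofReal_comp).mul_const (u - 1)).const_sub u
    refine ((hD s hs).sub (h2.mul h1)).congr_deriv ?_
    simp only [e, k]
    ring
  have hk : ContinuousOn k (Set.Icc 0 1) := by
    intro s hs
    have hz' := (hz s hs).continuousAt
    have hq' := (hq s hs).continuousAt
    have hd : ContinuousAt (fun s => deriv f (z s ^ n * q s)) s :=
      ContinuousAt.comp (g := deriv f) (hf s hs).deriv.continuousAt ((hz'.pow n).mul hq')
    exact ((((continuousAt_const.mul (hz'.pow _)).mul hq').mul hd).neg).continuousWithinAt
  obtain ⟨C, hC⟩ := isCompact_Icc.exists_bound_of_continuousOn hk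
  have h0 : e 0 = 0 := by simp [e, hD0]
  have := eq_zero_of_abs_deriv_le_mul_abs_self_of_eq_zero_right (f := e) (f' := fun s => k s * e s)
    (K := C) (a := 0) (b := 1) (fun s hs => (he s hs).continuousAt.continuousWithinAt)
    (fun s hs => (he s (Set.Ico_subset_Icc_self hs)).hasDerivWithinAt) h0 (fun s hs => by
      rw [norm_mul]
      gcongr
      exact hC s (Set.Ico_subset_Icc_self hs)) 1 (by simp)
  simp only [e] at this
  have h1 := sub_eq_zero.1 this
  rw [h1]
  simp

/-- A point is slid along the leaves of `x²∂x + (y + x y f(xⁿ y))∂y` from abscissa `P` to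
abscissa `x`. -/
lemma exists_slide_along_leaves {f : ℂ → ℂ} (hf : AnalyticAt ℂ f 0) (n : ℕ)
    {P Q σ u : ℂ × ℂ → ℂ} {v : ℂ × ℂ → ℂ × ℂ}
    (hP : AnalyticAt ℂ P 0) (hQ : AnalyticAt ℂ Q 0) (hσ : AnalyticAt ℂ σ 0)
    (hP0 : P 0 = 0) (hQ0 : Q 0 = 0) (hv : ∀ p, (v p).1 = p.1 ^ 2)
    (hDP : ∀ᶠ p in 𝓝 0, fderiv ℂ P p (v p) = u p * P p ^ 2)
    (hDQ : ∀ᶠ p in 𝓝 0, fderiv ℂ Q p (v p) = u p * (Q p + P p * Q p * f (P p ^ n * Q p)))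
    (hPσ : ∀ᶠ p in 𝓝 (0 : ℂ × ℂ), p.1 * (1 + σ p * P p) = P p) :
    ∃ w : ℂ × ℂ → ℂ, AnalyticAt ℂ w 0 ∧ ∀ᶠ p in 𝓝 (0 : ℂ × ℂ), p.1 ≠ 0 →
      fderiv ℂ (fun p => Q p * Complex.exp (w p)) p (v p) =
        Q p * Complex.exp (w p) * (1 + p.1 * f (p.1 ^ n * (Q p * Complex.exp (w p)))) := by
  let ι : C(unitInterval, ℂ) := ⟨fun t => ((t : ℝ) : ℂ), by fun_prop⟩
  obtain ⟨S, hS, hSe⟩ := AnalyticAt.exists_superposition unitInterval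
    (K := fun z : ℂ => (1 + z)⁻¹) (by
      apply AnalyticAt.inv (by fun_prop); simp)
  obtain ⟨T, hT, hTe⟩ := hf.exists_superposition unitInterval
  let Z : ℂ × ℂ → C(unitInterval, ℂ) := fun p => P p • S ((σ p * P p) • ι)
  let A : (ℂ × ℂ) × C(unitInterval, ℂ) → C(unitInterval, ℂ) := fun r => Z r.1 ^ n * (Q r.1 • NormedSpace.exp r.2)
  let M : (ℂ × ℂ) × C(unitInterval, ℂ) → C(unitInterval, ℂ) := fun r => σ r.1 • (1 + Z r.1 * T (A r))
  let w₀ : C(unitInterval, ℂ) := -unitPrimitive (σ 0 • 1)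
  have hZ : AnalyticAt ℂ Z 0 := by
    refine hP.smul (AnalyticAt.fun_comp (g := S) ?_ ?_)
    · rw [hP0, mul_zero, zero_smul ℂ ι]; exact hS
    · exact (hσ.mul hP).smul analyticAt_const
  have hZ0 : Z 0 = 0 := by simp [Z, hP0]
  have hA : AnalyticAt ℂ A (0, w₀) := by
    have hZ' : AnalyticAt ℂ (fun r : (ℂ × ℂ) × C(unitInterval, ℂ) => Z r.1) (0, w₀) :=
      AnalyticAt.fun_comp (g := Z) hZ analyticAt_fst
    have hQ' : AnalyticAt ℂ (fun r : (ℂ × ℂ) × C(unitInterval, ℂ) => Q r.1) (0, w₀) :=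
      AnalyticAt.fun_comp (g := Q) hQ analyticAt_fst
    have he : AnalyticAt ℂ (fun r : (ℂ × ℂ) × C(unitInterval, ℂ) => (NormedSpace.exp r.2 : C(unitInterval, ℂ))) (0, w₀) :=
      AnalyticAt.fun_comp (g := NormedSpace.exp) (NormedSpace.exp_analytic w₀) analyticAt_snd
    exact (hZ'.pow n).mul (hQ'.smul he)
  have hA0 : ∀ w, A (0, w) = 0 := by intro w; simp only [A, hQ0]; rw [zero_smul ℂ (NormedSpace.exp w), mul_zero]
  have hM : AnalyticAt ℂ M (0, w₀) := by
    have hZ' : AnalyticAt ℂ (fun r : (ℂ × ℂ) × C(unitInterval, ℂ) => Z r.1) (0, w₀) :=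
      AnalyticAt.fun_comp (g := Z) hZ analyticAt_fst
    have hσ' : AnalyticAt ℂ (fun r : (ℂ × ℂ) × C(unitInterval, ℂ) => σ r.1) (0, w₀) :=
      AnalyticAt.fun_comp (g := σ) hσ analyticAt_fst
    have hT' : AnalyticAt ℂ (fun r => T (A r)) (0, w₀) :=
      AnalyticAt.fun_comp (g := T) (by rw [hA0]; exact hT) hA
    exact hσ'.smul (analyticAt_const.add (hZ'.mul hT'))
  have hN : AnalyticAt ℂ (fun r => -unitPrimitive (M r)) (0, w₀) :=
    (AnalyticAt.fun_comp (g := unitPrimitive) (unitPrimitive.analyticAt _) hM).neg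
  obtain ⟨W, hW, hW0, hWe⟩ := exists_analyticAt_fixedPoint hN (by
    intro w; simp [M, hZ0, w₀])
  have hpair : AnalyticAt ℂ (fun p => (p, W p)) 0 := analyticAt_id.prod hW
  have hMW : AnalyticAt ℂ (fun p => M (p, W p)) 0 :=
    AnalyticAt.fun_comp (g := M) (by rw [hW0]; exact hM) hpair
  have hAW : Tendsto (fun p => A (p, W p)) (𝓝 0) (𝓝 0) := by
    have : AnalyticAt ℂ (fun p => A (p, W p)) 0 :=
      AnalyticAt.fun_comp (g := A) (by rw [hW0]; exact hA) hpair
    have := this.continuousAt.tendsto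
    rwa [hA0] at this
  have hSarg : Tendsto (fun p => (σ p * P p) • ι) (𝓝 0) (𝓝 0) := by
    have : AnalyticAt ℂ (fun p => (σ p * P p) • ι) 0 := (hσ.mul hP).smul analyticAt_const
    have := this.continuousAt.tendsto
    rwa [hP0, mul_zero, zero_smul ℂ ι] at this
  have hfan : ∀ᶠ b in 𝓝 (0 : C(unitInterval, ℂ)), ∀ t, AnalyticAt ℂ f (b t) := by
    obtain ⟨ε, hε, hb⟩ := Metric.eventually_nhds_iff.1 hf.eventually_analyticAt
    filter_upwards [Metric.ball_mem_nhds (0 : C(unitInterval, ℂ)) hε] with b hb' t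
    refine hb ?_
    rw [dist_zero_right]
    exact lt_of_le_of_lt (b.norm_coe_le_norm t) (by simpa using hb')
  have hsmall : ∀ᶠ b in 𝓝 (0 : C(unitInterval, ℂ)), ∀ t, 1 + b t ≠ 0 := by
    filter_upwards [Metric.ball_mem_nhds (0 : C(unitInterval, ℂ)) one_pos] with b hb t h0
    have h1 : ‖b t‖ < 1 := lt_of_le_of_lt (b.norm_coe_le_norm t) (by simpa using hb)
    rw [eq_neg_of_add_eq_zero_right h0] at h1
    simp at h1
  have hform : ∀ᶠ p in 𝓝 (0 : ℂ × ℂ), (∀ t, Z p t = P p * (1 + (t : ℝ) * (σ p * P p))⁻¹) ∧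
      (∀ t, A (p, W p) t = Z p t ^ n * (Q p * Complex.exp (W p t))) ∧
      (∀ t, M (p, W p) t = σ p * (1 + Z p t * f (A (p, W p) t))) := by
    filter_upwards [hSarg.eventually hSe, hAW.eventually hTe] with p h1 h2
    refine ⟨fun t => ?_, fun t => ?_, fun t => ?_⟩
    · simp only [Z, ContinuousMap.smul_apply, h1, smul_eq_mul, ι, ContinuousMap.coe_mk]
      ring
    · simp [A, ContinuousMap.exp_apply]
    · simp only [M, ContinuousMap.smul_apply, ContinuousMap.add_apply, ContinuousMap.mul_apply,
        ContinuousMap.one_apply, h2, smul_eq_mul]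
  let ev : C(unitInterval, ℂ) →L[ℂ] ℂ := ContinuousMap.evalCLM ℂ 1
  refine ⟨fun p => W p 1, AnalyticAt.fun_comp (g := ev) (ev.analyticAt _) hW, ?_⟩
  filter_upwards [hDP, hDQ, hPσ, hPσ.eventually_nhds, hWe, hWe.eventually_nhds, hform,
    hform.eventually_nhds, hMW.eventually_analyticAt, hW.eventually_analyticAt,
    hP.eventually_analyticAt, hQ.eventually_analyticAt, hσ.eventually_analyticAt,
    hAW.eventually hfan, hSarg.eventually hsmall] with p kDP kDQ kPσ kPσ' kW kW' kform kform'
    kM kWa kP kQ kσ kf ksm hx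
  have hpn : ∀ t : unitInterval, 1 + ((t : ℝ) : ℂ) * (σ p * P p) ≠ 0 := by
    intro t
    have := ksm t
    rwa [ContinuousMap.smul_apply, smul_eq_mul, mul_comm] at this
  have hp1 : 1 + σ p * P p ≠ 0 := by simpa using hpn 1
  have hPp : P p ≠ 0 := by rw [← kPσ]; exact mul_ne_zero hx hp1
  have hL : Tendsto (fun l : ℂ => p + l • v p) (𝓝 0) (𝓝 p) := by
    have : Continuous (fun l : ℂ => p + l • v p) := by fun_prop
    simpa using this.tendsto 0
  have lP := kP.differentiableAt.hasDerivAt_line (v p)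
  have lQ := kQ.differentiableAt.hasDerivAt_line (v p)
  have lσ := kσ.differentiableAt.hasDerivAt_line (v p)
  have lW := kWa.differentiableAt.hasDerivAt_line (v p)
  have lM := kM.differentiableAt.hasDerivAt_line (v p)
  rw [kDP] at lP
  rw [kDQ] at lQ
  have hDσ : fderiv ℂ σ p (v p) = u p - 1 := by
    have lx : HasDerivAt (fun l : ℂ => (p + l • v p).1) (p.1 ^ 2) 0 := by
      have := (differentiableAt_fst (𝕜 := ℂ) (p := p)).hasDerivAt_line (v p)
      simpa [fderiv_fst, hv] using this
    have h1 := lx.mul ((lσ.mul lP).const_add 1)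
    have h2 := (h1.congr_of_eventuallyEq ((hL.eventually kPσ').mono fun l hl => hl.symm)).unique lP
    simp only [zero_smul, add_zero, Pi.mul_apply] at h2
    have h3 : p.1 * P p * (fderiv ℂ σ p (v p) - (u p - 1)) = 0 := by
      linear_combination h2 + (-p.1 - u p * P p) * kPσ
    exact sub_eq_zero.1 ((mul_eq_zero.1 h3).resolve_left (mul_ne_zero hx hPp))
  rw [hDσ] at lσ
  set dW := fderiv ℂ W p (v p)
  set dM := fderiv ℂ (fun p => M (p, W p)) p (v p)
  have hdWM : dW = -unitPrimitive dM := by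
    have h1 := (unitPrimitive.hasFDerivAt.comp_hasDerivAt (0 : ℂ) lM).neg
    exact lW.unique (h1.congr_of_eventuallyEq (hL.eventually kW'))
  have lev : ∀ (t : unitInterval) {G : ℂ → C(unitInterval, ℂ)} {G' : C(unitInterval, ℂ)},
      HasDerivAt G G' 0 → HasDerivAt (fun l => G l t) (G' t) 0 := fun t G G' h =>
    (ContinuousMap.evalCLM ℂ t : C(unitInterval, ℂ) →L[ℂ] ℂ).hasFDerivAt.comp_hasDerivAt (0 : ℂ) h
  let κ : ℂ := u p * (1 + P p * f (P p ^ n * Q p))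
  let z : ℝ → ℂ := fun s => P p * (1 + s * (σ p * P p))⁻¹
  have lz : ∀ t : unitInterval, HasDerivAt (fun l : ℂ => P (p + l • v p) *
      (1 + (t : ℝ) * (σ (p + l • v p) * P (p + l • v p)))⁻¹)
      ((u p - (t : ℝ) * (u p - 1)) * z t ^ 2) 0 := by
    intro t
    have h1 := ((lσ.mul lP).const_mul ((t : ℝ) : ℂ)).const_add 1
    have h2 := lP.mul (h1.inv (by simpa using hpn t))
    refine h2.congr_deriv ?_
    have := hpn t
    simp only [zero_smul, add_zero, Pi.mul_apply, Pi.inv_apply, z]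
    field_simp
    ring
  have lq : ∀ t : unitInterval, HasDerivAt (fun l : ℂ => Q (p + l • v p) *
      Complex.exp (W (p + l • v p) t)) (Q p * Complex.exp (W p t) * (κ + dW t)) 0 := by
    intro t
    refine (lQ.mul (lev t lW).cexp).congr_deriv ?_
    simp only [zero_smul, add_zero, κ]
    ring
  have hdMt : ∀ t : unitInterval, dM t = (u p - 1) * (1 + z t * f (A (p, W p) t)) +
      σ p * ((u p - (t : ℝ) * (u p - 1)) * z t ^ 2 * f (A (p, W p) t) +
        z t * (deriv f (A (p, W p) t) * (n * z t ^ n * z t * (u p - (t : ℝ) * (u p - 1)) *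
          (Q p * Complex.exp (W p t)) +
            z t ^ n * (Q p * Complex.exp (W p t) * (κ + dW t))))) := by
    intro t
    have hAt : A (p, W p) t = z t ^ n * (Q p * Complex.exp (W p t)) := by
      rw [kform.2.1, kform.1]
    have h1 := hasDerivAt_one_add_mul_comp (𝕜 := ℂ) (f := f) (t := 0)
      (z := fun l : ℂ => P (p + l • v p) *
        (1 + (t : ℝ) * (σ (p + l • v p) * P (p + l • v p)))⁻¹)
      (q := fun l : ℂ => Q (p + l • v p) * Complex.exp (W (p + l • v p) t))
      (c := u p - (t : ℝ) * (u p - 1)) n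
      (by simpa [hAt, z] using (kf t).differentiableAt)
      (by simpa [z] using lz t) (lq t)
    have h2 := lσ.mul h1
    have h3 := (lev t lM).unique (h2.congr_of_eventuallyEq
      ((hL.eventually kform').mono fun l hl => by
        simp only [hl.2.2, hl.2.1, hl.1, Pi.mul_apply]))
    rw [h3, hAt]
    simp only [zero_smul, add_zero, z]
  let Wr : ℝ → ℂ := fun s => -∫ r in (0:ℝ)..s, Set.IccExtend zero_le_one (M (p, W p)) r
  let D : ℝ → ℂ := fun s => κ - ∫ r in (0:ℝ)..s, Set.IccExtend zero_le_one dM r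
  have hprim : ∀ (b : C(unitInterval, ℂ)) (s : ℝ) (hs : s ∈ Set.Icc (0 : ℝ) 1),
      HasDerivAt (fun s => ∫ r in (0:ℝ)..s, Set.IccExtend zero_le_one b r) (b ⟨s, hs⟩) s := by
    intro b s hs
    have hc : Continuous (Set.IccExtend zero_le_one b) := b.continuous.Icc_extend'
    have := hc.integral_hasStrictDerivAt 0 s
    rw [Set.IccExtend_of_mem _ _ hs] at this
    exact this.hasDerivAt
  have hWr : ∀ (s : ℝ) (hs : s ∈ Set.Icc (0 : ℝ) 1), Wr s = W p ⟨s, hs⟩ := by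
    intro s hs
    rw [kW, ContinuousMap.neg_apply, unitPrimitive_apply]
  have hDr : ∀ (s : ℝ) (hs : s ∈ Set.Icc (0 : ℝ) 1), D s = κ + dW ⟨s, hs⟩ := by
    intro s hs
    rw [hdWM, ContinuousMap.neg_apply, unitPrimitive_apply, ← sub_eq_add_neg]
  have hAr : ∀ (s : ℝ) (hs : s ∈ Set.Icc (0 : ℝ) 1),
      A (p, W p) ⟨s, hs⟩ = z s ^ n * (Q p * Complex.exp (Wr s)) := by
    intro s hs
    rw [kform.2.1, kform.1, hWr s hs]
  have hend := eq_one_add_mul_comp_of_flow (f := f) (z := z)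
    (q := fun s => Q p * Complex.exp (Wr s)) (D := D) (σ := σ p) (u := u p) n
    (fun s hs => by
      have := kf ⟨s, hs⟩
      rwa [hAr s hs] at this)
    (fun s hs => by
      have h1 : HasDerivAt (fun s : ℝ => 1 + (s : ℂ) * (σ p * P p)) (σ p * P p) s := by
        simpa using (((hasDerivAt_id s).ofReal_comp).mul_const (σ p * P p)).const_add 1
      have hne := hpn ⟨s, hs⟩
      refine ((h1.inv hne).const_mul (P p)).congr_deriv ?_
      simp only [z] at hne ⊢
      field_simp)
    (fun s hs => by
      have h1 : HasDerivAt Wr (-(M (p, W p) ⟨s, hs⟩)) s := (hprim _ s hs).neg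
      refine (h1.cexp.const_mul (Q p)).congr_deriv ?_
      rw [kform.2.2, kform.1, hAr s hs]
      simp only [z]
      ring)
    (fun s hs => by
      have h1 : HasDerivAt D (-(dM ⟨s, hs⟩)) s := (hprim dM s hs).const_sub κ
      refine h1.congr_deriv ?_
      rw [hdMt, hAr s hs, hDr s hs, hWr s hs])
    (by simp [D, z, Wr, κ])
  have h1m : (1 : ℝ) ∈ Set.Icc (0 : ℝ) 1 := by simp
  have hz1 : z 1 = p.1 := by
    simp only [z, Complex.ofReal_one, one_mul]
    rw [← div_eq_mul_inv, div_eq_iff hp1]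
    exact kPσ.symm
  rw [hDr 1 h1m, hWr 1 h1m, hz1] at hend
  have hφd : DifferentiableAt ℂ (fun p => Q p * Complex.exp (W p 1)) p :=
    kQ.differentiableAt.mul ((ContinuousMap.evalCLM ℂ (1 : unitInterval) :
      C(unitInterval, ℂ) →L[ℂ] ℂ).differentiableAt.comp p kWa.differentiableAt).cexp
  refine ((hφd.hasDerivAt_line (v p)).unique (lq 1)).trans ?_
  exact congrArg (Q p * Complex.exp (W p 1) * ·) hend

lemma eventually_eq_zero_of_mul_deriv_eq_mul {p s h : ℂ → ℂ} (hp : AnalyticAt ℂ p 0)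
    (hp0 : p 0 = 0) (hs : ContinuousAt s 0) (hh : ContinuousAt h 0)
    (hk : ∀ k : ℕ, 0 < k → k * s 0 ≠ h 0)
    (heq : ∀ᶠ y in 𝓝 (0 : ℂ), y * s y * deriv p y = h y * p y) :
    ∀ᶠ y in 𝓝 (0 : ℂ), p y = 0 := by
  by_contra hne
  obtain ⟨k, g, hg, hg0, hpg⟩ := hp.exists_eventuallyEq_pow_smul_nonzero_iff.2 hne
  simp only [sub_zero, smul_eq_mul] at hpg
  have hk0 : 0 < k := by
    rcases Nat.eq_zero_or_pos k with rfl | h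
    · have := hpg.self_of_nhds
      simp [hp0] at this
      exact absurd this.symm hg0
    · exact h
  have hcont : ContinuousAt (fun y => k * s y * g y + y * s y * deriv g y - h y * g y) 0 := by
    have := hg.continuousAt
    have := hg.deriv.continuousAt
    fun_prop
  have hzero : ∀ᶠ y in 𝓝[≠] (0 : ℂ), k * s y * g y + y * s y * deriv g y - h y * g y = 0 := by
    filter_upwards [heq.filter_mono nhdsWithin_le_nhds, hpg.filter_mono nhdsWithin_le_nhds,
      hpg.eventually_nhds.filter_mono nhdsWithin_le_nhds,
      hg.eventually_analyticAt.filter_mono nhdsWithin_le_nhds,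
      self_mem_nhdsWithin] with y h1 h2 h3 h4 hy
    have hy : y ≠ 0 := hy
    have h5 : HasDerivAt p (k * y ^ (k - 1) * g y + y ^ k * deriv g y) y :=
      ((hasDerivAt_pow k y).mul h4.differentiableAt.hasDerivAt).congr_of_eventuallyEq h3
    rw [h5.deriv, h2] at h1
    obtain ⟨j, rfl⟩ : ∃ j, k = j + 1 := ⟨k - 1, by omega⟩
    rw [Nat.add_sub_cancel] at h1
    refine (mul_eq_zero.1 ?_).resolve_left (pow_ne_zero (j + 1) hy)
    linear_combination h1
  have := tendsto_nhds_unique (hcont.tendsto.mono_left nhdsWithin_le_nhds)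
    (tendsto_const_nhds.congr' (hzero.mono fun y hy => hy.symm))
  simp only [zero_mul, add_zero] at this
  refine hk k hk0 (mul_right_cancel₀ hg0 (sub_eq_zero.1 this))

lemma eventually_ne_nhdsNE (a : ℂ) : ∀ᶠ t in 𝓝[≠] (0 : ℂ), t ≠ a := by
  rcases eq_or_ne a 0 with rfl | h
  · exact self_mem_nhdsWithin
  · exact (isOpen_ne.eventually_mem h.symm).filter_mono nhdsWithin_le_nhds

lemma AnalyticAt.eventually_eq_zero_of_off_axes {F : ℂ × ℂ → ℂ} (hF : AnalyticAt ℂ F 0)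
    (h : ∀ᶠ p in 𝓝 (0 : ℂ × ℂ), p.1 ≠ 0 → p.2 ≠ 0 → F p = 0) :
    ∀ᶠ p in 𝓝 (0 : ℂ × ℂ), F p = 0 := by
  filter_upwards [hF.eventually_analyticAt, h.eventually_nhds] with p h1 h2
  have hL : Tendsto (fun t : ℂ => p + (t, t)) (𝓝[≠] 0) (𝓝 p) := by
    have : Continuous (fun t : ℂ => p + (t, t)) := by fun_prop
    have := this.tendsto 0
    rw [show ((0 : ℂ), (0 : ℂ)) = 0 from rfl, add_zero] at this
    exact this.mono_left nhdsWithin_le_nhds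
  refine tendsto_nhds_unique (h1.continuousAt.tendsto.comp hL) (tendsto_const_nhds.congr' ?_)
  filter_upwards [hL.eventually h2, eventually_ne_nhdsNE (-p.1), eventually_ne_nhdsNE (-p.2)]
    with t ht h3 h4
  refine (ht (fun h => h3 ?_) (fun h => h4 ?_)).symm
  · exact eq_neg_of_add_eq_zero_right h
  · exact eq_neg_of_add_eq_zero_right h

lemma AnalyticAt.fderiv_apply_field {F : ℂ × ℂ → ℂ} {v : ℂ × ℂ → ℂ × ℂ} {p : ℂ × ℂ}
    (hF : AnalyticAt ℂ F p) (hv : AnalyticAt ℂ v p) :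
    AnalyticAt ℂ (fun p => fderiv ℂ F p (v p)) p :=
  AnalyticAt.fun_comp (g := fun r : (ℂ × ℂ →L[ℂ] ℂ) × (ℂ × ℂ) => r.1 r.2)
    ((ContinuousLinearMap.id ℂ (ℂ × ℂ →L[ℂ] ℂ)).analyticAt_bilinear _) (hF.fderiv.prod hv)

lemma fderiv_apply_of_eventuallyEq_fst_mul {F G : ℂ × ℂ → ℂ} {p : ℂ × ℂ}
    (hG : DifferentiableAt ℂ G p) (h : ∀ᶠ q in 𝓝 p, F q = q.1 * G q) (w : ℂ × ℂ) :
    fderiv ℂ F p w = w.1 * G p + p.1 * fderiv ℂ G p w := by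
  rw [Filter.EventuallyEq.fderiv_eq h, fderiv_fun_mul differentiableAt_fst hG]
  simp [fderiv_fst]
  ring

lemma fderiv_apply_of_eventuallyEq_snd_mul {F G : ℂ × ℂ → ℂ} {p : ℂ × ℂ}
    (hG : DifferentiableAt ℂ G p) (h : ∀ᶠ q in 𝓝 p, F q = q.2 * G q) (w : ℂ × ℂ) :
    fderiv ℂ F p w = w.2 * G p + p.2 * fderiv ℂ G p w := by
  rw [Filter.EventuallyEq.fderiv_eq h, fderiv_fun_mul differentiableAt_snd hG]
  simp [fderiv_snd]
  ring

lemma hasDerivAt_horizontal {F : ℂ × ℂ → ℂ} {x y : ℂ} (hF : DifferentiableAt ℂ F (x, y)) :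
    HasDerivAt (fun s => F (s, y)) (fderiv ℂ F (x, y) (1, 0)) x :=
  hF.hasFDerivAt.comp_hasDerivAt x ((hasDerivAt_id x).prodMk (hasDerivAt_const x y))

lemma hasDerivAt_vertical {F : ℂ × ℂ → ℂ} {x y : ℂ} (hF : DifferentiableAt ℂ F (x, y)) :
    HasDerivAt (fun s => F (x, s)) (fderiv ℂ F (x, y) (0, 1)) y :=
  hF.hasFDerivAt.comp_hasDerivAt y ((hasDerivAt_const y x).prodMk (hasDerivAt_id y))

lemma tendsto_horizontal_axis : Tendsto (fun x : ℂ => (x, (0 : ℂ))) (𝓝 0) (𝓝 0) :=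
  (by fun_prop : Continuous fun x : ℂ => (x, (0 : ℂ))).tendsto 0

lemma tendsto_vertical_axis : Tendsto (fun y : ℂ => ((0 : ℂ), y)) (𝓝 0) (𝓝 0) :=
  (by fun_prop : Continuous fun y : ℂ => ((0 : ℂ), y)).tendsto 0

lemma AnalyticAt.comp_horizontal_axis {F : ℂ × ℂ → ℂ} (hF : AnalyticAt ℂ F 0) :
    AnalyticAt ℂ (fun x : ℂ => F (x, 0)) 0 :=
  AnalyticAt.fun_comp (g := F) (f := fun x : ℂ => (x, (0 : ℂ))) hF
    (analyticAt_id.prod analyticAt_const)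

lemma AnalyticAt.comp_vertical_axis {F : ℂ × ℂ → ℂ} (hF : AnalyticAt ℂ F 0) :
    AnalyticAt ℂ (fun y : ℂ => F (0, y)) 0 :=
  AnalyticAt.fun_comp (g := F) (f := fun y : ℂ => ((0 : ℂ), y)) hF
    (analyticAt_const.prod analyticAt_id)

lemma AnalyticAt.exists_eq_self_mul {g : ℂ → ℂ} (hg : AnalyticAt ℂ g 0) (h0 : g 0 = 0) :
    ∃ g' : ℂ → ℂ, AnalyticAt ℂ g' 0 ∧ ∀ᶠ t in 𝓝 (0 : ℂ), g t = t * g' t := by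
  obtain ⟨G, hG, h⟩ := AnalyticAt.exists_eq_snd_mul (F := fun p : ℂ × ℂ => g p.2)
    (AnalyticAt.fun_comp (g := g) hg analyticAt_snd) (by simp [h0])
  exact ⟨fun t => G (0, t), hG.comp_vertical_axis, tendsto_vertical_axis.eventually h⟩

/-- The normal form `x²∂x + (y + x y f(xⁿ y))∂y`. -/
def saddleField (f : ℂ → ℂ) (n : ℕ) (p : ℂ × ℂ) : ℂ × ℂ :=
  (p.1 ^ 2, p.2 + p.1 * p.2 * f (p.1 ^ n * p.2))

lemma AnalyticAt.comp_resonant {f : ℂ → ℂ} (hf : AnalyticAt ℂ f 0) {P Q : ℂ × ℂ → ℂ} (n : ℕ)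
    (hP : AnalyticAt ℂ P 0) (hQ : AnalyticAt ℂ Q 0) (hQ0 : Q 0 = 0) :
    AnalyticAt ℂ (fun p => f (P p ^ n * Q p)) 0 :=
  AnalyticAt.fun_comp (g := f) (f := fun p => P p ^ n * Q p) (by simpa [hQ0] using hf)
    ((hP.pow n).mul hQ)

lemma AnalyticAt.saddleField {f : ℂ → ℂ} (hf : AnalyticAt ℂ f 0) (n : ℕ) :
    AnalyticAt ℂ (saddleField f n) 0 :=
  (analyticAt_fst.pow 2).prod (analyticAt_snd.add ((analyticAt_fst.mul analyticAt_snd).mul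
    (hf.comp_resonant n analyticAt_fst analyticAt_snd rfl)))

lemma exists_flat_expansion {f₁ f₃ : ℂ → ℂ} {χ : ℂ × ℂ → ℂ} {μ : ℂ} {n : ℕ}
    (hf₁ : AnalyticAt ℂ f₁ 0) (hf₃ : AnalyticAt ℂ f₃ 0) (hχ : AnalyticAt ℂ χ 0)
    (h1 : f₁ 0 = μ) (h3 : f₃ 0 = μ) (hμ : ∀ s : ℝ, (s : ℂ) = μ → 0 < s + n)
    (hχ1 : ∀ᶠ x in 𝓝 (0 : ℂ), χ (x, 0) = 1)
    (hD : ∀ᶠ p in 𝓝 (0 : ℂ × ℂ), fderiv ℂ χ p (saddleField f₁ n p) =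
      p.1 * χ p * (f₃ (p.1 ^ n * (p.2 * χ p)) - f₁ (p.1 ^ n * p.2))) (m : ℕ) :
    ∃ (R : ℂ × ℂ → ℂ) (g : ℂ → ℂ), AnalyticAt ℂ R 0 ∧ AnalyticAt ℂ g 0 ∧
      (∀ᶠ p in 𝓝 (0 : ℂ × ℂ), χ p = 1 + p.2 ^ (m + 1) * R p) ∧
      ∀ᶠ t in 𝓝 (0 : ℂ), f₃ t = f₁ t + t ^ (m + 1) * g t := by
  induction m with
  | zero =>
    obtain ⟨R, hR, hRe⟩ := AnalyticAt.exists_eq_snd_mul (hχ.sub analyticAt_const)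
      (F := fun p => χ p - 1) (hχ1.mono fun x hx => by simp [hx])
    obtain ⟨g, hg, hge⟩ := AnalyticAt.exists_eq_self_mul (hf₃.sub hf₁)
      (g := fun t => f₃ t - f₁ t) (by simp [h1, h3])
    exact ⟨R, g, hR, hg, hRe.mono fun p hp => by linear_combination hp,
      hge.mono fun t ht => by linear_combination ht⟩
  | succ k ih =>
    obtain ⟨R, g, hR, hg, hRe, hge⟩ := ih
    set m := k + 1 with hm
    have hm0 : 0 < m := Nat.succ_pos k
    obtain ⟨H, hH, hHe⟩ := AnalyticAt.exists_eq_fst_mul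
      (F := fun q : ℂ × ℂ => f₁ (q.2 + q.1) - f₁ q.2) (by
        refine AnalyticAt.sub (AnalyticAt.fun_comp (g := f₁) (f := fun q : ℂ × ℂ => q.2 + q.1) ?_
          (analyticAt_snd.add analyticAt_fst)) (AnalyticAt.fun_comp (g := f₁) hf₁ analyticAt_snd)
        simpa using hf₁) (by simp)
    let sh : ℂ × ℂ → ℂ × ℂ := fun p => (p.1 ^ n * p.2 * (p.2 ^ m * R p), p.1 ^ n * p.2)
    let τ : ℂ × ℂ → ℂ := fun p => p.1 ^ n * (p.2 * χ p)
    have hx : AnalyticAt ℂ (fun p : ℂ × ℂ => p.1) 0 := analyticAt_fst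
    have hy : AnalyticAt ℂ (fun p : ℂ × ℂ => p.2) 0 := analyticAt_snd
    have hsh : AnalyticAt ℂ sh 0 :=
      (((hx.pow n).mul hy).mul ((hy.pow m).mul hR)).prod ((hx.pow n).mul hy)
    have hsh0 : sh 0 = 0 := by simp [sh]
    have hτ : AnalyticAt ℂ τ 0 := (hx.pow n).mul (hy.mul hχ)
    have hτ0 : τ 0 = 0 := by simp [τ]
    have hHsh : AnalyticAt ℂ (fun p => H (sh p)) 0 :=
      AnalyticAt.fun_comp (g := H) (by rwa [hsh0]) hsh
    have hgτ : AnalyticAt ℂ (fun p => g (τ p)) 0 :=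
      AnalyticAt.fun_comp (g := g) (by rwa [hτ0]) hτ
    have hf₁' := hf₁.comp_resonant n hx hy rfl
    let E : ℂ × ℂ → ℂ := fun p => m * (1 + p.1 * f₁ (p.1 ^ n * p.2)) * R p +
      fderiv ℂ R p (saddleField f₁ n p) - p.1 * χ p * (p.1 ^ n * p.2 * R p * H (sh p) +
        p.1 ^ (n * m) * χ p ^ m * g (τ p))
    have hE : AnalyticAt ℂ E 0 :=
      (((analyticAt_const.mul (analyticAt_const.add (hx.mul hf₁'))).mul hR).add
        (hR.fderiv_apply_field (hf₁.saddleField n))).sub ((hx.mul hχ).mul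
          (((((hx.pow n).mul hy).mul hR).mul hHsh).add (((hx.pow _).mul (hχ.pow m)).mul hgτ)))
    have hE0 : ∀ᶠ p in 𝓝 (0 : ℂ × ℂ), E p = 0 := by
      refine hE.eventually_eq_zero_of_off_axes ?_
      have hsht : Tendsto sh (𝓝 0) (𝓝 0) := by simpa [hsh0] using hsh.continuousAt.tendsto
      have hτt : Tendsto τ (𝓝 0) (𝓝 0) := by simpa [hτ0] using hτ.continuousAt.tendsto
      filter_upwards [hD, hRe, hRe.eventually_nhds, hR.eventually_analyticAt, hsht.eventually hHe,
        hτt.eventually hge] with p k1 k2 k3 k4 k5 k6 _ hp2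
      have h5 : fderiv ℂ χ p (saddleField f₁ n p) =
          m * p.2 ^ k * (saddleField f₁ n p).2 * R p +
            p.2 ^ m * fderiv ℂ R p (saddleField f₁ n p) := by
        have h6 : HasFDerivAt (fun p : ℂ × ℂ => 1 + p.2 ^ m * R p) _ p :=
          ((hasFDerivAt_snd.pow m).mul k4.differentiableAt.hasFDerivAt).const_add 1
        rw [Filter.EventuallyEq.fderiv_eq k3, h6.fderiv]
        simp [hm]
        ring
      have h7 : τ p = (sh p).2 + (sh p).1 := by
        simp only [τ, sh, k2]
        ring
      have h8 : f₁ (τ p) = f₁ (p.1 ^ n * p.2) + p.1 ^ n * p.2 * (p.2 ^ m * R p) * H (sh p) := by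
        rw [h7]
        linear_combination k5
      have h9 : f₃ (p.1 ^ n * (p.2 * χ p)) = f₁ (p.1 ^ n * p.2) +
          p.1 ^ n * p.2 * (p.2 ^ m * R p) * H (sh p) +
            p.1 ^ (n * m) * p.2 ^ m * χ p ^ m * g (τ p) := by
        refine k6.trans ?_
        rw [h8]
        simp only [τ]
        ring
      rw [h5, h9] at k1
      refine (mul_eq_zero.1 ?_).resolve_left (pow_ne_zero m hp2)
      simp only [E]
      simp only [saddleField] at k1 ⊢
      rw [hm, pow_succ] at *
      linear_combination k1
    have hr : AnalyticAt ℂ (fun x => R (x, 0)) 0 := hR.comp_horizontal_axis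
    have heuler := euler_equation_convergent_solution hr (μ := μ) (d := g 0) (n := n) hm0 hμ (by
      filter_upwards [tendsto_horizontal_axis.eventually hE0, hχ1,
        tendsto_horizontal_axis.eventually hR.eventually_analyticAt] with x k1 k2 k3
      rw [(hasDerivAt_horizontal k3.differentiableAt).deriv]
      have h4 : saddleField f₁ n (x, 0) = x ^ 2 • ((1 : ℂ), (0 : ℂ)) := by simp [saddleField]
      simp only [E, τ, h4, map_smul, smul_eq_mul, k2, mul_zero, zero_mul, one_pow, mul_one, h1,
        zero_add] at k1
      linear_combination k1)
    obtain ⟨R', hR', hRe'⟩ := hR.exists_eq_snd_mul heuler.2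
    obtain ⟨g', hg', hge'⟩ := hg.exists_eq_self_mul heuler.1
    refine ⟨R', g', hR', hg', ?_, ?_⟩
    · filter_upwards [hRe, hRe'] with p h1 h2
      rw [h1, h2]
      ring
    · filter_upwards [hge, hge'] with p h1 h2
      rw [h1, h2]
      ring

lemma AnalyticAt.eventually_eq_zero_of_flat {F : ℂ → ℂ} (hF : AnalyticAt ℂ F 0)
    (h : ∀ m : ℕ, ∃ g : ℂ → ℂ, AnalyticAt ℂ g 0 ∧ ∀ᶠ t in 𝓝 (0 : ℂ), F t = t ^ (m + 1) * g t) :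
    ∀ᶠ t in 𝓝 (0 : ℂ), F t = 0 := by
  by_contra hne
  obtain ⟨k, g, hg, hg0, hFg⟩ := hF.exists_eventuallyEq_pow_smul_nonzero_iff.2 hne
  obtain ⟨g', hg', hFg'⟩ := h k
  simp only [sub_zero, smul_eq_mul] at hFg
  have hz : ∀ᶠ t in 𝓝[≠] (0 : ℂ), g t - t * g' t = 0 := by
    filter_upwards [hFg.filter_mono nhdsWithin_le_nhds, hFg'.filter_mono nhdsWithin_le_nhds,
      self_mem_nhdsWithin] with t h1 h2 ht
    refine (mul_eq_zero.1 ?_).resolve_left (pow_ne_zero k (show t ≠ 0 from ht))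
    linear_combination h2 - h1
  have hc : ContinuousAt (fun t => g t - t * g' t) 0 :=
    hg.continuousAt.sub (continuousAt_id.mul hg'.continuousAt)
  have := tendsto_nhds_unique (hc.tendsto.mono_left nhdsWithin_le_nhds)
    (tendsto_const_nhds.congr' (hz.mono fun y hy => hy.symm))
  simp only [zero_mul, sub_zero] at this
  exact hg0 this

lemma eventually_comp_mul_eq {f₁ f₂ : ℂ → ℂ} {ψ : ℂ × ℂ → ℂ} {μ : ℂ} {n : ℕ}
    (hf₁ : AnalyticAt ℂ f₁ 0) (hf₂ : AnalyticAt ℂ f₂ 0) (hψ : AnalyticAt ℂ ψ 0)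
    (h1 : f₁ 0 = μ) (h2 : f₂ 0 = μ) (hμ : ∀ s : ℝ, (s : ℂ) = μ → 0 < s + n)
    (hψ0 : ψ 0 ≠ 0)
    (hD : ∀ᶠ p in 𝓝 (0 : ℂ × ℂ), fderiv ℂ ψ p (saddleField f₁ n p) =
      p.1 * ψ p * (f₂ (p.1 ^ n * (p.2 * ψ p)) - f₁ (p.1 ^ n * p.2))) :
    ∀ᶠ t in 𝓝 (0 : ℂ), f₂ (ψ 0 * t) = f₁ t := by
  set c := ψ 0 with hc
  have hr : AnalyticAt ℂ (fun x => ψ (x, 0) - c) 0 := hψ.comp_horizontal_axis.sub analyticAt_const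
  have hconst : ∀ᶠ x in 𝓝 (0 : ℂ), ψ (x, 0) - c = 0 := by
    refine eventually_eq_zero_of_mul_deriv_eq_mul (s := fun _ => 1) (h := fun _ => 0) hr
      (by simp [hc, Prod.zero_eq_mk]) continuousAt_const continuousAt_const (fun k hk => by
        simpa using hk.ne') ?_
    filter_upwards [tendsto_horizontal_axis.eventually hD,
        tendsto_horizontal_axis.eventually hψ.eventually_analyticAt] with x k1 k3
    rw [((hasDerivAt_horizontal k3.differentiableAt).sub_const c).deriv]
    have h4 : saddleField f₁ n (x, 0) = x ^ 2 • ((1 : ℂ), (0 : ℂ)) := by simp [saddleField]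
    simp only [h4, map_smul, smul_eq_mul, zero_mul, mul_zero, h1, h2, sub_self] at k1
    rcases eq_or_ne x 0 with rfl | hx
    · simp
    · rw [(mul_eq_zero.1 k1).resolve_left (pow_ne_zero 2 hx)]
      simp
  let χ : ℂ × ℂ → ℂ := fun p => ψ p * c⁻¹
  let f₃ : ℂ → ℂ := fun t => f₂ (c * t)
  have hf₃ : AnalyticAt ℂ f₃ 0 :=
    AnalyticAt.fun_comp (g := f₂) (by simpa using hf₂) (analyticAt_const.mul analyticAt_id)
  have hχ : AnalyticAt ℂ χ 0 := hψ.mul analyticAt_const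
  have hDχ : ∀ᶠ p in 𝓝 (0 : ℂ × ℂ), fderiv ℂ χ p (saddleField f₁ n p) =
      p.1 * χ p * (f₃ (p.1 ^ n * (p.2 * χ p)) - f₁ (p.1 ^ n * p.2)) := by
    filter_upwards [hD, hψ.eventually_analyticAt] with p k1 k2
    have h5 : c * (p.1 ^ n * (p.2 * χ p)) = p.1 ^ n * (p.2 * ψ p) := by
      simp only [χ]
      field_simp
    have h6 := (k2.differentiableAt.hasFDerivAt.mul_const c⁻¹).fderiv
    simp only [f₃, h5]
    rw [show fderiv ℂ χ p = c⁻¹ • fderiv ℂ ψ p from h6, smul_apply, k1]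
    simp only [χ, smul_eq_mul]
    ring
  have hflat := exists_flat_expansion hf₁ hf₃ hχ h1 (by simp [f₃, h2]) hμ
    (hconst.mono fun x hx => by
      simp only [χ, sub_eq_zero.1 hx]
      exact mul_inv_cancel₀ hψ0) hDχ
  have := AnalyticAt.eventually_eq_zero_of_flat (hf₃.sub hf₁) (fun m => by
    obtain ⟨R, g, -, hg, -, h⟩ := hflat m
    exact ⟨g, hg, h.mono fun t ht => by simp only [Pi.sub_apply, ht]; ring⟩)
  exact this.mono fun t ht => sub_eq_zero.1 ht

lemma exists_transversal_normalization {f₁ f₂ : ℂ → ℂ} {P Q u : ℂ × ℂ → ℂ} {n : ℕ}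
    (hf₁ : AnalyticAt ℂ f₁ 0) (hf₂ : AnalyticAt ℂ f₂ 0)
    (hP : AnalyticAt ℂ P 0) (hQ : AnalyticAt ℂ Q 0) (hu : AnalyticAt ℂ u 0)
    (hP0 : P 0 = 0) (hQ0 : Q 0 = 0) (hu0 : u 0 ≠ 0)
    (hPx : fderiv ℂ P 0 (1, 0) ≠ 0 ∨ fderiv ℂ Q 0 (1, 0) ≠ 0)
    (hQy : fderiv ℂ P 0 (0, 1) ≠ 0 ∨ fderiv ℂ Q 0 (0, 1) ≠ 0)
    (hDP : ∀ᶠ p in 𝓝 0, fderiv ℂ P p (saddleField f₁ n p) = u p * P p ^ 2)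
    (hDQ : ∀ᶠ p in 𝓝 0, fderiv ℂ Q p (saddleField f₁ n p) =
      u p * (Q p + P p * Q p * f₂ (P p ^ n * Q p))) :
    ∃ ψ : ℂ × ℂ → ℂ, AnalyticAt ℂ ψ 0 ∧ ψ 0 ≠ 0 ∧
      ∀ᶠ p in 𝓝 (0 : ℂ × ℂ), fderiv ℂ ψ p (saddleField f₁ n p) =
        p.1 * ψ p * (f₂ (p.1 ^ n * (p.2 * ψ p)) - f₁ (p.1 ^ n * p.2)) := by
  set v := saddleField f₁ n with hv
  have hva : AnalyticAt ℂ v 0 := hf₁.saddleField n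
  have hv0 : v 0 = 0 := by simp [hv, saddleField]
  have hvx : ∀ x, v (x, 0) = x ^ 2 • ((1 : ℂ), (0 : ℂ)) := fun x => by simp [hv, saddleField]
  have hvy : ∀ y, v (0, y) = y • ((0 : ℂ), (1 : ℂ)) := fun y => by simp [hv, saddleField]
  have hv2 : ∀ p, (v p).2 = p.2 * (1 + p.1 * f₁ (p.1 ^ n * p.2)) := fun p => by
    simp only [hv, saddleField]
    ring
  have hx : AnalyticAt ℂ (fun p : ℂ × ℂ => p.1) 0 := analyticAt_fst
  have hy : AnalyticAt ℂ (fun p : ℂ × ℂ => p.2) 0 := analyticAt_snd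
  have hf₁' : AnalyticAt ℂ (fun p : ℂ × ℂ => f₁ (p.1 ^ n * p.2)) 0 :=
    hf₁.comp_resonant n hx hy rfl
  have hf₂' : AnalyticAt ℂ (fun p : ℂ × ℂ => f₂ (P p ^ n * Q p)) 0 :=
    hf₂.comp_resonant n hP hQ hQ0
  have hPvert : ∀ᶠ y in 𝓝 (0 : ℂ), P (0, y) = 0 := by
    refine eventually_eq_zero_of_mul_deriv_eq_mul (s := fun _ => 1)
      (h := fun y => u (0, y) * P (0, y)) hP.comp_vertical_axis hP0 continuousAt_const
      (hu.comp_vertical_axis.mul hP.comp_vertical_axis).continuousAt (fun k hk => ?_) ?_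
    · rw [show P (0, 0) = 0 from hP0]
      simpa using hk.ne'
    · filter_upwards [tendsto_vertical_axis.eventually hDP,
        tendsto_vertical_axis.eventually hP.eventually_analyticAt] with y k1 k2
      rw [(hasDerivAt_vertical k2.differentiableAt).deriv]
      rw [hvy, map_smul, smul_eq_mul] at k1
      linear_combination k1
  have hQhor : ∀ᶠ x in 𝓝 (0 : ℂ), Q (x, 0) = 0 := by
    have hh : AnalyticAt ℂ (fun p => u p * (1 + P p * f₂ (P p ^ n * Q p))) 0 :=
      hu.mul (analyticAt_const.add (hP.mul hf₂'))
    refine eventually_eq_zero_of_mul_deriv_eq_mul (s := fun x => x)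
      (h := fun x => u (x, 0) * (1 + P (x, 0) * f₂ (P (x, 0) ^ n * Q (x, 0))))
      hQ.comp_horizontal_axis hQ0 continuousAt_id hh.comp_horizontal_axis.continuousAt
      (fun k hk => ?_) ?_
    · rw [show P (0, 0) = 0 from hP0]
      simpa using (show 0 ≠ u (0, 0) from hu0.symm)
    · filter_upwards [tendsto_horizontal_axis.eventually hDQ,
        tendsto_horizontal_axis.eventually hQ.eventually_analyticAt] with y k1 k2
      rw [(hasDerivAt_horizontal k2.differentiableAt).deriv]
      rw [hvx, map_smul, smul_eq_mul] at k1
      linear_combination k1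
  obtain ⟨A, hA, hPA⟩ := hP.exists_eq_fst_mul hPvert
  obtain ⟨B, hB, hQB⟩ := hQ.exists_eq_snd_mul hQhor
  have hA0 : A 0 ≠ 0 := by
    intro h0
    have h1 := fderiv_apply_of_eventuallyEq_fst_mul hA.differentiableAt hPA (1, 0)
    have h2 := fderiv_apply_of_eventuallyEq_snd_mul hB.differentiableAt hQB (1, 0)
    simp [h0] at h1 h2
    tauto
  have hB0 : B 0 ≠ 0 := by
    intro h0
    have h1 := fderiv_apply_of_eventuallyEq_fst_mul hA.differentiableAt hPA (0, 1)
    have h2 := fderiv_apply_of_eventuallyEq_snd_mul hB.differentiableAt hQB (0, 1)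
    simp [h0] at h1 h2
    tauto
  have hDA : ∀ᶠ p in 𝓝 (0 : ℂ × ℂ), p.1 * A p + fderiv ℂ A p (v p) - u p * p.1 * A p ^ 2 = 0 := by
    refine AnalyticAt.eventually_eq_zero_of_off_axes
      (((hx.mul hA).add (hA.fderiv_apply_field hva)).sub ((hu.mul hx).mul (hA.pow 2))) ?_
    filter_upwards [hDP, hPA, hPA.eventually_nhds, hA.eventually_analyticAt] with p k1 k2 k3 k4 hp _
    rw [fderiv_apply_of_eventuallyEq_fst_mul k4.differentiableAt k3, k2] at k1
    refine (mul_eq_zero.1 ?_).resolve_left hp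
    have : (v p).1 = p.1 ^ 2 := rfl
    rw [this] at k1
    linear_combination k1
  have hAvert : ∀ᶠ y in 𝓝 (0 : ℂ), A (0, y) - A 0 = 0 := by
    refine eventually_eq_zero_of_mul_deriv_eq_mul (s := fun _ => 1) (h := fun _ => 0)
      (hA.comp_vertical_axis.sub analyticAt_const) (sub_self _) continuousAt_const
      continuousAt_const (fun k hk => by simpa using hk.ne') ?_
    filter_upwards [tendsto_vertical_axis.eventually hDA,
        tendsto_vertical_axis.eventually hA.eventually_analyticAt] with y k1 k2
    rw [((hasDerivAt_vertical k2.differentiableAt).sub_const (A 0)).deriv]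
    rw [hvy, map_smul, smul_eq_mul] at k1
    linear_combination k1
  obtain ⟨a, ha, hAa⟩ := AnalyticAt.exists_eq_fst_mul (F := fun p => A p - A 0)
    (hA.sub analyticAt_const) hAvert
  have hDa : ∀ᶠ p in 𝓝 (0 : ℂ × ℂ),
      A p + p.1 * a p + fderiv ℂ a p (v p) - u p * A p ^ 2 = 0 := by
    refine AnalyticAt.eventually_eq_zero_of_off_axes
      (((hA.add (hx.mul ha)).add (ha.fderiv_apply_field hva)).sub (hu.mul (hA.pow 2))) ?_
    filter_upwards [hDA, hAa.eventually_nhds, ha.eventually_analyticAt] with p k1 k3 k4 hp _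
    have h1 := fderiv_apply_of_eventuallyEq_fst_mul k4.differentiableAt k3 (v p)
    rw [fderiv_sub_const] at h1
    refine (mul_eq_zero.1 ?_).resolve_left hp
    have : (v p).1 = p.1 ^ 2 := rfl
    rw [this] at h1
    linear_combination k1 - h1
  have hDB : ∀ᶠ p in 𝓝 (0 : ℂ × ℂ), (1 + p.1 * f₁ (p.1 ^ n * p.2)) * B p + fderiv ℂ B p (v p) -
      u p * (B p * (1 + P p * f₂ (P p ^ n * Q p))) = 0 := by
    refine AnalyticAt.eventually_eq_zero_of_off_axes
      ((((analyticAt_const.add (hx.mul hf₁')).mul hB).add (hB.fderiv_apply_field hva)).sub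
        (hu.mul (hB.mul (analyticAt_const.add (hP.mul hf₂'))))) ?_
    filter_upwards [hDQ, hQB, hQB.eventually_nhds, hB.eventually_analyticAt] with p k1 k2 k3 k4 _ hp
    rw [fderiv_apply_of_eventuallyEq_snd_mul k4.differentiableAt k3, hv2] at k1
    refine (mul_eq_zero.1 ?_).resolve_left hp
    linear_combination k1 + u p * (1 + P p * f₂ (P p ^ n * Q p)) * k2
  have hu1 : u 0 = 1 := by
    have := hDB.self_of_nhds
    simp only [hv0, map_zero, hP0, Prod.fst_zero, zero_mul, add_zero, one_mul, mul_one] at this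
    refine mul_right_cancel₀ hB0 ?_
    linear_combination -this
  have hA1 : A 0 = 1 := by
    have := hDa.self_of_nhds
    simp only [hv0, map_zero, Prod.fst_zero, zero_mul, add_zero, hu1] at this
    refine mul_right_cancel₀ hA0 ?_
    linear_combination -this
  let σ : ℂ × ℂ → ℂ := fun p => a p / A p
  have hσ : AnalyticAt ℂ σ 0 := ha.div hA hA0
  have hPσ : ∀ᶠ p in 𝓝 (0 : ℂ × ℂ), p.1 * (1 + σ p * P p) = P p := by
    filter_upwards [hPA, hAa, hA.continuousAt.eventually_ne hA0] with p k1 k2 k3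
    have h1 : σ p * P p = p.1 * a p := by
      simp only [σ, k1]
      field_simp
    rw [h1, k1, ← k2, hA1]
    ring
  obtain ⟨w, hw, hDφ⟩ := exists_slide_along_leaves hf₂ n hP hQ hσ hP0 hQ0 (fun p => rfl) hDP hDQ hPσ
  let ψ : ℂ × ℂ → ℂ := fun p => B p * Complex.exp (w p)
  have hψ : AnalyticAt ℂ ψ 0 := hB.mul hw.cexp
  refine ⟨ψ, hψ, mul_ne_zero hB0 (Complex.exp_ne_zero _), ?_⟩
  have hτ : AnalyticAt ℂ (fun p : ℂ × ℂ => f₂ (p.1 ^ n * (p.2 * ψ p))) 0 :=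
    hf₂.comp_resonant n hx (hy.mul hψ) (by simp)
  refine (AnalyticAt.eventually_eq_zero_of_off_axes ((hψ.fderiv_apply_field hva).sub
    ((hx.mul hψ).mul (hτ.sub hf₁'))) ?_).mono fun p hp => sub_eq_zero.1 hp
  filter_upwards [hDφ, hQB, hQB.eventually_nhds, hψ.eventually_analyticAt] with p k1 k2 k3 k4 hp1 hp2
  have h1 : ∀ᶠ q in 𝓝 p, Q q * Complex.exp (w q) = q.2 * ψ q := k3.mono fun q hq => by
    rw [hq]
    simp only [ψ]
    ring
  have h2 := k1 hp1
  rw [fderiv_apply_of_eventuallyEq_snd_mul k4.differentiableAt h1, hv2, h1.self_of_nhds] at h2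
  refine (mul_eq_zero.1 ?_).resolve_left hp2
  simp only [Pi.sub_apply, Pi.mul_apply]
  linear_combination h2

/-- **Theorem (uniqueness of the normal form `X_{f,n}` up to homothety).**
If two normal forms `X_{f₁,n}`, `X_{f₂,n}` with `f₁ 0 = f₂ 0 = μ`, where either
`μ ∉ ℝ` or `μ + n > 0`, are analytically equivalent as singular foliations, then
there is `c ≠ 0` with `f₂ t = f₁ (t / c)` for all `t` near `0`. -/
theorem saddleNode_unique_normal_form_unique
    (n : ℕ) (μ : ℂ) (f₁ f₂ : ℂ → ℂ) (hf₁ : AnalyticAt ℂ f₁ 0) (hf₂ : AnalyticAt ℂ f₂ 0)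
    (hf₁0 : f₁ 0 = μ) (hf₂0 : f₂ 0 = μ)
    (hμ : ∀ r : ℝ, (r : ℂ) = μ → 0 < r + n)
    (hequiv : FoliationEquiv
      (fun p => (p.1 ^ 2, p.2 + p.1 * p.2 * f₁ (p.1 ^ n * p.2)))
      (fun p => (p.1 ^ 2, p.2 + p.1 * p.2 * f₂ (p.1 ^ n * p.2)))) :
    ∃ c : ℂ, c ≠ 0 ∧ ∀ᶠ t in nhds (0 : ℂ), f₂ t = f₁ (t / c) := by
  obtain ⟨Φ, u, hΦ, hΦ0, hdet, hu, hu0, hD⟩ := hequiv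
  have hP : AnalyticAt ℂ (fun p => (Φ p).1) 0 :=
    AnalyticAt.fun_comp (g := Prod.fst) analyticAt_fst hΦ
  have hQ : AnalyticAt ℂ (fun p => (Φ p).2) 0 :=
    AnalyticAt.fun_comp (g := Prod.snd) analyticAt_snd hΦ
  have hfst : ∀ p w, AnalyticAt ℂ Φ p → fderiv ℂ (fun p => (Φ p).1) p w = (fderiv ℂ Φ p w).1 :=
    fun p w h => by rw [h.differentiableAt.hasFDerivAt.fst.fderiv]; rfl
  have hsnd : ∀ p w, AnalyticAt ℂ Φ p → fderiv ℂ (fun p => (Φ p).2) p w = (fderiv ℂ Φ p w).2 :=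
    fun p w h => by rw [h.differentiableAt.hasFDerivAt.snd.fderiv]; rfl
  have hinj : ∀ w : ℂ × ℂ, w ≠ 0 → fderiv ℂ (fun p => (Φ p).1) 0 w ≠ 0 ∨
      fderiv ℂ (fun p => (Φ p).2) 0 w ≠ 0 := by
    intro w hw
    rw [hfst 0 w hΦ, hsnd 0 w hΦ]
    by_contra! h
    have hker : w = 0 := by
      let e := LinearMap.equivOfDetNeZero _ hdet
      refine e.injective ?_
      rw [map_zero]
      exact Prod.ext h.1 h.2
    exact hw hker
  obtain ⟨ψ, hψ, hψ0, hDψ⟩ := exists_transversal_normalization (n := n) hf₁ hf₂ hP hQ hu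
    (by simp [hΦ0]) (by simp [hΦ0]) hu0 (hinj _ (by simp)) (hinj _ (by simp))
    (by
      filter_upwards [hD, hΦ.eventually_analyticAt] with p k1 k2
      rw [hfst _ _ k2]
      exact congrArg Prod.fst k1)
    (by
      filter_upwards [hD, hΦ.eventually_analyticAt] with p k1 k2
      rw [hsnd _ _ k2]
      exact congrArg Prod.snd k1)
  have hfin := eventually_comp_mul_eq hf₁ hf₂ hψ hf₁0 hf₂0 hμ hψ0 hDψ
  refine ⟨ψ 0, hψ0, ?_⟩
  have ht : Tendsto (fun t : ℂ => t / ψ 0) (𝓝 0) (𝓝 0) := by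
    have : Continuous (fun t : ℂ => t / ψ 0) := by fun_prop
    simpa using this.tendsto 0
  filter_upwards [ht.eventually hfin] with t h
  rwa [mul_div_cancel₀ _ hψ0] at h
end

section
/- Let k ≥ 1 be an integer and f a function holomorphic near 0 ∈ ℂ² with f(0,0) ≠ 0. Set F(x,y) = y + x·y^k·f(x,y) and F₀(x,y) = y + x·y^k. Then: (a) the map Φ₀(x,y) := (x·f(x,y), y) is a local biholomorphism at 0 (its derivative at 0 is invertible) and F = F₀ ∘ Φ₀ in a neighborhood of 0; (b) Φ₀ is the unique such map vanishing on the vertical axis: if φ̃ is holomorphic near 0 ∈ ℂ², the map Φ(x,y) = (x·φ̃(x,y), y) is a local biholomorphism at 0, ψ is holomorphic near 0 ∈ ℂ with ψ(0) = 0, and F₀ ∘ Φ = ψ ∘ F near 0, then Φ = Φ₀ and ψ(y) = y near 0. -/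
open Filter

/-- The differential at the origin of `(x, y) ↦ (x * f (x, y), y)` is `diag (f 0, 1)`. -/
theorem hasFDerivAt_fst_mul_prodMk_snd {f : ℂ × ℂ → ℂ} (hf : DifferentiableAt ℂ f 0) :
    HasFDerivAt (fun p : ℂ × ℂ => (p.1 * f p, p.2))
      ((f 0 • ContinuousLinearMap.id ℂ ℂ).prodMap (ContinuousLinearMap.id ℂ ℂ)) 0 := by
  have h := ((hasFDerivAt_fst (𝕜 := ℂ) (p := (0 : ℂ × ℂ))).mul hf.hasFDerivAt).prodMk
    (hasFDerivAt_snd (𝕜 := ℂ) (p := (0 : ℂ × ℂ)))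
  refine h.congr_fderiv ?_
  ext <;> simp

theorem det_fderiv_fst_mul_prodMk_snd {f : ℂ × ℂ → ℂ} (hf : DifferentiableAt ℂ f 0) :
    LinearMap.det (fderiv ℂ (fun p : ℂ × ℂ => (p.1 * f p, p.2)) 0).toLinearMap = f 0 := by
  rw [(hasFDerivAt_fst_mul_prodMk_snd hf).fderiv, ContinuousLinearMap.coe_prodMap,
    LinearMap.det_prodMap]
  simp

/-- A factor `y ^ k` can be cancelled from a continuous function vanishing near a point. -/
theorem eventually_eq_zero_of_mul_snd_pow {X 𝕜 : Type*} [TopologicalSpace X]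
    [NontriviallyNormedField 𝕜] {g : X × 𝕜 → 𝕜} {a : X × 𝕜} (k : ℕ)
    (hg : ∀ᶠ p in nhds a, ContinuousAt g p) (h : ∀ᶠ p in nhds a, g p * p.2 ^ k = 0) :
    ∀ᶠ p in nhds a, g p = 0 := by
  filter_upwards [hg, eventually_eventually_nhds.2 h] with p hp hz
  by_contra hne
  have hsnd : ∀ᶠ q in nhds p, q.2 = 0 := by
    filter_upwards [hz, hp.eventually_ne hne] with q hq hq'
    exact eq_zero_of_pow_eq_zero ((mul_eq_zero.1 hq).resolve_left hq')
  have hslice : ∀ᶠ t in nhds p.2, t = 0 :=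
    ((Continuous.prodMk_right p.1).tendsto p.2).eventually hsnd
  obtain ⟨t, ht, ht'⟩ := ((dense_compl_singleton (0 : 𝕜)).inter_nhds_nonempty hslice)
  exact ht ht'

/-- **Gluing Lemma (first integrals), local normalization.**
Let `F(x,y) = y + x·yᵏ·f(x,y)` with `f(0,0) ≠ 0` and let `F₀(x,y) = y + x·yᵏ`
be the model. Then:
(a) `Φ₀(x,y) = (x·f(x,y), y)` is a local biholomorphism at `0` and `F = F₀ ∘ Φ₀`
near `0`;
(b) `Φ₀` is unique among maps of the form `Φ(x,y) = (x·φ̃(x,y), y)`: if `Φ` is a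
local biholomorphism at `0`, `ψ(0) = 0` and `F₀ ∘ Φ = ψ ∘ F` near `0`, then
`Φ = Φ₀` and `ψ = id` near `0`. -/
theorem gluing_lemma_first_integral (k : ℕ) (hk : 1 ≤ k)
    (f : ℂ × ℂ → ℂ) (hf : AnalyticAt ℂ f 0) (hf0 : f 0 ≠ 0) :
    -- (a) existence
    (LinearMap.det ((fderiv ℂ (fun p : ℂ × ℂ => (p.1 * f p, p.2)) 0).toLinearMap) ≠ 0 ∧
      ∀ᶠ p in nhds (0 : ℂ × ℂ),
        p.2 + p.1 * p.2 ^ k * f p = (p.1 * f p) * p.2 ^ k + p.2) ∧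
    -- (b) uniqueness
    (∀ (φt : ℂ × ℂ → ℂ) (ψ : ℂ → ℂ), AnalyticAt ℂ φt 0 → AnalyticAt ℂ ψ 0 → ψ 0 = 0 →
      LinearMap.det ((fderiv ℂ (fun p : ℂ × ℂ => (p.1 * φt p, p.2)) 0).toLinearMap) ≠ 0 →
      (∀ᶠ p in nhds (0 : ℂ × ℂ),
        (p.1 * φt p) * p.2 ^ k + p.2 = ψ (p.2 + p.1 * p.2 ^ k * f p)) →
      (∀ᶠ p in nhds (0 : ℂ × ℂ),
          (p.1 * φt p, p.2) = ((p.1 * f p, p.2) : ℂ × ℂ)) ∧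
        ∀ᶠ y in nhds (0 : ℂ), ψ y = y) := by
  refine ⟨⟨?_, .of_forall fun p => by ring⟩, fun φt ψ hφ _ _ _ heq => ?_⟩
  · rwa [det_fderiv_fst_mul_prodMk_snd hf.differentiableAt]
  have hψ : ∀ᶠ y in nhds (0 : ℂ), ψ y = y := by
    have hy : Tendsto (fun y : ℂ => ((0 : ℂ), y)) (nhds 0) (nhds 0) :=
      (Continuous.prodMk_right (0 : ℂ)).tendsto 0
    filter_upwards [hy.eventually heq] with y h
    simpa using h.symm
  refine ⟨?_, hψ⟩
  have hF : Tendsto (fun p : ℂ × ℂ => p.2 + p.1 * p.2 ^ k * f p) (nhds 0) (nhds 0) := by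
    have hc : ContinuousAt (fun p : ℂ × ℂ => p.2 + p.1 * p.2 ^ k * f p) 0 := by
      have := hf.continuousAt
      fun_prop
    simpa [ContinuousAt] using hc
  have hzero : ∀ᶠ p in nhds (0 : ℂ × ℂ), p.1 * φt p - p.1 * f p = 0 := by
    refine eventually_eq_zero_of_mul_snd_pow k ?_ ?_
    · filter_upwards [hf.eventually_analyticAt, hφ.eventually_analyticAt] with p hp hp'
      have := hp.continuousAt
      have := hp'.continuousAt
      fun_prop
    · filter_upwards [heq, hF.eventually hψ] with p h h'
      linear_combination h.trans h'
  filter_upwards [hzero] with p hp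
  rw [sub_eq_zero.1 hp]
end
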